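/- Let n ≥ 1, κ_1,…,κ_{n+1} > −1/2, and suppose (P_{k,j})_{k≥0, 1≤j≤N_k} is a family of real algebraic polynomials on 𝕋^n such that deg P_{k,j} ≤ k, the family is orthonormal in L²(𝕋^n, μ), the polynomials {P_{k,j} : k ≤ m, 1 ≤ j ≤ N_k} span all polynomials of degree ≤ m for every m, and L_T P_{k,j} = −λ_k P_{k,j} on 𝕋^n for all k, j. Define e^{tL_T}(x,y) := Σ_{k≥0} e^{−λ_k t} Σ_{j=1}^{N_k} P_{k,j}(x) P_{k,j}(y). Then there exist constants c₁, c₂, c₃, c₄ > 0 such that for all x, y in the closed simplex and all t > 0: c₁ exp(−ρ(x,y)²/(c₂ t)) / √(V(x,√t) V(y,√t)) ≤ e^{tL_T}(x,y) ≤ c₃ exp(−ρ(x,y)²/(c₄ t)) / √(V(x,√t) V(y,√t)). -/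

import Mathlib

open MeasureTheory MvPolynomial Real

noncomputable section

/-- The open simplex `𝕋^n = {x ∈ ℝ^n : x_i > 0, |x| < 1}`. -/
def simplexSet (n : ℕ) : Set (Fin n → ℝ) := {x | (∀ i, 0 < x i) ∧ (∑ i, x i) < 1}

/-- The weight `Π_i x_i^{κ_i - 1/2} (1 - |x|)^{κ_{n+1} - 1/2}` on `𝕋^n`. -/
def simplexW (n : ℕ) (κ : Fin (n + 1) → ℝ) (x : Fin n → ℝ) : ℝ :=
  (∏ i : Fin n, (x i) ^ (κ i.castSucc - 1 / 2)) * (1 - ∑ i, x i) ^ (κ (Fin.last n) - 1 / 2)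

/-- The weighted measure `μ` on the simplex. -/
def simplexMeasure (n : ℕ) (κ : Fin (n + 1) → ℝ) : Measure (Fin n → ℝ) :=
  (volume.restrict (simplexSet n)).withDensity fun x => ENNReal.ofReal (simplexW n κ x)

/-- The distance `ρ(x,y) = arccos(Σ_i √(x_i y_i) + √(1-|x|)√(1-|y|))` on the simplex. -/
def simplexDist (n : ℕ) (x y : Fin n → ℝ) : ℝ :=
  Real.arccos ((∑ i, Real.sqrt (x i * y i)) +
    Real.sqrt (1 - ∑ i, x i) * Real.sqrt (1 - ∑ i, y i))

/-- `V(x,r) = μ({y ∈ 𝕋^n : ρ(x,y) < r})`. -/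
def simplexVol (n : ℕ) (κ : Fin (n + 1) → ℝ) (x : Fin n → ℝ) (r : ℝ) : ℝ :=
  (simplexMeasure n κ {y | simplexDist n x y < r}).toReal

/-- The differential operator
`L_T f = Σ_i x_i ∂_i² f − Σ_{i,j} x_i x_j ∂_i ∂_j f + Σ_i (κ_i + 1/2 − (|κ| + (n+1)/2) x_i) ∂_i f`
acting on polynomials. -/
def simplexOp (n : ℕ) (κ : Fin (n + 1) → ℝ) (f : MvPolynomial (Fin n) ℝ) :
    MvPolynomial (Fin n) ℝ :=
  (∑ i, X i * pderiv i (pderiv i f))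
    - (∑ i, ∑ j, X i * X j * pderiv i (pderiv j f))
    + ∑ i, (C (κ i.castSucc + 1 / 2) - C ((∑ j, κ j) + ((n : ℝ) + 1) / 2) * X i) * pderiv i f

/-- The eigenvalues `λ_k = k(k + |κ| + (n−1)/2)`. -/
def simplexEig (n : ℕ) (κ : Fin (n + 1) → ℝ) (k : ℕ) : ℝ :=
  k * (k + (∑ j, κ j) + ((n : ℝ) - 1) / 2)

/-- `N_k = C(k+n-1, k)` (equal to `1` when `k = 0`). -/
def simplexNk (n k : ℕ) : ℕ := (k + n - 1).choose k

/-- The heat kernel `e^{tL_T}(x,y) = Σ_k e^{-λ_k t} Σ_j P_{k,j}(x) P_{k,j}(y)`. -/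
def simplexHeat (n : ℕ) (κ : Fin (n + 1) → ℝ)
    (P : (k : ℕ) → Fin (simplexNk n k) → MvPolynomial (Fin n) ℝ)
    (t : ℝ) (x y : Fin n → ℝ) : ℝ :=
  ∑' k : ℕ, Real.exp (-(simplexEig n κ k) * t) * ∑ j, eval x (P k j) * eval y (P k j)

/-- `G` is a supersolution of the backward equation of a pure death chain with rates `r`. -/
def DeathSuper (r : ℕ → ℝ) (G : ℕ → ℝ → ℝ) : Prop :=
  ∃ G' : ℕ → ℝ → ℝ, (∀ m, ∀ t, 0 ≤ t → HasDerivAt (G m) (G' m t) t) ∧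
    (∀ t, 0 ≤ t → 0 ≤ G' 0 t) ∧
    ∀ m, ∀ t, 0 ≤ t → r (m + 1) * (G m t - G (m + 1) t) ≤ G' (m + 1) t

/-- `U` solves the backward equation of a pure death chain with rates `r`. -/
def DeathSol (r : ℕ → ℝ) (U : ℕ → ℝ → ℝ) : Prop :=
  DeathSuper r U ∧ DeathSuper r (fun m t => -U m t)

theorem death_nonneg_of_le {r : ℕ → ℝ} {M : ℕ} {T : ℝ} {W W' : ℕ → ℝ → ℝ}
    (hd : ∀ m ≤ M, ∀ t ∈ Set.Icc 0 T, HasDerivAt (W m) (W' m t) t)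
    (h0 : ∀ m ≤ M, 0 ≤ W m 0)
    (hz : ∀ t ∈ Set.Icc 0 T, 0 ≤ W' 0 t)
    (hr : ∀ m, 0 ≤ r m)
    (hs : ∀ m, m + 1 ≤ M → ∀ t ∈ Set.Icc 0 T,
      r (m + 1) * (W m t - W (m + 1) t) ≤ W' (m + 1) t) :
    ∀ m ≤ M, ∀ t ∈ Set.Icc 0 T, 0 ≤ W m t := by
  have key : ∀ (V V' : ℝ → ℝ) (q : ℝ), (∀ t ∈ Set.Icc 0 T, HasDerivAt V (V' t) t) →
      0 ≤ V 0 → (∀ t ∈ Set.Icc 0 T, -(q * V t) ≤ V' t) → ∀ t ∈ Set.Icc 0 T, 0 ≤ V t := by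
    intro V V' q hV hV0 hq t ht
    have hder : ∀ x ∈ Set.Icc 0 T, HasDerivAt (fun x => exp (q * x) * V x)
        (exp (q * x) * q * V x + exp (q * x) * V' x) x := fun x hx => by
      have h1 : HasDerivAt (fun x : ℝ => exp (q * x)) (exp (q * x) * q) x := by
        simpa using ((hasDerivAt_id x).const_mul q).exp
      exact h1.mul (hV x hx)
    have hmono : MonotoneOn (fun x => exp (q * x) * V x) (Set.Icc 0 T) := by
      apply monotoneOn_of_deriv_nonneg (convex_Icc 0 T)
      · exact fun x hx => (hder x hx).continuousAt.continuousWithinAt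
      · exact fun x hx =>
          (hder x (interior_subset hx)).differentiableAt.differentiableWithinAt
      · intro x hx
        rw [(hder x (interior_subset hx)).deriv]
        have := hq x (interior_subset hx)
        nlinarith [exp_pos (q * x)]
    have h := hmono (Set.left_mem_Icc.2 (ht.1.trans ht.2)) ht ht.1
    simp only [mul_zero, exp_zero, one_mul] at h
    exact nonneg_of_mul_nonneg_right (hV0.trans h) (exp_pos _)
  intro m
  induction m with
  | zero =>
    intro hm
    exact key (W 0) (W' 0) 0 (hd 0 hm) (h0 0 hm) (fun t ht => by simpa using hz t ht)
  | succ m ih =>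
    intro hm
    refine key (W (m + 1)) (W' (m + 1)) (r (m + 1)) (hd _ hm) (h0 _ hm) fun t ht => ?_
    have h1 := ih (by omega) t ht
    have h2 := hs m hm t ht
    nlinarith [hr (m + 1), mul_nonneg (hr (m + 1)) h1]

namespace DeathSuper

variable {r : ℕ → ℝ} {G H : ℕ → ℝ → ℝ}

theorem nonneg (hr : ∀ m, 0 ≤ r m) (hG : DeathSuper r G) (h0 : ∀ m, 0 ≤ G m 0) (m : ℕ) {t : ℝ}
    (ht : 0 ≤ t) : 0 ≤ G m t := by
  obtain ⟨G', h1, h2, h3⟩ := hG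
  exact death_nonneg_of_le (M := m) (T := t) (fun m _ t ht => h1 m t ht.1) (fun m _ => h0 m)
    (fun t ht => h2 t ht.1) hr (fun m _ t ht => h3 m t ht.1) m le_rfl t ⟨ht, le_rfl⟩

theorem add (hG : DeathSuper r G) (hH : DeathSuper r H) :
    DeathSuper r (fun m t => G m t + H m t) := by
  obtain ⟨G', h1, h2, h3⟩ := hG
  obtain ⟨H', k1, k2, k3⟩ := hH
  refine ⟨fun m t => G' m t + H' m t, fun m t ht => (h1 m t ht).add (k1 m t ht),
    fun t ht => add_nonneg (h2 t ht) (k2 t ht), fun m t ht => ?_⟩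
  have := h3 m t ht
  have := k3 m t ht
  linarith

theorem const_mul (hG : DeathSuper r G) {a : ℝ} (ha : 0 ≤ a) :
    DeathSuper r (fun m t => a * G m t) := by
  obtain ⟨G', h1, h2, h3⟩ := hG
  refine ⟨fun m t => a * G' m t, fun m t ht => (h1 m t ht).const_mul a,
    fun t ht => mul_nonneg ha (h2 t ht), fun m t ht => ?_⟩
  have := mul_le_mul_of_nonneg_left (h3 m t ht) ha
  linarith

theorem const (a : ℝ) : DeathSuper r (fun _ _ => a) :=
  ⟨fun _ _ => 0, fun _ t _ => hasDerivAt_const t a, fun _ _ => le_rfl, fun _ _ _ => by simp⟩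

theorem shift (hG : DeathSuper r G) {s : ℝ} (hs : 0 ≤ s) :
    DeathSuper r (fun m t => G m (t + s)) := by
  obtain ⟨G', h1, h2, h3⟩ := hG
  exact ⟨fun m t => G' m (t + s), fun m t ht => (h1 m (t + s) (by linarith)).comp_add_const t s,
    fun t ht => h2 _ (by linarith), fun m t ht => h3 m _ (by linarith)⟩

end DeathSuper

/-- The death rates `m (m + θ - 1)`. -/
def deathRate (θ : ℝ) (m : ℕ) : ℝ := m * (m + θ - 1)

theorem deathRate_nonneg {θ : ℝ} (hθ : 0 < θ) (m : ℕ) : 0 ≤ deathRate θ m := by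
  rcases m with _ | m
  · simp [deathRate]
  · unfold deathRate
    push_cast
    have : (0 : ℝ) ≤ m := m.cast_nonneg
    apply mul_nonneg <;> linarith

theorem deathRate_succ (θ : ℝ) (m : ℕ) :
    deathRate θ (m + 1) = (m + 1) * (m + θ) := by
  unfold deathRate; push_cast; ring

theorem deathSuper_exp {θ : ℝ} (hθ : 0 < θ) {s : ℝ} (hs : 0 ≤ s) (hs1 : s ≤ 1) :
    DeathSuper (deathRate θ)
      (fun m t => exp (-s / (1 / ((m : ℝ) + 1) + 2 * (1 + θ) * t))) := by
  have hpos : ∀ (m : ℕ) (t : ℝ), 0 ≤ t → 0 < 1 / ((m : ℝ) + 1) + 2 * (1 + θ) * t :=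
    fun m t ht => by positivity
  have hderiv : ∀ (m : ℕ) (t : ℝ), 0 ≤ t → HasDerivAt
      (fun t => exp (-s / (1 / ((m : ℝ) + 1) + 2 * (1 + θ) * t)))
      (exp (-s / (1 / ((m : ℝ) + 1) + 2 * (1 + θ) * t)) *
        (s * (2 * (1 + θ)) / (1 / ((m : ℝ) + 1) + 2 * (1 + θ) * t) ^ 2)) t := by
    intro m t ht
    have h1 : HasDerivAt (fun t : ℝ => 1 / ((m : ℝ) + 1) + 2 * (1 + θ) * t) (2 * (1 + θ)) t := by
      simpa using ((hasDerivAt_id t).const_mul (2 * (1 + θ))).const_add (1 / ((m : ℝ) + 1))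
    have h2 := ((hasDerivAt_const t (-s)).div h1 (hpos m t ht).ne').exp
    refine h2.congr_deriv ?_
    rw [Pi.div_apply]
    ring
  refine ⟨_, hderiv, fun t ht => by positivity, fun m t ht => ?_⟩
  have hA := hpos m t ht
  have hB := hpos (m + 1) t ht
  push_cast at hB ⊢
  set A := 1 / ((m : ℝ) + 1) + 2 * (1 + θ) * t with hAdef
  set B := 1 / ((m : ℝ) + 1 + 1) + 2 * (1 + θ) * t with hBdef
  have hm : (0 : ℝ) ≤ m := m.cast_nonneg
  have hAB : A - B = 1 / (((m : ℝ) + 1) * (m + 2)) := by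
    rw [hAdef, hBdef]; field_simp; ring
  have hAB0 : 0 < A - B := by rw [hAB]; positivity
  have hΔ : 1 / B - 1 / A = (A - B) / (A * B) := by field_simp
  have hΔ0 : 0 ≤ (A - B) / (A * B) := by positivity
  have hΔ1 : (A - B) / (A * B) ≤ 1 := by
    rw [div_le_one (by positivity), hAB]
    have h1 : 1 / ((m : ℝ) + 1) ≤ A := by rw [hAdef]; have : 0 ≤ 2 * (1 + θ) * t := by positivity
                                          linarith
    have h2 : 1 / ((m : ℝ) + 1 + 1) ≤ B := by
      rw [hBdef]; have : 0 ≤ 2 * (1 + θ) * t := by positivity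
      linarith
    calc 1 / (((m : ℝ) + 1) * (m + 2)) = 1 / ((m : ℝ) + 1) * (1 / ((m : ℝ) + 1 + 1)) := by
          field_simp; ring
      _ ≤ A * B := mul_le_mul h1 h2 (by positivity) hA.le
  have hΔ2 : (A - B) / (A * B) ≤ (A - B) / B ^ 2 := by
    apply div_le_div_of_nonneg_left hAB0.le (by positivity)
    rw [sq]; exact mul_le_mul_of_nonneg_right (by linarith) hB.le
  have hexp : exp (-s / A) = exp (-s / B) * exp (s * ((A - B) / (A * B))) := by
    rw [← exp_add, ← hΔ]; congr 1; ring
  have hsΔ : |s * ((A - B) / (A * B))| ≤ 1 := by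
    rw [abs_of_nonneg (by positivity)]
    calc s * ((A - B) / (A * B)) ≤ 1 * 1 := mul_le_mul hs1 hΔ1 hΔ0 zero_le_one
      _ = 1 := one_mul 1
  have h3 := abs_le.1 (Real.abs_exp_sub_one_le hsΔ)
  rw [abs_of_nonneg (show 0 ≤ s * ((A - B) / (A * B)) by positivity)] at h3
  rw [hexp, deathRate_succ]
  have h4 : ((m : ℝ) + 1) * (m + θ) * (A - B) ≤ 1 + θ := by
    rw [hAB, mul_one_div, div_le_iff₀ (by positivity)]
    nlinarith [mul_nonneg hm hθ.le, mul_nonneg hm hm, mul_nonneg (mul_nonneg hm hm) hθ.le]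
  calc ((m : ℝ) + 1) * (m + θ) * (exp (-s / B) * exp (s * ((A - B) / (A * B))) - exp (-s / B))
      = exp (-s / B) * (((m : ℝ) + 1) * (m + θ) * (exp (s * ((A - B) / (A * B))) - 1)) := by ring
    _ ≤ exp (-s / B) * (((m : ℝ) + 1) * (m + θ) * (2 * (s * ((A - B) / B ^ 2)))) := by
        gcongr
        exact h3.2.trans (by gcongr)
    _ = exp (-s / B) * (2 * s * (((m : ℝ) + 1) * (m + θ) * (A - B)) / B ^ 2) := by ring
    _ ≤ exp (-s / B) * (2 * s * (1 + θ) / B ^ 2) := by gcongr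
    _ = _ := by ring

theorem pow_succ_sub_le {a b : ℝ} (hb : 0 ≤ b) (hab : b ≤ a) (k : ℕ) :
    a ^ (k + 1) - b ^ (k + 1) ≤ (k + 1) * (a - b) * a ^ k := by
  induction k with
  | zero => simp
  | succ k ih =>
    have ha : 0 ≤ a := hb.trans hab
    have h1 : b ^ (k + 1) ≤ a ^ (k + 1) := pow_le_pow_left₀ hb hab _
    have h2 := mul_le_mul_of_nonneg_left ih ha
    have h3 := mul_le_mul_of_nonneg_left h1 (sub_nonneg.2 hab)
    push_cast
    have e1 : a ^ (k + 2) = a * a ^ (k + 1) := by ring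
    have e2 : b ^ (k + 2) = b * b ^ (k + 1) := by ring
    have e3 : a ^ (k + 1) = a * a ^ k := by ring
    rw [show k + 1 + 1 = k + 2 by ring, e1, e2]
    have e4 : a * ((↑k + 1) * (a - b) * a ^ k) = (↑k + 1) * (a - b) * a ^ (k + 1) := by
      rw [e3]; ring
    rw [e4] at h2
    linarith

theorem deathSuper_inv_pow {θ : ℝ} (hθ : 0 < θ) (k : ℕ) :
    DeathSuper (deathRate θ)
      (fun m t => (1 / ((m : ℝ) + 1) + (1 + θ) * 2 ^ k * t) ^ (k + 1)) := by
  have hderiv : ∀ (m : ℕ) (t : ℝ), 0 ≤ t → HasDerivAt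
      (fun t => (1 / ((m : ℝ) + 1) + (1 + θ) * 2 ^ k * t) ^ (k + 1))
      ((k + 1) * (1 / ((m : ℝ) + 1) + (1 + θ) * 2 ^ k * t) ^ k * ((1 + θ) * 2 ^ k)) t := by
    intro m t ht
    have h1 : HasDerivAt (fun t : ℝ => 1 / ((m : ℝ) + 1) + (1 + θ) * 2 ^ k * t)
        ((1 + θ) * 2 ^ k) t := by
      simpa using ((hasDerivAt_id t).const_mul ((1 + θ) * 2 ^ k)).const_add (1 / ((m : ℝ) + 1))
    refine (h1.pow (k + 1)).congr_deriv ?_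
    push_cast
    simp
  refine ⟨_, hderiv, fun t ht => by positivity, fun m t ht => ?_⟩
  have hm : (0 : ℝ) ≤ m := m.cast_nonneg
  push_cast
  set A := 1 / ((m : ℝ) + 1) + (1 + θ) * 2 ^ k * t with hAdef
  set B := 1 / ((m : ℝ) + 1 + 1) + (1 + θ) * 2 ^ k * t with hBdef
  have hct : 0 ≤ (1 + θ) * 2 ^ k * t := by positivity
  have hB : 0 < B := by rw [hBdef]; positivity
  have hAB : A - B = 1 / (((m : ℝ) + 1) * (m + 2)) := by
    rw [hAdef, hBdef]; field_simp; ring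
  have hAB0 : 0 < A - B := by rw [hAB]; positivity
  have hA2 : A ≤ 2 * B := by
    have : 1 / ((m : ℝ) + 1) ≤ 2 * (1 / ((m : ℝ) + 1 + 1)) := by
      rw [mul_one_div, div_le_div_iff₀ (by positivity) (by positivity)]; linarith
    rw [hAdef, hBdef]; linarith
  have hA : 0 < A := by linarith
  rw [deathRate_succ]
  have h4 : ((m : ℝ) + 1) * (m + θ) * (A - B) ≤ 1 + θ := by
    rw [hAB, mul_one_div, div_le_iff₀ (by positivity)]
    nlinarith [mul_nonneg hm hθ.le, mul_nonneg hm hm, mul_nonneg (mul_nonneg hm hm) hθ.le]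
  calc ((m : ℝ) + 1) * (m + θ) * (A ^ (k + 1) - B ^ (k + 1))
      ≤ ((m : ℝ) + 1) * (m + θ) * ((k + 1) * (A - B) * A ^ k) := by
        gcongr
        exact pow_succ_sub_le hB.le (by linarith) k
    _ = ((m : ℝ) + 1) * (m + θ) * (A - B) * ((k + 1) * A ^ k) := by ring
    _ ≤ (1 + θ) * ((k + 1) * (2 * B) ^ k) := by gcongr
    _ = _ := by rw [mul_pow]; ring

theorem deathSuper_pow {θ : ℝ} (hθ : 0 < θ) (k : ℕ) :
    DeathSuper (deathRate θ)
      (fun m t => ((m : ℝ) / (1 + min 1 θ / (k + 1) * m * t)) ^ (k + 1)) := by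
  set c := min 1 θ / ((k : ℝ) + 1) with hc
  have hc0 : 0 < c := by have : 0 < min 1 θ := lt_min one_pos hθ
                         positivity
  have hderiv : ∀ (m : ℕ) (t : ℝ), 0 ≤ t → HasDerivAt
      (fun t => ((m : ℝ) / (1 + c * m * t)) ^ (k + 1))
      (-((k + 1) * c * ((m : ℝ) / (1 + c * m * t)) ^ (k + 2))) t := by
    intro m t ht
    have h1 : HasDerivAt (fun t : ℝ => 1 + c * m * t) (c * m) t := by
      simpa using ((hasDerivAt_id t).const_mul (c * m)).const_add 1
    have hne : 1 + c * m * t ≠ 0 := by positivity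
    have h2 := ((hasDerivAt_const t (m : ℝ)).div h1 hne).pow (k + 1)
    refine h2.congr_deriv ?_
    push_cast
    simp only [Pi.div_apply]
    rw [pow_add _ k 2]
    field_simp
    ring
  refine ⟨_, hderiv, fun t ht => by simp, fun m t ht => ?_⟩
  have hm : (0 : ℝ) ≤ m := m.cast_nonneg
  push_cast
  have hDx : 0 < 1 + c * ((m : ℝ) + 1) * t := by positivity
  have hDy : 0 < 1 + c * (m : ℝ) * t := by positivity
  set x := ((m : ℝ) + 1) / (1 + c * (m + 1) * t) with hx
  set y := (m : ℝ) / (1 + c * m * t) with hy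
  have hx0 : 0 < x := by positivity
  have hy0 : 0 ≤ y := by positivity
  have hxy : x ^ 2 / ((m : ℝ) + 1) ^ 2 ≤ x - y := by
    have e1 : x - y = 1 / ((1 + c * (m + 1) * t) * (1 + c * m * t)) := by
      rw [hx, hy]; field_simp; ring
    have e2 : x ^ 2 / ((m : ℝ) + 1) ^ 2 =
        1 / ((1 + c * (m + 1) * t) * (1 + c * (m + 1) * t)) := by
      rw [hx]; field_simp
    rw [e1, e2]
    apply one_div_le_one_div_of_le (by positivity)
    gcongr
    linarith
  have hyx : y ≤ x := by
    have : 0 ≤ x ^ 2 / ((m : ℝ) + 1) ^ 2 := by positivity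
    linarith
  have h1 : (x - y) * x ^ k ≤ x ^ (k + 1) - y ^ (k + 1) := by
    have : y ^ k ≤ x ^ k := pow_le_pow_left₀ hy0 hyx k
    have := mul_le_mul_of_nonneg_left this hy0
    rw [pow_succ, pow_succ]; linarith
  have hr : min 1 θ * ((m : ℝ) + 1) ^ 2 ≤ deathRate θ (m + 1) := by
    rw [deathRate_succ, sq]
    have a1 : min 1 θ * (m : ℝ) ≤ m := mul_le_of_le_one_left hm (min_le_left _ _)
    have a2 := min_le_right 1 θ
    nlinarith
  have hcm : (k + 1) * c = min 1 θ := by rw [hc]; field_simp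
  have hr0 := deathRate_nonneg hθ (m + 1)
  have h2 : (k + 1) * c * x ^ (k + 2) ≤ deathRate θ (m + 1) * (x ^ (k + 1) - y ^ (k + 1)) := by
    calc (k + 1) * c * x ^ (k + 2)
        = min 1 θ * ((m : ℝ) + 1) ^ 2 * (x ^ 2 / ((m : ℝ) + 1) ^ 2 * x ^ k) := by
          rw [hcm, pow_add]; field_simp
      _ ≤ deathRate θ (m + 1) * ((x - y) * x ^ k) := by gcongr
      _ ≤ _ := by gcongr
  linarith

theorem DeathSuper.le_of_sol {r : ℕ → ℝ} {G U : ℕ → ℝ → ℝ} (hr : ∀ m, 0 ≤ r m)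
    (hG : DeathSuper r G) (hU : DeathSol r U) (h0 : ∀ m, U m 0 ≤ G m 0) (m : ℕ) {t : ℝ}
    (ht : 0 ≤ t) : U m t ≤ G m t := by
  have := (hG.add hU.2).nonneg hr (fun m => by have := h0 m; linarith) m ht
  linarith

theorem deathSol_upper {θ : ℝ} (hθ : 0 < θ) (k : ℕ) :
    ∃ C > 0, ∃ c > 0, ∀ U : ℕ → ℝ → ℝ, DeathSol (deathRate θ) U → ∀ B s t : ℝ, 0 ≤ B → 0 ≤ s →
      s ≤ 1 / 2 → 0 < t →
      (∀ m : ℕ, U m 0 ≤ B * (exp (-s * (m + 1)) *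
        ((((m : ℝ) + 1) / (1 + 1 / t)) ^ (k + 1) + ((1 + 1 / t) / ((m : ℝ) + 1)) ^ (k + 1)))) →
      ∀ m : ℕ, 1 / t ≤ (m : ℝ) + 1 → U m t ≤ C * B * exp (-c * s / t) := by
  set C0 : ℝ := 2 * (1 + θ) with hC0
  set C1 : ℝ := (1 + θ) * 2 ^ (2 * k + 1) with hC1
  set c1 : ℝ := min 1 θ / ((2 * k + 1 : ℕ) + 1) with hc1
  have hc1p : 0 < c1 := by have : 0 < min 1 θ := lt_min one_pos hθ
                           positivity
  set N : ℕ := 2 * k + 2 with hN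
  set D : ℝ := 2 ^ N * ((1 / c1) ^ N + 1) + (2 ^ N + (2 * (1 + C1)) ^ N) with hD
  have hDp : 0 < D := by positivity
  refine ⟨1 + D, by positivity, 1 / (1 + C0), by positivity, ?_⟩
  intro U hU B s t hB hs hs2 ht h0 m hm
  set l : ℝ := exp (s / ((1 + C0) * t)) with hl
  have hlp : 0 < l := exp_pos _
  have hr := deathRate_nonneg hθ
  obtain ⟨H, hH, hH0, hHt⟩ : ∃ H : ℕ → ℝ → ℝ, DeathSuper (deathRate θ) H ∧
      (∀ m : ℕ, ((1 + 1 / t) / ((m : ℝ) + 1)) ^ N ≤ H m 0) ∧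
      H m t ≤ 2 ^ N + (2 * (1 + C1)) ^ N := by
    rcases le_total 1 t with h | h
    · refine ⟨fun _ _ => 2 ^ N, DeathSuper.const _, fun m => ?_, ?_⟩
      · have h1 : 1 / t ≤ 1 := by rw [div_le_one ht]; exact h
        have : (1 + 1 / t) / ((m : ℝ) + 1) ≤ 2 := by
          rw [div_le_iff₀ (by positivity)]
          have : (0 : ℝ) ≤ m := m.cast_nonneg
          linarith
        exact pow_le_pow_left₀ (by positivity) this _
      · have : 0 ≤ (2 * (1 + C1)) ^ N := by positivity
        linarith
    · refine ⟨_, (deathSuper_inv_pow hθ (2 * k + 1)).const_mul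
        (a := (1 + 1 / t) ^ N) (by positivity), fun m => ?_, ?_⟩
      · simp only [mul_zero, add_zero]
        rw [← mul_pow, mul_one_div]
      · have h1 : 1 / ((m : ℝ) + 1) ≤ t := by
          rw [div_le_iff₀ (by positivity)]
          rw [div_le_iff₀ ht] at hm
          linarith
        have h2 : 1 / ((m : ℝ) + 1) + C1 * t ≤ (1 + C1) * t := by linarith
        have h3 : 1 + 1 / t ≤ 2 / t := by
          rw [le_div_iff₀ ht]; field_simp; linarith
        have : (1 + 1 / t) ^ N * (1 / ((m : ℝ) + 1) + C1 * t) ^ N ≤ (2 * (1 + C1)) ^ N := by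
          rw [← mul_pow]
          apply pow_le_pow_left₀ (by positivity)
          calc (1 + 1 / t) * (1 / ((m : ℝ) + 1) + C1 * t) ≤ 2 / t * ((1 + C1) * t) := by gcongr
            _ = 2 * (1 + C1) := by field_simp
        have h4 : (0 : ℝ) ≤ 2 ^ N := by positivity
        calc _ ≤ (2 * (1 + C1)) ^ N := this
          _ ≤ _ := by linarith
  have hpos := ((deathSuper_pow hθ (2 * k + 1)).add (DeathSuper.const 1)).const_mul
    (a := 2 ^ N / (1 + 1 / t) ^ N) (by positivity)
  have hexp := (deathSuper_exp hθ (s := 2 * s) (by linarith) (by linarith)).const_mul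
    (a := l / 2) (by positivity)
  have hG := ((hexp.add ((hpos.add hH).const_mul (a := 1 / l) (by positivity))).const_mul hB)
  refine (hG.le_of_sol hr hU (fun j => (h0 j).trans ?_) m ht.le).trans ?_
  · have hb := hH0 j
    apply mul_le_mul_of_nonneg_left _ hB
    set a := exp (-s * (j + 1)) with ha
    have ha2 : exp (-(2 * s) / (1 / ((j : ℝ) + 1) + 2 * (1 + θ) * 0)) = a ^ 2 := by
      rw [ha, ← exp_nat_mul]; congr 1; push_cast; field_simp; ring
    set x := (((j : ℝ) + 1) / (1 + 1 / t)) ^ (k + 1) with hx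
    set y := ((1 + 1 / t) / ((j : ℝ) + 1)) ^ (k + 1) with hy
    have hx2 : x ^ 2 ≤ 2 ^ N / (1 + 1 / t) ^ N * (((j : ℝ)) ^ N + 1) := by
      rw [hx, ← pow_mul, show (k + 1) * 2 = N by omega, div_pow, div_mul_eq_mul_div]
      gcongr
      have hj : (0 : ℝ) ≤ j := j.cast_nonneg
      rcases le_total (j : ℝ) 1 with h | h
      · have h1 : ((j : ℝ) + 1) ^ N ≤ 2 ^ N := pow_le_pow_left₀ (by positivity) (by linarith) _
        have h2 : (0 : ℝ) ≤ 2 ^ N * (j : ℝ) ^ N := by positivity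
        linarith
      · have h1 : ((j : ℝ) + 1) ^ N ≤ (2 * j) ^ N := pow_le_pow_left₀ (by positivity) (by linarith) _
        have h2 : (0 : ℝ) ≤ 2 ^ N := by positivity
        rw [mul_pow] at h1
        linarith
    have hy2 : y ^ 2 ≤ H j 0 := by
      rw [hy, ← pow_mul, show (k + 1) * 2 = N by omega]; exact hb
    rw [ha2]
    have e : ((j : ℝ) / (1 + min 1 θ / ((2 * k + 1 : ℕ) + 1) * j * 0)) ^ (2 * k + 1 + 1) = (j : ℝ) ^ N := by
      simp [hN]
    rw [e]
    set Q := 2 ^ N / (1 + 1 / t) ^ N * (((j : ℝ)) ^ N + 1) + H j 0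
    have hxy : (x + y) ^ 2 ≤ 2 * Q := by nlinarith [sq_nonneg (x - y)]
    have key : a * (x + y) ≤ l / 2 * a ^ 2 + 1 / (2 * l) * (x + y) ^ 2 := by
      have : l / 2 * a ^ 2 + 1 / (2 * l) * (x + y) ^ 2 - a * (x + y) =
          1 / (2 * l) * (l * a - (x + y)) ^ 2 := by field_simp; ring
      have h2 : 0 ≤ 1 / (2 * l) * (l * a - (x + y)) ^ 2 := by positivity
      linarith
    calc a * (x + y) ≤ l / 2 * a ^ 2 + 1 / (2 * l) * (2 * Q) := by
          refine key.trans ?_; gcongr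
      _ = l / 2 * a ^ 2 + 1 / l * Q := by field_simp
  · have hC0p : 0 < C0 := by positivity
    have h1 : 1 / ((m : ℝ) + 1) ≤ t := by
      rw [div_le_iff₀ (by positivity)]
      rw [div_le_iff₀ ht] at hm
      linarith
    have hE : exp (-(2 * s) / (1 / ((m : ℝ) + 1) + C0 * t)) ≤ (1 / l) ^ 2 := by
      rw [hl, one_div (exp _), ← exp_neg, ← exp_nat_mul]
      apply exp_le_exp.2
      push_cast
      rw [show (2 : ℝ) * -(s / ((1 + C0) * t)) = -(2 * s / ((1 + C0) * t)) by ring, neg_div]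
      apply neg_le_neg
      apply div_le_div_of_nonneg_left (by linarith) (by positivity)
      linarith
    have hP : 2 ^ N / (1 + 1 / t) ^ N * (((m : ℝ) / (1 + c1 * m * t)) ^ N + 1) ≤
        2 ^ N * ((1 / c1) ^ N + 1) := by
      have h3 : (m : ℝ) / (1 + c1 * m * t) ≤ 1 / (c1 * t) := by
        rw [div_le_div_iff₀ (by positivity) (by positivity)]; nlinarith
      have h4 : ((m : ℝ) / (1 + c1 * m * t)) ^ N ≤ (1 / c1) ^ N * (1 + 1 / t) ^ N := by
        rw [← mul_pow]
        apply pow_le_pow_left₀ (by positivity)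
        refine h3.trans ?_
        rw [show 1 / (c1 * t) = 1 / c1 * (1 / t) by field_simp]
        gcongr
        linarith
      have h5 : (1 : ℝ) ≤ (1 + 1 / t) ^ N := one_le_pow₀ (by have : 0 < 1 / t := by positivity
                                                             linarith)
      rw [div_mul_eq_mul_div, div_le_iff₀ (by positivity), mul_assoc (2 ^ N)]
      apply mul_le_mul_of_nonneg_left _ (by positivity)
      rw [add_mul]
      linarith
    rw [mul_comm (1 + D) B, mul_assoc B]
    apply mul_le_mul_of_nonneg_left _ hB
    have hfin : exp (-(1 / (1 + C0)) * s / t) = 1 / l := by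
      rw [hl, one_div (exp _), ← exp_neg]; congr 1; field_simp
    rw [hfin]
    have hP' : 2 ^ N / (1 + 1 / t) ^ N *
      (((m : ℝ) / (1 + min 1 θ / (((2 * k + 1 : ℕ) : ℝ) + 1) * m * t)) ^ (2 * k + 1 + 1) + 1) + H m t ≤ D := by
      rw [hD]; exact add_le_add hP hHt
    calc _ ≤ l / 2 * (1 / l) ^ 2 + 1 / l * D := by
          apply add_le_add
          · exact mul_le_mul_of_nonneg_left hE (by positivity)
          · exact mul_le_mul_of_nonneg_left hP' (by positivity)
      _ = (1 / 2 + D) * (1 / l) := by field_simp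
      _ ≤ _ := by gcongr; norm_num

theorem deathSol_lower_near {θ : ℝ} (hθ : 0 < θ) :
    ∃ a > 0, ∃ b > 0, ∃ t₁ > 0, t₁ ≤ 1 ∧ ∀ U : ℕ → ℝ → ℝ, DeathSol (deathRate θ) U →
      ∀ B t : ℝ, 0 ≤ B → 0 < t → t ≤ t₁ → (∀ m, 0 ≤ U m 0) →
      (∀ m : ℕ, a / t ≤ m → (m : ℝ) ≤ b / t → B ≤ U m 0) →
      ∀ m : ℕ, 1 / t ≤ (m : ℝ) + 1 → B / 2 ≤ U m t := by
  set c := min 1 θ with hc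
  have hcp : 0 < c := lt_min one_pos hθ
  refine ⟨1 / (8 * (2 + θ)), by positivity, 4 / c, by positivity, 1 / (8 * (2 + θ)), by positivity,
    ?_, ?_⟩
  · rw [div_le_one (by positivity)]; linarith
  intro U hU B t hB ht ht1 hU0 hUB m hm
  set a := 1 / (8 * (2 + θ)) with ha
  have hap : 0 < a := by positivity
  have hG := (((deathSuper_pow hθ 0).const_mul (a := t * c / 4) (by positivity)).add
    (((deathSuper_inv_pow hθ 0)).const_mul (a := a / t + 1) (by positivity))).const_mul hB
  have hW := (hG.add hU.1).add (DeathSuper.const (-B))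
  have := hW.nonneg (deathRate_nonneg hθ) (fun j => ?_) m ht.le
  · simp only [zero_add, pow_one, pow_zero, mul_one, Nat.cast_zero, div_one] at this
    have h1 : 1 / ((m : ℝ) + 1) ≤ t := by
      rw [div_le_iff₀ (by positivity)]
      rw [div_le_iff₀ ht] at hm
      linarith
    have h3 : t * c / 4 * ((m : ℝ) / (1 + c * m * t)) ≤ 1 / 4 := by
      have : (m : ℝ) / (1 + c * m * t) ≤ 1 / (c * t) := by
        rw [div_le_div_iff₀ (by positivity) (by positivity)]; nlinarith
      calc _ ≤ t * c / 4 * (1 / (c * t)) := by gcongr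
        _ = 1 / 4 := by field_simp
    have h4 : (a / t + 1) * (1 / ((m : ℝ) + 1) + (1 + θ) * t) ≤ 1 / 4 := by
      calc _ ≤ (a / t + 1) * (t + (1 + θ) * t) := by gcongr
        _ = (a + t) * (2 + θ) := by field_simp; ring
        _ ≤ (a + a) * (2 + θ) := by gcongr
        _ = 1 / 4 := by rw [ha]; field_simp; norm_num
    have h5 := mul_le_mul_of_nonneg_left (add_le_add h3 h4) hB
    linarith
  · simp only [zero_add, pow_one, pow_zero, mul_one, Nat.cast_zero, div_one, mul_zero, add_zero]
    have hj : (0 : ℝ) ≤ j := j.cast_nonneg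
    by_cases h1 : a / t ≤ j
    · by_cases h2 : (j : ℝ) ≤ 4 / c / t
      · have h3 := hUB j h1 h2
        have : 0 ≤ B * (t * c / 4 * j + (a / t + 1) * (1 / (j + 1))) := by positivity
        linarith
      · have h3 : 1 ≤ t * c / 4 * j := by
          push Not at h2
          rw [div_div, div_lt_iff₀ (by positivity)] at h2
          linarith
        have h4 : 0 ≤ (a / t + 1) * (1 / ((j : ℝ) + 1)) := by positivity
        nlinarith [hU0 j, mul_nonneg hB h4, mul_le_mul_of_nonneg_left h3 hB]
    · have h3 : 1 ≤ (a / t + 1) * (1 / ((j : ℝ) + 1)) := by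
        rw [mul_one_div, le_div_iff₀ (by positivity)]
        linarith
      have h4 : 0 ≤ t * c / 4 * (j : ℝ) := by positivity
      nlinarith [hU0 j, mul_nonneg hB h4, mul_le_mul_of_nonneg_left h3 hB]

theorem deathSol_lower_zero {θ : ℝ} (hθ : 0 < θ) :
    ∃ C > 0, ∀ U : ℕ → ℝ → ℝ, DeathSol (deathRate θ) U →
      ∀ B t : ℝ, 0 ≤ B → 0 < t → (∀ m, 0 ≤ U m 0) → B ≤ U 0 0 →
      ∀ m : ℕ, B / 2 * exp (-C / t) ≤ U m t := by
  set c := min 1 θ with hc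
  have hcp : 0 < c := lt_min one_pos hθ
  set b := 2 / c with hb
  have hbp : 0 < b := by positivity
  set c0 := min (c / 2) (1 / (2 * b)) with hc0
  have hc0p : 0 < c0 := by positivity
  refine ⟨2 / c0, by positivity, ?_⟩
  intro U hU B t hB ht hU0 hUB m
  have hr := deathRate_nonneg hθ
  set s := t / 2 with hs
  have hsp : 0 < s := by positivity
  have hUnn : ∀ m t, 0 ≤ t → 0 ≤ U m t := fun m t ht => hU.1.nonneg hr hU0 m ht
  have phase1 : ∀ m : ℕ, (m : ℝ) ≤ b / s → B * exp (-(1 / (c0 * s))) ≤ U m s := by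
    intro m hm
    obtain ⟨U', d1, d2, d3⟩ := hU.1
    have hd : ∀ (j : ℕ) (t : ℝ), HasDerivAt (fun t => B * (j.factorial * (c0 * t) ^ j))
        (B * (j.factorial * (j * (c0 * t) ^ (j - 1) * c0))) t := by
      intro j t
      have h1 : HasDerivAt (fun t : ℝ => c0 * t) c0 t := by
        simpa using (hasDerivAt_id t).const_mul c0
      exact ((h1.pow j).const_mul _).const_mul _
    have := death_nonneg_of_le (r := deathRate θ) (M := m) (T := s)
      (W := fun j t => U j t - B * (j.factorial * (c0 * t) ^ j))
      (fun j _ t ht => (d1 j t ht.1).sub (hd j t)) (fun j _ => ?_) (fun t ht => ?_) hr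
      (fun j hj t ht => ?_) m le_rfl s ⟨hsp.le, le_rfl⟩
    · simp only [sub_nonneg] at this
      refine le_trans ?_ this
      gcongr
      have h1 := Real.pow_div_factorial_le_exp (1 / (c0 * s)) (by positivity) m
      rw [exp_neg, inv_le_comm₀ (exp_pos _) (by positivity)]
      refine le_trans (le_of_eq ?_) h1
      rw [mul_inv, one_div, inv_pow]; ring
    · rcases j with _ | j
      · simpa using hUB
      · simpa using hU0 (j + 1)
    · simpa using d2 t ht.1
    · have h1 := d3 j t ht.1
      have ht0 := ht.1
      simp only [Nat.add_sub_cancel]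
      have hjt : ((j : ℝ) + 1) * t ≤ b := by
        have h2 : ((j : ℝ) + 1) ≤ m := by exact_mod_cast hj
        have h3 : ((j : ℝ) + 1) ≤ b / s := h2.trans hm
        calc ((j : ℝ) + 1) * t ≤ b / s * s := by gcongr; exact ht.2
          _ = b := by field_simp
      have h4 : ((j : ℝ) + 1) * t * c0 ≤ 1 / 2 := by
        calc ((j : ℝ) + 1) * t * c0 ≤ b * (1 / (2 * b)) := by gcongr; exact min_le_right _ _
          _ = 1 / 2 := by field_simp
      have h5 : c * ((j : ℝ) + 1) ^ 2 ≤ deathRate θ (j + 1) := by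
        have hm : (0 : ℝ) ≤ j := j.cast_nonneg
        rw [deathRate_succ, sq]
        have a1 : c * (j : ℝ) ≤ j := mul_le_of_le_one_left hm (min_le_left _ _)
        have a2 := min_le_right 1 θ
        nlinarith
      have h6 : ((j : ℝ) + 1) ^ 2 * c0 ≤ deathRate θ (j + 1) * (1 - (j + 1) * t * c0) := by
        calc ((j : ℝ) + 1) ^ 2 * c0 ≤ ((j : ℝ) + 1) ^ 2 * (c / 2) := by
              gcongr; exact min_le_left _ _
          _ = c * ((j : ℝ) + 1) ^ 2 * (1 / 2) := by ring
          _ ≤ _ := by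
              have := hr (j + 1)
              gcongr
              linarith
      have h7 := mul_le_mul_of_nonneg_left h6
        (show 0 ≤ B * (j.factorial * (c0 * t) ^ j) by positivity)
      rw [Nat.factorial_succ]
      push_cast
      rw [pow_succ]
      linarith
  have hG := ((((deathSuper_pow hθ 0).const_mul (a := s / b) (by positivity)).const_mul
    (a := B * exp (-(1 / (c0 * s)))) (by positivity)).add (hU.1.shift hsp.le)).add
      (DeathSuper.const (-(B * exp (-(1 / (c0 * s))))))
  have := hG.nonneg hr (fun j => ?_) m hsp.le
  · simp only [zero_add, pow_one, Nat.cast_zero, div_one] at this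
    rw [show s + s = t by rw [hs]; ring] at this
    have h3 : s / b * ((m : ℝ) / (1 + c * m * s)) ≤ 1 / 2 := by
      have : (m : ℝ) / (1 + c * m * s) ≤ 1 / (c * s) := by
        rw [div_le_div_iff₀ (by positivity) (by positivity)]; nlinarith
      calc _ ≤ s / b * (1 / (c * s)) := by gcongr
        _ = 1 / 2 := by rw [hb]; field_simp
    have h4 := mul_le_mul_of_nonneg_left h3
      (show 0 ≤ B * exp (-(1 / (c0 * s))) by positivity)
    have h5 : -(2 / c0) / t = -(1 / (c0 * s)) := by rw [hs]; field_simp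
    rw [h5]
    linarith
  · simp only [zero_add, pow_one, Nat.cast_zero, div_one, mul_zero, add_zero]
    by_cases h2 : (j : ℝ) ≤ b / s
    · have h3 := phase1 j h2
      have : 0 ≤ B * exp (-(1 / (c0 * s))) * (s / b * j) := by positivity
      linarith
    · have h3 : 1 ≤ s / b * j := by
        push Not at h2
        rw [div_lt_iff₀ hsp] at h2
        rw [div_mul_eq_mul_div, le_div_iff₀ hbp]
        linarith
      have := hUnn j s hsp.le
      have h4 := mul_le_mul_of_nonneg_left h3
        (show 0 ≤ B * exp (-(1 / (c0 * s))) by positivity)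
      linarith

theorem Gamma_add_nat {a : ℝ} (ha : 0 < a) (n : ℕ) :
    Gamma (a + n) = Gamma a * ∏ j ∈ Finset.range n, (a + j) := by
  induction n with
  | zero => simp
  | succ n ih =>
    rw [Finset.prod_range_succ, ← mul_assoc, ← ih, Nat.cast_succ, ← add_assoc,
      Gamma_add_one (by positivity), mul_comm]

theorem exists_bounds_of_tendsto_pos {u : ℕ → ℝ} (hu : ∀ n, 0 < u n) {L : ℝ} (hL : 0 < L)
    (h : Filter.Tendsto u Filter.atTop (nhds L)) :
    ∃ c > 0, ∃ C > 0, ∀ n, c ≤ u n ∧ u n ≤ C := by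
  obtain ⟨C, hC⟩ := h.bddAbove_range
  obtain ⟨D, hD⟩ := (h.inv₀ hL.ne').bddAbove_range
  have hC' : ∀ n, u n ≤ C := fun n => hC ⟨n, rfl⟩
  have hD' : ∀ n, (u n)⁻¹ ≤ D := fun n => hD ⟨n, rfl⟩
  have hD0 : 0 < D := (inv_pos.2 (hu 0)).trans_le (hD' 0)
  refine ⟨D⁻¹, inv_pos.2 hD0, C, (hu 0).trans_le (hC' 0), fun n => ⟨?_, hC' n⟩⟩
  exact inv_le_of_inv_le₀ (hu n) (hD' n)

theorem tendsto_factorial_div_Gamma {a : ℝ} (ha : 0 < a) :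
    Filter.Tendsto (fun n : ℕ => (n.factorial / Gamma (a + n)) / ((n : ℝ) + 1) ^ (1 - a))
      Filter.atTop (nhds 1) := by
  have h1 := (Real.GammaSeq_tendsto_Gamma a).div_const (Gamma a)
  rw [div_self (Gamma_pos_of_pos ha).ne'] at h1
  have hlim : Filter.Tendsto (fun n : ℕ => ((n : ℝ) + 1) / n) Filter.atTop (nhds 1) := by
    have := (tendsto_natCast_div_add_atTop (𝕜 := ℝ) 1).inv₀ one_ne_zero
    simpa using this
  have hlim2 : Filter.Tendsto (fun n : ℕ => (n + a) / (n : ℝ)) Filter.atTop (nhds 1) := by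
    have := (tendsto_natCast_div_add_atTop (𝕜 := ℝ) a).inv₀ one_ne_zero
    simpa using this
  have h2 := (h1.mul hlim2).mul (hlim.rpow_const (p := a - 1) (Or.inl one_ne_zero))
  rw [one_rpow, one_mul, one_mul] at h2
  refine h2.congr' ?_
  filter_upwards [Filter.eventually_gt_atTop 0] with n hn
  have hn' : (0 : ℝ) < n := by exact_mod_cast hn
  have hG := Gamma_add_nat ha (n + 1)
  have hG2 : Gamma (a + (n + 1 : ℕ)) = (a + n) * Gamma (a + n) := by
    rw [Nat.cast_succ, ← add_assoc, Gamma_add_one (by positivity)]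
  have hgp := Gamma_pos_of_pos ha
  have hgp2 : 0 < Gamma (a + n) := Gamma_pos_of_pos (by positivity)
  have hprod : ∏ j ∈ Finset.range (n + 1), (a + (j : ℝ)) = (a + n) * Gamma (a + n) / Gamma a := by
    rw [← hG2, hG]; field_simp
  unfold Real.GammaSeq
  rw [hprod, div_rpow (by positivity) hn'.le, rpow_sub (by positivity : (0 : ℝ) < n + 1) 1 a,
    rpow_sub (by positivity : (0 : ℝ) < n + 1) a 1, rpow_sub hn' a 1, rpow_one, rpow_one]
  have : 0 < (n : ℝ) ^ a := by positivity
  have : 0 < ((n : ℝ) + 1) ^ a := by positivity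
  field_simp
  ring

theorem factorial_div_Gamma_bounds {a : ℝ} (ha : 0 < a) :
    ∃ c > 0, ∃ C > 0, ∀ n : ℕ, c * ((n : ℝ) + 1) ^ (1 - a) ≤ n.factorial / Gamma (a + n) ∧
      n.factorial / Gamma (a + n) ≤ C * ((n : ℝ) + 1) ^ (1 - a) := by
  obtain ⟨c, hc, C, hC, h⟩ := exists_bounds_of_tendsto_pos (fun n => by
    have : 0 < Gamma (a + n) := Gamma_pos_of_pos (by positivity)
    positivity) one_pos (tendsto_factorial_div_Gamma ha)
  refine ⟨c, hc, C, hC, fun n => ?_⟩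
  have hp : 0 < ((n : ℝ) + 1) ^ (1 - a) := by positivity
  have := h n
  rw [le_div_iff₀ hp, div_le_iff₀ hp] at this
  exact this

theorem Gamma_div_factorial_bounds {a : ℝ} (ha : 0 < a) :
    ∃ c > 0, ∃ C > 0, ∀ n : ℕ, c * ((n : ℝ) + 1) ^ (a - 1) ≤ Gamma (a + n) / n.factorial ∧
      Gamma (a + n) / n.factorial ≤ C * ((n : ℝ) + 1) ^ (a - 1) := by
  obtain ⟨c, hc, C, hC, h⟩ := factorial_div_Gamma_bounds ha
  refine ⟨C⁻¹, by positivity, c⁻¹, by positivity, fun n => ?_⟩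
  have hg : 0 < Gamma (a + n) := Gamma_pos_of_pos (by positivity)
  have hp : 0 < ((n : ℝ) + 1) ^ (1 - a) := by positivity
  have h1 : ((n : ℝ) + 1) ^ (a - 1) = (((n : ℝ) + 1) ^ (1 - a))⁻¹ := by
    rw [← rpow_neg (by positivity)]; congr 1; ring
  obtain ⟨h2, h3⟩ := h n
  rw [h1, ← mul_inv, ← mul_inv, ← inv_div (n.factorial : ℝ)]
  exact ⟨inv_anti₀ (by positivity) h3, inv_anti₀ (by positivity) h2⟩

theorem factorial_le_stirling (n : ℕ) :
    (n.factorial : ℝ) ≤ exp 1 * √(n + 1) * (n / exp 1) ^ n := by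
  rcases n with _ | n
  · simp
  · have h := Stirling.stirlingSeq'_antitone (Nat.zero_le n)
    simp only [Function.comp, Nat.succ_eq_add_one, zero_add, Stirling.stirlingSeq_one] at h
    unfold Stirling.stirlingSeq at h
    have h2 : 0 < √(2 * ((n + 1 : ℕ) : ℝ)) := by positivity
    rw [div_le_iff₀ (by positivity)] at h
    refine h.trans ?_
    rw [sqrt_mul (by norm_num)]
    have : √((n + 1 : ℕ) : ℝ) ≤ √((n + 1 : ℕ) + 1 : ℝ) := sqrt_le_sqrt (by linarith)
    calc exp 1 / √2 * (√2 * √((n + 1 : ℕ) : ℝ) * (((n + 1 : ℕ) : ℝ) / exp 1) ^ (n + 1))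
        = exp 1 * √((n + 1 : ℕ) : ℝ) * (((n + 1 : ℕ) : ℝ) / exp 1) ^ (n + 1) := by
          have : √(2 : ℝ) ≠ 0 := by positivity
          field_simp
      _ ≤ _ := by gcongr

theorem stirling_le_factorial (n : ℕ) : √(n + 1) * (n / exp 1) ^ n ≤ (n.factorial : ℝ) := by
  rcases n with _ | n
  · simp
  · refine le_trans ?_ (Stirling.le_factorial_stirling (n + 1))
    gcongr
    push_cast
    nlinarith [pi_gt_three, (Nat.cast_nonneg n : (0 : ℝ) ≤ n)]

theorem pow_div_factorial_le_exp_div_sqrt {a : ℝ} (ha : 0 ≤ a) (l : ℕ) :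
    a ^ l / l.factorial ≤ exp a / √(l + 1) := by
  rw [div_le_div_iff₀ (by positivity) (by positivity)]
  have key : a ^ l ≤ exp a * (l / exp 1) ^ l := by
    rcases Nat.eq_zero_or_pos l with rfl | hl
    · simpa using one_le_exp ha
    · have hl' : (0 : ℝ) < l := by exact_mod_cast hl
      have h1 : a ≤ exp (a / l - 1) * l := by
        have := add_one_le_exp (a / l - 1)
        rw [← div_le_iff₀ hl']; linarith
      calc a ^ l ≤ (exp (a / l - 1) * l) ^ l := by gcongr
        _ = exp a * (l / exp 1) ^ l := by
          rw [mul_pow, div_pow, ← exp_nat_mul, ← exp_nat_mul, mul_sub, mul_div_cancel₀ _ hl'.ne',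
            exp_sub]
          field_simp
  calc a ^ l * √(l + 1) ≤ exp a * (l / exp 1) ^ l * √(l + 1) := by gcongr
    _ = exp a * (√(l + 1) * (l / exp 1) ^ l) := by ring
    _ ≤ _ := by gcongr; exact stirling_le_factorial l

section
variable {ι : Type*} [Fintype ι] [DecidableEq ι]

def mulP (m : ℕ) (z : ι → ℝ) (l : ι → ℕ) : ℝ :=
  m.factorial * ∏ i, z i ^ l i / (l i).factorial

omit [DecidableEq ι] in
theorem mulP_nonneg {z : ι → ℝ} (hz : ∀ i, 0 ≤ z i) (m : ℕ) (l : ι → ℕ) : 0 ≤ mulP m z l := by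
  unfold mulP
  have : 0 ≤ ∏ i, z i ^ l i / (l i).factorial :=
    Finset.prod_nonneg fun i _ => div_nonneg (pow_nonneg (hz i) _) (by positivity)
  positivity

theorem sum_mulP (m : ℕ) (z : ι → ℝ) :
    ∑ l ∈ Finset.piAntidiag Finset.univ m, mulP m z l = (∑ i, z i) ^ m := by
  rw [Finset.sum_pow_eq_sum_piAntidiag]
  refine Finset.sum_congr rfl fun l hl => ?_
  rw [Finset.mem_piAntidiag] at hl
  have h := Nat.multinomial_spec Finset.univ l
  rw [hl.1] at h
  have h' : (∏ i, ((l i).factorial : ℝ)) * Nat.multinomial Finset.univ l = m.factorial := by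
    exact_mod_cast h
  unfold mulP
  have : (∏ i, ((l i).factorial : ℝ)) ≠ 0 :=
    Finset.prod_ne_zero_iff.2 fun i _ => by positivity
  rw [Finset.prod_div_distrib, ← h']
  field_simp

theorem sum_eq_of_mem_piAntidiag {m : ℕ} {l : ι → ℕ}
    (hl : l ∈ Finset.piAntidiag Finset.univ m) : ∑ i, l i = m := by
  rw [Finset.mem_piAntidiag] at hl; exact hl.1

omit [DecidableEq ι] in
theorem mulP_le {z : ι → ℝ} (hz : ∀ i, 0 ≤ z i) (hz1 : ∑ i, z i = 1) {m : ℕ} {l : ι → ℕ}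
    (hl : ∑ i, l i = m) :
    mulP m z l ≤ exp 1 * √(m + 1) * ∏ i, (√(l i + 1))⁻¹ := by
  have h1 : mulP m z l * (m : ℝ) ^ m = m.factorial * ∏ i, (m * z i) ^ l i / (l i).factorial := by
    have : (m : ℝ) ^ m = ∏ i, (m : ℝ) ^ l i := by rw [Finset.prod_pow_eq_pow_sum, hl]
    unfold mulP
    rw [this, mul_assoc, ← Finset.prod_mul_distrib]
    congr 1
    exact Finset.prod_congr rfl fun i _ => by rw [mul_pow]; ring
  have h2 : ∏ i, (m * z i) ^ l i / (l i).factorial ≤ exp m * ∏ i, (√(l i + 1))⁻¹ := by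
    calc ∏ i, (m * z i) ^ l i / (l i).factorial ≤ ∏ i, exp (m * z i) / √(l i + 1) :=
          Finset.prod_le_prod (fun i _ => by have := hz i; positivity) fun i _ =>
            pow_div_factorial_le_exp_div_sqrt (mul_nonneg (by positivity) (hz i)) _
      _ = _ := by
        simp_rw [div_eq_mul_inv]
        rw [Finset.prod_mul_distrib, ← exp_sum, ← Finset.mul_sum, hz1, mul_one]
  have hm : (0 : ℝ) < (m : ℝ) ^ m := by
    rcases Nat.eq_zero_or_pos m with rfl | hm
    · simp
    · positivity
  have hp : 0 ≤ ∏ i, (√((l i : ℝ) + 1))⁻¹ := by positivity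
  refine le_of_mul_le_mul_right ?_ hm
  rw [h1]
  calc (m.factorial : ℝ) * ∏ i, (m * z i) ^ l i / (l i).factorial
      ≤ (exp 1 * √(m + 1) * (m / exp 1) ^ m) * (exp m * ∏ i, (√(l i + 1))⁻¹) :=
        mul_le_mul (factorial_le_stirling m) h2
          (Finset.prod_nonneg fun i _ => by have := hz i; positivity) (by positivity)
    _ = _ := by
      rw [div_pow, ← exp_nat_mul, mul_one]; field_simp

theorem sum_mulP_mul_pow {z : ι → ℝ} (hz1 : ∑ i, z i = 1) (m : ℕ) (i : ι) (w : ℝ) :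
    ∑ l ∈ Finset.piAntidiag Finset.univ m, mulP m z l * w ^ l i = (1 + z i * (w - 1)) ^ m := by
  have h := sum_mulP m (Function.update z i (z i * w))
  have h2 : ∑ j, Function.update z i (z i * w) j = 1 + z i * (w - 1) := by
    have h3 := Finset.add_sum_erase Finset.univ z (Finset.mem_univ i)
    rw [Finset.sum_update_of_mem (Finset.mem_univ i), Finset.sdiff_singleton_eq_erase]
    linear_combination h3 + hz1
  rw [h2] at h
  rw [← h]
  refine Finset.sum_congr rfl fun l _ => ?_
  unfold mulP
  rw [mul_assoc, ← Finset.mul_prod_erase _ _ (Finset.mem_univ i),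
    ← Finset.mul_prod_erase _ (fun j => Function.update z i (z i * w) j ^ l j / _)
      (Finset.mem_univ i), Function.update_self, mul_pow]
  have : ∏ j ∈ Finset.univ.erase i, Function.update z i (z i * w) j ^ l j / ((l j).factorial : ℝ)
      = ∏ j ∈ Finset.univ.erase i, z j ^ l j / ((l j).factorial : ℝ) :=
    Finset.prod_congr rfl fun j hj => by
      rw [Function.update_of_ne (Finset.ne_of_mem_erase hj)]
  rw [this]; ring

theorem sum_mulP_mul_exp_le {z : ι → ℝ} (hz : ∀ i, 0 ≤ z i) (hz1 : ∑ i, z i = 1) (m : ℕ) (i : ι)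
    (u : ℝ) : ∑ l ∈ Finset.piAntidiag Finset.univ m, mulP m z l * exp (u * l i)
      ≤ exp (m * z i * (exp u - 1)) := by
  have h := sum_mulP_mul_pow hz1 m i (exp u)
  have h1 : z i ≤ 1 := hz1 ▸ Finset.single_le_sum (fun j _ => hz j) (Finset.mem_univ i)
  simp_rw [mul_comm u, exp_nat_mul]
  rw [h, mul_assoc, exp_nat_mul]
  refine pow_le_pow_left₀ ?_ (by linarith [add_one_le_exp (z i * (exp u - 1))]) _
  nlinarith [exp_pos u, hz i]

theorem moment_bound (N : ℕ) : ∃ C > 0, ∀ (l : ℕ) (a : ℝ), 0 ≤ a →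
    ((l + 1) / (1 + a)) ^ N + ((1 + a) / (l + 1)) ^ N
      ≤ C * (exp ((1 + a)⁻¹ * l) + 1 + exp (a / 4) * exp (-1 * l)) := by
  refine ⟨N.factorial * exp 1 + (8 ^ N + 8 ^ N * (N.factorial * exp 1)), by positivity,
    fun l a ha => ?_⟩
  have hl : (0 : ℝ) ≤ l := l.cast_nonneg
  have h1 : ((l + 1) / (1 + a)) ^ N ≤ N.factorial * exp 1 * exp ((1 + a)⁻¹ * l) := by
    have h := pow_div_factorial_le_exp (((l : ℝ) + 1) / (1 + a)) (by positivity) N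
    rw [div_le_iff₀ (by positivity)] at h
    refine h.trans ?_
    rw [mul_comm, mul_assoc, ← exp_add]
    gcongr
    rw [add_div, div_eq_inv_mul, add_comm]
    gcongr
    rw [div_le_one (by positivity)]; linarith
  have h2 : ((1 + a) / (l + 1)) ^ N
      ≤ 8 ^ N + 8 ^ N * (N.factorial * exp 1) * (exp (a / 4) * exp (-1 * l)) := by
    by_cases h : a / 8 ≤ l
    · have : ((1 + a) / (l + 1)) ^ N ≤ 8 ^ N := by
        gcongr
        rw [div_le_iff₀ (by positivity)]; linarith
      refine this.trans (le_add_of_nonneg_right (by positivity))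
    · push Not at h
      have h3 := pow_div_factorial_le_exp ((1 + a) / 8) (by positivity) N
      rw [div_le_iff₀ (by positivity)] at h3
      have h4 : ((1 + a) / (l + 1)) ^ N ≤ 8 ^ N * ((1 + a) / 8) ^ N := by
        rw [← mul_pow]
        gcongr
        rw [div_le_iff₀ (by positivity)]; nlinarith
      refine (h4.trans (mul_le_mul_of_nonneg_left h3 (by positivity))).trans
        (le_trans ?_ (le_add_of_nonneg_left (by positivity)))
      rw [← exp_add, mul_assoc, mul_assoc, ← exp_add, mul_comm (exp _)]
      gcongr
      linarith
  have e1 := exp_pos ((1 + a)⁻¹ * l)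
  have e2 : 0 < exp (a / 4) * exp (-1 * l) := by positivity
  set E1 := exp ((1 + a)⁻¹ * l)
  set E2 := exp (a / 4) * exp (-1 * l)
  have f1 : 0 < N.factorial * exp 1 := by positivity
  have f2 : (0 : ℝ) < 8 ^ N := by positivity
  have f3 := mul_pos f2 f1
  nlinarith [mul_pos f1 e1, mul_pos f1 e2, mul_pos f2 e1, mul_pos f2 e2, mul_pos f3 e1,
    mul_pos f3 e2]

theorem sum_mulP_moment (N : ℕ) : ∃ C > 0, ∀ {z : ι → ℝ}, (∀ i, 0 ≤ z i) → ∑ i, z i = 1 →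
    ∀ (m : ℕ) (i : ι), ∑ l ∈ Finset.piAntidiag Finset.univ m, mulP m z l *
      (((l i + 1) / (1 + m * z i)) ^ N + ((1 + m * z i) / (l i + 1)) ^ N) ≤ C := by
  obtain ⟨C, hC, h⟩ := moment_bound N
  refine ⟨C * (exp 2 + 1 + 1), by positivity, fun {z} hz hz1 m i => ?_⟩
  have ha : 0 ≤ m * z i := mul_nonneg m.cast_nonneg (hz i)
  set a := m * z i with hadef
  calc _ ≤ ∑ l ∈ Finset.piAntidiag Finset.univ m, C * (mulP m z l * exp ((1 + a)⁻¹ * l i)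
        + mulP m z l + exp (a / 4) * (mulP m z l * exp (-1 * l i))) := by
        refine Finset.sum_le_sum fun l _ => ?_
        have := mul_le_mul_of_nonneg_left (h (l i) a ha) (mulP_nonneg hz m l)
        refine this.trans_eq ?_
        ring
    _ ≤ _ := by
      rw [← Finset.mul_sum, Finset.sum_add_distrib, Finset.sum_add_distrib, ← Finset.mul_sum,
        sum_mulP, hz1, one_pow]
      have e1 := sum_mulP_mul_exp_le hz hz1 m i (1 + a)⁻¹
      have e2 := sum_mulP_mul_exp_le hz hz1 m i (-1)
      have hu : (1 + a)⁻¹ ≤ 1 := inv_le_one_of_one_le₀ (by linarith)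
      have hu0 : 0 < (1 + a)⁻¹ := by positivity
      have h3 : exp (m * z i * (exp (1 + a)⁻¹ - 1)) ≤ exp 2 := by
        rw [← hadef]
        gcongr
        have h4 := abs_exp_sub_one_sub_id_le (x := (1 + a)⁻¹) (by rwa [abs_of_pos hu0])
        have h5 := (abs_le.1 h4).2
        have h6 : exp (1 + a)⁻¹ - 1 ≤ 2 * (1 + a)⁻¹ := by nlinarith
        have h7 : a * (1 + a)⁻¹ ≤ 1 := by
          rw [← div_eq_mul_inv, div_le_one (by positivity)]; linarith
        nlinarith [mul_le_mul_of_nonneg_left h6 ha]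
      have h4 : exp (a / 4) * exp (m * z i * (exp (-1) - 1)) ≤ 1 := by
        rw [← hadef, ← exp_add, exp_le_one_iff]
        have : exp (-1 : ℝ) ≤ 1 / 2 := by
          rw [exp_neg, ← one_div]
          exact one_div_le_one_div_of_le (by norm_num) (by linarith [exp_one_gt_d9])
        nlinarith
      have h5 := mul_le_mul_of_nonneg_left e2 (exp_pos (a / 4)).le
      gcongr
      · exact e1.trans h3
      · exact h5.trans h4

omit [DecidableEq ι] in
theorem prod_le_one_add_sum_pow {b : ι → ℝ} (hb : ∀ i, 1 ≤ b i) :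
    ∏ i, b i ≤ 1 + ∑ i, b i ^ Fintype.card ι := by
  have hs : ∀ i, 0 ≤ b i := fun i => zero_le_one.trans (hb i)
  rcases isEmpty_or_nonempty ι with h | h
  · simp
  · obtain ⟨i, -, hi⟩ := Finset.exists_max_image Finset.univ b Finset.univ_nonempty
    have h1 : ∏ i, b i ≤ b i ^ Fintype.card ι := by
      calc ∏ j, b j ≤ ∏ _j : ι, b i := Finset.prod_le_prod (fun j _ => hs j) hi
        _ = _ := by simp
    have h2 : b i ^ Fintype.card ι ≤ ∑ i, b i ^ Fintype.card ι :=
      Finset.single_le_sum (f := fun i => b i ^ Fintype.card ι)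
        (fun j _ => pow_nonneg (hs j) _) (Finset.mem_univ i)
    linarith

theorem rpow_le_max_pow {x p : ℝ} (hx : 0 < x) {N : ℕ} (hp : |p| ≤ N) :
    x ^ p ≤ (max x x⁻¹) ^ N := by
  rcases le_total 1 x with h | h
  · calc x ^ p ≤ x ^ (N : ℝ) := rpow_le_rpow_of_exponent_le h ((le_abs_self p).trans hp)
      _ = x ^ N := rpow_natCast _ _
      _ ≤ _ := by gcongr; exact le_max_left _ _
  · calc x ^ p = (x⁻¹) ^ (-p) := by rw [rpow_neg (by positivity), inv_rpow hx.le, inv_inv]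
      _ ≤ (x⁻¹) ^ (N : ℝ) := rpow_le_rpow_of_exponent_le (one_le_inv₀ hx |>.2 h)
          ((neg_le_abs p).trans hp)
      _ = (x⁻¹) ^ N := rpow_natCast _ _
      _ ≤ _ := by gcongr; exact le_max_right _ _

omit [DecidableEq ι] in
theorem exists_nat_abs_le (p : ι → ℝ) : ∃ N : ℕ, ∀ i, |p i| ≤ N := by
  obtain ⟨N, hN⟩ := exists_nat_ge (∑ i, |p i|)
  exact ⟨N, fun i => (Finset.single_le_sum (f := fun i => |p i|)
    (fun j _ => abs_nonneg _) (Finset.mem_univ i)).trans hN⟩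

theorem sum_mulP_prod_rpow (p : ι → ℝ) : ∃ C > 0, ∀ {z : ι → ℝ}, (∀ i, 0 ≤ z i) →
    ∑ i, z i = 1 → ∀ m : ℕ, ∑ l ∈ Finset.piAntidiag Finset.univ m, mulP m z l *
      ∏ i, ((l i + 1) / (1 + m * z i)) ^ p i ≤ C := by
  obtain ⟨N, hN⟩ := exists_nat_abs_le p
  set c := Fintype.card ι
  obtain ⟨C, hC, h⟩ := sum_mulP_moment (ι := ι) (N * c)
  refine ⟨1 + c * C, by positivity, fun {z} hz hz1 m => ?_⟩
  calc _ ≤ ∑ l ∈ Finset.piAntidiag Finset.univ m, (mulP m z l + ∑ i, mulP m z l *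
      (((l i + 1) / (1 + m * z i)) ^ (N * c) + ((1 + m * z i) / (l i + 1)) ^ (N * c))) := by
        refine Finset.sum_le_sum fun l _ => ?_
        rw [← Finset.mul_sum]
        have hx : ∀ i, 0 < ((l i : ℝ) + 1) / (1 + m * z i) := fun i => by
          have := hz i; positivity
        have h1 : ∏ i, (((l i : ℝ) + 1) / (1 + m * z i)) ^ p i
            ≤ ∏ i, (max (((l i : ℝ) + 1) / (1 + m * z i)) (((l i : ℝ) + 1) / (1 + m * z i))⁻¹) ^ N :=
          Finset.prod_le_prod (fun i _ => (rpow_pos_of_pos (hx i) _).le)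
            fun i _ => rpow_le_max_pow (hx i) (hN i)
        have h2 := prod_le_one_add_sum_pow (b := fun i => (max (((l i : ℝ) + 1) / (1 + m * z i))
          (((l i : ℝ) + 1) / (1 + m * z i))⁻¹) ^ N) (fun i => one_le_pow₀ (by
            rcases le_total 1 (((l i : ℝ) + 1) / (1 + m * z i)) with h | h
            · exact h.trans (le_max_left _ _)
            · exact ((one_le_inv₀ (hx i)).2 h).trans (le_max_right _ _)))
        have h3 : ∀ i, ((max (((l i : ℝ) + 1) / (1 + m * z i))
          (((l i : ℝ) + 1) / (1 + m * z i))⁻¹) ^ N) ^ c ≤ ((l i + 1) / (1 + m * z i)) ^ (N * c)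
            + ((1 + m * z i) / (l i + 1)) ^ (N * c) := fun i => by
          have hx' := hx i
          rw [← pow_mul, ← inv_div ((l i : ℝ) + 1)]
          rcases max_choice (((l i : ℝ) + 1) / (1 + m * z i))
            (((l i : ℝ) + 1) / (1 + m * z i))⁻¹ with h | h <;> rw [h]
          · exact le_add_of_nonneg_right (by positivity)
          · exact le_add_of_nonneg_left (by positivity)
        have h4 := h1.trans (h2.trans (add_le_add le_rfl (Finset.sum_le_sum fun i _ => h3 i)))
        exact (mul_le_mul_of_nonneg_left h4 (mulP_nonneg hz m l)).trans_eq (by ring)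
    _ ≤ _ := by
      rw [Finset.sum_add_distrib, sum_mulP, hz1, one_pow, Finset.sum_comm]
      gcongr
      calc _ ≤ ∑ _i : ι, C := Finset.sum_le_sum fun i _ => h hz hz1 m i
        _ = _ := by simp [c]

end

section
variable {ι : Type*} [Fintype ι] [DecidableEq ι]

def bernKer (α : ι → ℝ) (m : ℕ) (p : ι → ℝ) : ℝ :=
  Gamma ((∑ i, α i) + m) * m.factorial * ∑ l ∈ Finset.piAntidiag Finset.univ m,
    ∏ i, p i ^ l i / ((l i).factorial * Gamma (α i + l i))

def volF (α : ι → ℝ) (M : ℝ) (x : ι → ℝ) : ℝ :=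
  (1 + M) ^ ((∑ i, α i) - 1 / 2) * ∏ i, (1 + M * x i) ^ (1 / 2 - α i)

theorem bernKer_sq {α : ι → ℝ} (hα : ∀ i, 0 < α i) (m : ℕ) (z : ι → ℝ) :
    bernKer α m (fun i => z i ^ 2) = ∑ l ∈ Finset.piAntidiag Finset.univ m,
      Gamma ((∑ i, α i) + m) / m.factorial *
        (mulP m z l ^ 2 * ∏ i, (l i).factorial / Gamma (α i + l i)) := by
  unfold bernKer
  rw [Finset.mul_sum]
  refine Finset.sum_congr rfl fun l _ => ?_
  unfold mulP
  rw [mul_pow, mul_assoc ((m.factorial : ℝ) ^ 2), ← Finset.prod_pow, ← Finset.prod_mul_distrib]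
  have : ∏ i, (z i ^ 2) ^ l i / ((l i).factorial * Gamma (α i + l i)) =
      ∏ i, (z i ^ l i / (l i).factorial) ^ 2 * ((l i).factorial / Gamma (α i + l i)) := by
    refine Finset.prod_congr rfl fun i _ => ?_
    have : 0 < Gamma (α i + l i) := Gamma_pos_of_pos (by have := hα i; positivity)
    field_simp
    rw [← pow_mul, ← pow_mul, mul_comm]
  rw [this]
  field_simp

omit [DecidableEq ι] in
theorem prod_factorial_div_Gamma_bounds {α : ι → ℝ} (hα : ∀ i, 0 < α i) :
    ∃ c > 0, ∃ C > 0, ∀ l : ι → ℕ,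
      c * ∏ i, ((l i : ℝ) + 1) ^ (1 - α i) ≤ ∏ i, (l i).factorial / Gamma (α i + l i) ∧
      ∏ i, (l i).factorial / Gamma (α i + l i) ≤ C * ∏ i, ((l i : ℝ) + 1) ^ (1 - α i) := by
  choose c hc C hC h using fun i => factorial_div_Gamma_bounds (hα i)
  refine ⟨∏ i, c i, Finset.prod_pos fun i _ => hc i, ∏ i, C i, Finset.prod_pos fun i _ => hC i,
    fun l => ⟨?_, ?_⟩⟩
  · rw [← Finset.prod_mul_distrib]
    exact Finset.prod_le_prod (fun i _ => mul_nonneg (hc i).le (by positivity))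
      fun i _ => (h i (l i)).1
  · rw [← Finset.prod_mul_distrib]
    refine Finset.prod_le_prod (fun i _ => ?_) fun i _ => (h i (l i)).2
    have : 0 < Gamma (α i + l i) := Gamma_pos_of_pos (by have := hα i; positivity)
    positivity

theorem bernKer_sq_le {α : ι → ℝ} (hα : ∀ i, 0 < α i) (hθ : 0 < ∑ i, α i) :
    ∃ C > 0, ∀ z : ι → ℝ, (∀ i, 0 ≤ z i) → ∑ i, z i = 1 → ∀ m : ℕ,
      bernKer α m (fun i => z i ^ 2) ≤ C * volF α m z := by
  obtain ⟨_, _, C1, hC1, h1⟩ := Gamma_div_factorial_bounds hθ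
  obtain ⟨_, _, C2, hC2, h2⟩ := prod_factorial_div_Gamma_bounds hα
  obtain ⟨C3, hC3, h3⟩ := sum_mulP_prod_rpow (fun i => 1 / 2 - α i)
  refine ⟨C1 * exp 1 * C2 * C3, by positivity, fun z hz hz1 m => ?_⟩
  rw [bernKer_sq hα]
  have hB : 0 < ∏ i, (1 + m * z i) ^ (1 / 2 - α i) :=
    Finset.prod_pos fun i _ => rpow_pos_of_pos (by have := hz i; positivity) _
  calc _ ≤ ∑ l ∈ Finset.piAntidiag Finset.univ m, (C1 * exp 1 * C2) * volF α m z *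
      (mulP m z l * ∏ i, ((l i + 1) / (1 + m * z i)) ^ (1 / 2 - α i)) := by
        refine Finset.sum_le_sum fun l hl => ?_
        have hl := sum_eq_of_mem_piAntidiag hl
        have hm0 := mulP_nonneg hz m l
        have e1 := mulP_le hz hz1 hl
        have e2 := (h2 l).2
        have e3 := (h1 m).2
        have e4 : ∏ i, (((l i : ℝ) + 1) / (1 + m * z i)) ^ (1 / 2 - α i) =
            ((∏ i, (√((l i : ℝ) + 1))⁻¹) * ∏ i, ((l i : ℝ) + 1) ^ (1 - α i)) /
              ∏ i, (1 + m * z i) ^ (1 / 2 - α i) := by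
          rw [← Finset.prod_mul_distrib, ← Finset.prod_div_distrib]
          refine Finset.prod_congr rfl fun i _ => ?_
          have := hz i
          rw [div_rpow (by positivity) (by positivity), sqrt_eq_rpow, ← rpow_neg (by positivity),
            ← rpow_add (by positivity)]
          congr 2; ring
        have hp : (0 : ℝ) ≤ ∏ i, ((l i).factorial : ℝ) / Gamma (α i + l i) :=
          Finset.prod_nonneg fun i _ => by
            have : 0 < Gamma (α i + l i) := Gamma_pos_of_pos (by have := hα i; positivity)
            positivity
        have e5 : ((m : ℝ) + 1) ^ ((∑ i, α i) - 1) * √(m + 1) = (1 + m) ^ ((∑ i, α i) - 1 / 2) := by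
          rw [sqrt_eq_rpow, ← rpow_add (by positivity), add_comm (m : ℝ)]
          congr 1; ring
        have hq : (0 : ℝ) ≤ ∏ i, ((l i : ℝ) + 1) ^ (1 - α i) :=
          Finset.prod_nonneg fun i _ => by positivity
        have hr : (0 : ℝ) ≤ ∏ i, (√((l i : ℝ) + 1))⁻¹ := Finset.prod_nonneg fun i _ => by positivity
        rw [e4]
        unfold volF
        rw [← e5]
        calc _ ≤ (C1 * ((m : ℝ) + 1) ^ ((∑ i, α i) - 1)) *
            ((mulP m z l * (exp 1 * √(m + 1) * ∏ i, (√((l i : ℝ) + 1))⁻¹)) *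
              (C2 * ∏ i, ((l i : ℝ) + 1) ^ (1 - α i))) := by
              rw [sq (mulP m z l)]
              gcongr
          _ = _ := by
            generalize ∏ i, (1 + m * z i) ^ (1 / 2 - α i) = B at hB
            field_simp
    _ ≤ _ := by
      rw [← Finset.mul_sum]
      have := h3 hz hz1 m
      have hv : 0 ≤ volF α m z := by unfold volF; positivity
      calc _ ≤ (C1 * exp 1 * C2) * volF α m z * C3 := by gcongr
        _ = _ := by ring

theorem card_typical_le {a : ι → ℝ} {w : ι → ℝ} (hw : ∀ i, 0 ≤ w i) (m : ℕ) (i₀ : ι) :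
    (((Finset.piAntidiag Finset.univ m).filter fun l : ι → ℕ =>
      ∀ i, |(l i : ℝ) - a i| ≤ w i).card : ℝ) ≤ ∏ i ∈ Finset.univ.erase i₀, (2 * w i + 1) := by
  classical
  set S := (Finset.piAntidiag Finset.univ m).filter fun l : ι → ℕ => ∀ i, |(l i : ℝ) - a i| ≤ w i
  set I : ι → Finset ℕ := fun i =>
    if i = i₀ then {0} else Finset.Icc ⌈a i - w i⌉₊ ⌊a i + w i⌋₊ with hI
  have hcard : S.card ≤ (Fintype.piFinset I).card := by
    refine Finset.card_le_card_of_injOn (fun l => Function.update l i₀ 0) ?_ ?_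
    · intro l hl
      have hl : l ∈ S := hl
      simp only [S, Finset.mem_filter] at hl
      simp only [Finset.mem_coe, Fintype.mem_piFinset]
      intro i
      by_cases h : i = i₀
      · subst h; simp [hI]
      · have := abs_le.1 (hl.2 i)
        simp only [hI, h, if_false, Function.update_of_ne h, Finset.mem_Icc]
        exact ⟨Nat.ceil_le.2 (by linarith), Nat.le_floor (by linarith)⟩
    · intro l hl l' hl' h
      have hl : l ∈ S := hl
      have hl' : l' ∈ S := hl'
      simp only [S, Finset.mem_filter] at hl hl'
      have h1 := sum_eq_of_mem_piAntidiag hl.1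
      have h2 := sum_eq_of_mem_piAntidiag hl'.1
      have h3 : ∀ i, i ≠ i₀ → l i = l' i := fun i hi => by
        have := congrFun h i
        simpa [Function.update_of_ne hi] using this
      rw [← Finset.add_sum_erase _ _ (Finset.mem_univ i₀)] at h1 h2
      have h4 : ∑ x ∈ Finset.univ.erase i₀, l x = ∑ x ∈ Finset.univ.erase i₀, l' x :=
        Finset.sum_congr rfl fun i hi => h3 i (Finset.ne_of_mem_erase hi)
      ext i
      by_cases hi : i = i₀
      · subst hi; omega
      · exact h3 i hi
  refine (Nat.cast_le.2 hcard).trans ?_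
  rw [Fintype.card_piFinset, Nat.cast_prod, ← Finset.mul_prod_erase _ _ (Finset.mem_univ i₀)]
  simp only [hI, if_true, Finset.card_singleton, Nat.cast_one, one_mul]
  refine Finset.prod_le_prod (fun i _ => by positivity) fun i hi => ?_
  rw [if_neg (Finset.ne_of_mem_erase hi), Nat.card_Icc]
  have h1 := Nat.le_ceil (a i - w i)
  by_cases h : 0 ≤ a i + w i
  · have h2 := Nat.floor_le h
    rcases le_total ⌈a i - w i⌉₊ (⌊a i + w i⌋₊ + 1) with h3 | h3
    · rw [Nat.cast_sub h3]; push_cast; linarith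
    · rw [Nat.sub_eq_zero_of_le h3]; have := hw i; push_cast; linarith
  · rw [Nat.floor_of_nonpos (le_of_not_ge h)]
    have : ((0 + 1 - ⌈a i - w i⌉₊ : ℕ) : ℝ) ≤ 1 := by
      exact_mod_cast (by omega : 0 + 1 - ⌈a i - w i⌉₊ ≤ 1)
    have := hw i
    linarith

theorem sum_mulP_atypical_le {z : ι → ℝ} (hz : ∀ i, 0 ≤ z i) (hz1 : ∑ i, z i = 1) (m : ℕ)
    (i : ι) (K : ℝ) :
    ∑ l ∈ (Finset.piAntidiag Finset.univ m).filter
      (fun l : ι → ℕ => K * √(1 + m * z i) < |(l i : ℝ) - m * z i|), mulP m z l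
      ≤ 2 * exp 1 * exp (-K) := by
  have ha : 0 ≤ m * z i := mul_nonneg m.cast_nonneg (hz i)
  set a := m * z i with hadef
  have hs : 0 < √(1 + a) := by positivity
  set u := (√(1 + a))⁻¹ with hu
  have hu0 : 0 < u := by positivity
  have hu1 : u ≤ 1 := inv_le_one_of_one_le₀ (by rw [one_le_sqrt]; linarith)
  have hau : a * u ^ 2 ≤ 1 := by
    rw [hu, inv_pow, sq_sqrt (by positivity), ← div_eq_mul_inv, div_le_one (by positivity)]
    linarith
  have hmom : ∀ v : ℝ, |v| = u → ∑ l ∈ Finset.piAntidiag Finset.univ m,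
      mulP m z l * exp (v * (l i - a)) ≤ exp 1 := fun v hv => by
    have h1 := sum_mulP_mul_exp_le hz hz1 m i v
    have h2 := abs_exp_sub_one_sub_id_le (x := v) (hv ▸ hu1)
    have h3 := (abs_le.1 h2).2
    have h4 : v ^ 2 = u ^ 2 := by rw [← sq_abs, hv]
    calc _ = exp (-v * a) * ∑ l ∈ Finset.piAntidiag Finset.univ m, mulP m z l * exp (v * l i) := by
          rw [Finset.mul_sum]
          refine Finset.sum_congr rfl fun l _ => ?_
          rw [mul_left_comm, ← exp_add]; congr 2; ring
      _ ≤ exp (-v * a) * exp (a * (exp v - 1)) := by gcongr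
      _ ≤ _ := by
        rw [← exp_add]; gcongr
        nlinarith [mul_le_mul_of_nonneg_left h3 ha]
  have hp := hmom u (abs_of_pos hu0)
  have hn := hmom (-u) (by rw [abs_neg, abs_of_pos hu0])
  calc _ ≤ ∑ l ∈ Finset.piAntidiag Finset.univ m,
      exp (-K) * (mulP m z l * exp (u * (l i - a)) + mulP m z l * exp (-u * (l i - a))) := by
        rw [Finset.sum_filter]
        refine Finset.sum_le_sum fun l _ => ?_
        have h0 := mulP_nonneg hz m l
        split_ifs with h
        · have h5 : K < u * |(l i : ℝ) - a| := by
            rw [hu, inv_mul_eq_div, lt_div_iff₀ hs]; exact h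
          have h6 : 1 ≤ exp (-K) * (exp (u * (l i - a)) + exp (-u * (l i - a))) := by
            rw [mul_add, ← exp_add, ← exp_add]
            rcases abs_cases ((l i : ℝ) - a) with ⟨h7, -⟩ | ⟨h7, -⟩ <;> rw [h7] at h5
            · have := one_le_exp (by linarith : 0 ≤ -K + u * (l i - a))
              linarith [exp_pos (-K + -u * (l i - a))]
            · have := one_le_exp (by linarith : 0 ≤ -K + -u * (l i - a))
              linarith [exp_pos (-K + u * (l i - a))]
          nlinarith [mul_le_mul_of_nonneg_left h6 h0]
        · positivity
    _ ≤ _ := by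
      rw [← Finset.mul_sum, Finset.sum_add_distrib]
      nlinarith [exp_pos (-K), mul_le_mul_of_nonneg_left hp (exp_pos (-K)).le,
        mul_le_mul_of_nonneg_left hn (exp_pos (-K)).le]

end

section
variable {ι : Type*} [Fintype ι] [DecidableEq ι]

theorem rpow_ge_of_le {x p R : ℝ} (hx : 0 < x) (h1 : x ≤ R) (h2 : x⁻¹ ≤ R) {N : ℕ}
    (hp : |p| ≤ N) : (R ^ N)⁻¹ ≤ x ^ p := by
  have h := rpow_le_max_pow (p := -p) hx (by rwa [abs_neg])
  have hR : max x x⁻¹ ≤ R := max_le h1 h2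
  have h0 : 0 < max x x⁻¹ := hx.trans_le (le_max_left _ _)
  rw [rpow_neg hx.le] at h
  exact inv_le_of_inv_le₀ (rpow_pos_of_pos hx _) (h.trans (by gcongr))

theorem typical_ratio {a K l : ℝ} (ha : 0 ≤ a) (hK : 0 ≤ K) (hl : 0 ≤ l)
    (h : |l - a| ≤ K * √(1 + a)) :
    (l + 1) / (1 + a) ≤ 2 + K + K ^ 2 ∧ ((l + 1) / (1 + a))⁻¹ ≤ 2 + K + K ^ 2 := by
  have hsq : √(1 + a) ^ 2 = 1 + a := sq_sqrt (by positivity)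
  have hs1 : 1 ≤ √(1 + a) := by rw [one_le_sqrt]; linarith
  obtain ⟨h1, h2⟩ := abs_le.1 h
  have h3 : √(1 + a) ≤ 1 + a := by nlinarith
  constructor
  · rw [div_le_iff₀ (by positivity)]
    nlinarith [mul_le_mul_of_nonneg_left h3 hK, mul_nonneg (sq_nonneg K) ha, sq_nonneg K]
  · rw [inv_div, div_le_iff₀ (by positivity)]
    nlinarith [sq_nonneg (√(1 + a) - K), mul_nonneg hl hK, mul_nonneg hl (sq_nonneg K)]

theorem half_le_sum_mulP_typical {z : ι → ℝ} (hz : ∀ i, 0 ≤ z i) (hz1 : ∑ i, z i = 1) (m : ℕ)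
    {K : ℝ} (hK : Fintype.card ι * (2 * exp 1 * exp (-K)) ≤ 1 / 2) :
    1 / 2 ≤ ∑ l ∈ (Finset.piAntidiag Finset.univ m).filter
      (fun l : ι → ℕ => ∀ i, |(l i : ℝ) - m * z i| ≤ K * √(1 + m * z i)), mulP m z l := by
  classical
  have h1 := sum_mulP m z
  rw [hz1, one_pow, ← Finset.sum_filter_add_sum_filter_not _
    (fun l : ι → ℕ => ∀ i, |(l i : ℝ) - m * z i| ≤ K * √(1 + m * z i))] at h1
  have h2 : ∑ l ∈ (Finset.piAntidiag Finset.univ m).filter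
      (fun l : ι → ℕ => ¬ ∀ i, |(l i : ℝ) - m * z i| ≤ K * √(1 + m * z i)), mulP m z l
      ≤ ∑ _i : ι, 2 * exp 1 * exp (-K) := by
    refine le_trans ?_ (Finset.sum_le_sum fun i _ => sum_mulP_atypical_le hz hz1 m i K)
    simp_rw [Finset.sum_filter]
    rw [Finset.sum_comm]
    refine Finset.sum_le_sum fun l _ => ?_
    have h0 := mulP_nonneg hz m l
    have h3 : ∀ j, 0 ≤ if K * √(1 + m * z j) < |(l j : ℝ) - m * z j| then mulP m z l else 0 :=
      fun j => by split_ifs <;> simp [h0]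
    by_cases h : ∀ i, |(l i : ℝ) - m * z i| ≤ K * √(1 + m * z i)
    · rw [if_neg (not_not.2 h)]
      exact Finset.sum_nonneg fun j _ => h3 j
    · rw [if_pos h]
      push Not at h
      obtain ⟨i, hi⟩ := h
      refine le_trans ?_ (Finset.single_le_sum (fun j _ => h3 j) (Finset.mem_univ i))
      rw [if_pos hi]
  rw [Finset.sum_const, Finset.card_univ, nsmul_eq_mul] at h2
  linarith

theorem sqrt_div_prod_le_sum_sq_typical {z : ι → ℝ} (hz : ∀ i, 0 ≤ z i) (hz1 : ∑ i, z i = 1)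
    (m : ℕ) {K : ℝ} (hK0 : 0 ≤ K) (hK : Fintype.card ι * (2 * exp 1 * exp (-K)) ≤ 1 / 2) :
    √(1 + m) / ∏ i, √(1 + m * z i) ≤
      4 * (√(Fintype.card ι) * (2 * K + 1) ^ Fintype.card ι + 1) *
      ∑ l ∈ (Finset.piAntidiag Finset.univ m).filter
        (fun l : ι → ℕ => ∀ i, |(l i : ℝ) - m * z i| ≤ K * √(1 + m * z i)), mulP m z l ^ 2 := by
  classical
  set c := Fintype.card ι with hc
  have hι : 0 ≤ (c : ℝ) := by positivity
  set D : ℝ := √c * (2 * K + 1) ^ c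
  have hne : Nonempty ι := by
    by_contra h
    rw [not_nonempty_iff] at h
    simp at hz1
  obtain ⟨i₀, hi₀⟩ : ∃ i, 1 ≤ c * z i := by
    by_contra! h
    have : ∑ i, c * z i < ∑ _i : ι, 1 := Finset.sum_lt_sum_of_nonempty Finset.univ_nonempty
      fun i _ => h i
    rw [← Finset.mul_sum, hz1] at this
    simp [hc] at this
  have ha : ∀ i, 0 ≤ m * z i := fun i => mul_nonneg m.cast_nonneg (hz i)
  set S := (Finset.piAntidiag Finset.univ m).filter
      (fun l : ι → ℕ => ∀ i, |(l i : ℝ) - m * z i| ≤ K * √(1 + m * z i)) with hS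
  have hhalf := half_le_sum_mulP_typical hz hz1 m hK
  have hcs := sq_sum_le_card_mul_sum_sq (s := S) (f := fun l => mulP m z l)
  set Q := ∑ l ∈ S, mulP m z l ^ 2 with hQ
  have hQ0 : 0 ≤ Q := Finset.sum_nonneg fun l _ => sq_nonneg _
  have hcard : (S.card : ℝ) * √(1 + m) ≤ D * ∏ i, √(1 + m * z i) := by
    have h5 : (S.card : ℝ) ≤ _ := card_typical_le (a := fun i => m * z i)
      (w := fun i => K * √(1 + m * z i)) (fun i => by positivity) m i₀
    have h6 : ∏ i ∈ Finset.univ.erase i₀, (2 * (K * √(1 + m * z i)) + 1) ≤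
        (2 * K + 1) ^ c * ∏ i ∈ Finset.univ.erase i₀, √(1 + m * z i) := by
      calc _ ≤ ∏ i ∈ Finset.univ.erase i₀, ((2 * K + 1) * √(1 + m * z i)) :=
            Finset.prod_le_prod (fun i _ => by positivity) fun i _ => by
              have : 1 ≤ √(1 + m * z i) := by rw [one_le_sqrt]; linarith [ha i]
              nlinarith
        _ ≤ _ := by
          rw [Finset.prod_mul_distrib, Finset.prod_const]
          gcongr
          · linarith
          · exact Finset.card_le_univ _
    have h7 : √(1 + m) ≤ √c * √(1 + m * z i₀) := by
      rw [← sqrt_mul hι]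
      refine sqrt_le_sqrt ?_
      have h71 : z i₀ ≤ 1 := hz1 ▸ Finset.single_le_sum (fun j _ => hz j) (Finset.mem_univ i₀)
      nlinarith [mul_le_mul_of_nonneg_left hi₀ (m.cast_nonneg : (0 : ℝ) ≤ m)]
    rw [← Finset.mul_prod_erase _ _ (Finset.mem_univ i₀)]
    have h8 : 0 ≤ ∏ i ∈ Finset.univ.erase i₀, √(1 + m * z i) := by positivity
    calc (S.card : ℝ) * √(1 + m) ≤ ((2 * K + 1) ^ c *
          ∏ i ∈ Finset.univ.erase i₀, √(1 + m * z i)) * (√c * √(1 + m * z i₀)) :=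
          mul_le_mul (h5.trans h6) h7 (by positivity) (by positivity)
      _ = _ := by simp only [D]; ring
  have h9 : 0 < ∏ i, √(1 + m * z i) := Finset.prod_pos fun i _ => by have := ha i; positivity
  rw [div_le_iff₀ h9]
  have h10 : 1 / 4 ≤ S.card * Q := le_trans (by nlinarith) hcs
  have h11 := mul_le_mul_of_nonneg_right hcard hQ0
  have h12 : 0 ≤ √(1 + (m : ℝ)) := by positivity
  nlinarith [mul_le_mul_of_nonneg_left h10 h12, mul_nonneg h9.le hQ0]

theorem le_bernKer_sq {α : ι → ℝ} (hα : ∀ i, 0 < α i) (hθ : 0 < ∑ i, α i) :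
    ∃ c > 0, ∀ z : ι → ℝ, (∀ i, 0 ≤ z i) → ∑ i, z i = 1 → ∀ m : ℕ,
      c * volF α m z ≤ bernKer α m (fun i => z i ^ 2) := by
  classical
  obtain ⟨c1, hc1, _, _, h1⟩ := Gamma_div_factorial_bounds hθ
  obtain ⟨c2, hc2, _, _, h2⟩ := prod_factorial_div_Gamma_bounds hα
  obtain ⟨N, hN⟩ := exists_nat_abs_le (fun i => 1 - α i)
  set c := Fintype.card ι with hc
  set K : ℝ := 4 * exp 1 * c with hKdef
  have hK0 : 0 ≤ K := by positivity
  have hK : c * (2 * exp 1 * exp (-K)) ≤ 1 / 2 := by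
    have h3 := add_one_le_exp K
    rw [exp_neg, ← div_eq_mul_inv, ← mul_div_assoc, div_le_iff₀ (exp_pos _)]
    nlinarith
  set R : ℝ := 2 + K + K ^ 2
  have hR : 0 < R := by positivity
  set D : ℝ := √c * (2 * K + 1) ^ c
  set c4 : ℝ := ((R ^ N)⁻¹) ^ c
  have hι : 0 ≤ (c : ℝ) := by positivity
  refine ⟨c1 * c2 * c4 / (4 * (D + 1)), by positivity, fun z hz hz1 m => ?_⟩
  have ha : ∀ i, 0 ≤ m * z i := fun i => mul_nonneg m.cast_nonneg (hz i)
  have hlow := sqrt_div_prod_le_sum_sq_typical hz hz1 m hK0 hK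
  set S := (Finset.piAntidiag Finset.univ m).filter
      (fun l : ι → ℕ => ∀ i, |(l i : ℝ) - m * z i| ≤ K * √(1 + m * z i)) with hS
  set Q := ∑ l ∈ S, mulP m z l ^ 2 with hQ
  rw [bernKer_sq hα]
  have hg : 0 < Gamma ((∑ i, α i) + m) := Gamma_pos_of_pos (by positivity)
  have hgp : ∀ l : ι → ℕ, ∀ i, 0 < ((l i).factorial : ℝ) / Gamma (α i + l i) := fun l i => by
    have : 0 < Gamma (α i + l i) := Gamma_pos_of_pos (by have := hα i; positivity)
    positivity
  have hBp : 0 < ∏ i, (1 + m * z i) ^ (1 - α i) :=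
    Finset.prod_pos fun i _ => rpow_pos_of_pos (by have := ha i; positivity) _
  have hterm : ∀ l ∈ S, c1 * c2 * c4 * (1 + m) ^ ((∑ i, α i) - 1) *
      (∏ i, (1 + m * z i) ^ (1 - α i)) * mulP m z l ^ 2 ≤
      Gamma ((∑ i, α i) + m) / m.factorial *
        (mulP m z l ^ 2 * ∏ i, (l i).factorial / Gamma (α i + l i)) := fun l hl => by
    rw [hS, Finset.mem_filter] at hl
    have e1 := (h1 m).1
    have e2 := (h2 l).1
    have e3 : c4 * ∏ i, (1 + m * z i) ^ (1 - α i) ≤ ∏ i, ((l i : ℝ) + 1) ^ (1 - α i) := by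
      have : c4 = ∏ _i : ι, (R ^ N)⁻¹ := by simp [c4, hc]
      rw [this, ← Finset.prod_mul_distrib]
      refine Finset.prod_le_prod (fun i _ => by have := ha i; positivity) fun i _ => ?_
      have hai := ha i
      have e4 := typical_ratio hai hK0 (Nat.cast_nonneg (l i)) (hl.2 i)
      have e4 := rpow_ge_of_le (by positivity) e4.1 e4.2 (hN i)
      rw [div_rpow (by positivity) (by positivity), le_div_iff₀ (by positivity)] at e4
      exact e4
    have e5 : (c2 * (c4 * ∏ i, (1 + m * z i) ^ (1 - α i))) ≤
        ∏ i, ((l i).factorial : ℝ) / Gamma (α i + l i) :=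
      (mul_le_mul_of_nonneg_left e3 hc2.le).trans e2
    have e6 : 0 ≤ mulP m z l ^ 2 := sq_nonneg _
    calc _ = (c1 * ((m : ℝ) + 1) ^ ((∑ i, α i) - 1)) *
          (mulP m z l ^ 2 * (c2 * (c4 * ∏ i, (1 + m * z i) ^ (1 - α i)))) := by
          rw [add_comm (m : ℝ)]; ring
      _ ≤ _ := by gcongr
  calc c1 * c2 * c4 / (4 * (D + 1)) * volF α m z
      = c1 * c2 * c4 * (1 + m) ^ ((∑ i, α i) - 1) * (∏ i, (1 + m * z i) ^ (1 - α i)) *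
        ((√(1 + m) / ∏ i, √(1 + m * z i)) / (4 * (D + 1))) := by
        unfold volF
        have e1 : (1 + (m : ℝ)) ^ ((∑ i, α i) - 1 / 2) = (1 + m) ^ ((∑ i, α i) - 1) * √(1 + m) := by
          rw [sqrt_eq_rpow, ← rpow_add (by positivity)]; congr 1; ring
        have e2 : ∏ i, (1 + m * z i) ^ (1 / 2 - α i) =
            (∏ i, (1 + m * z i) ^ (1 - α i)) / ∏ i, √(1 + m * z i) := by
          rw [← Finset.prod_div_distrib]
          refine Finset.prod_congr rfl fun i _ => ?_
          have := ha i
          rw [sqrt_eq_rpow, ← rpow_sub (by positivity)]; congr 1; ring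
        rw [e1, e2]; ring
    _ ≤ c1 * c2 * c4 * (1 + m) ^ ((∑ i, α i) - 1) * (∏ i, (1 + m * z i) ^ (1 - α i)) * Q := by
        have : (√(1 + m) / ∏ i, √(1 + m * z i)) / (4 * (D + 1)) ≤ Q := by
          rw [div_le_iff₀ (by positivity)]; linarith
        gcongr
    _ ≤ _ := by
        rw [hQ, Finset.mul_sum]
        refine (Finset.sum_le_sum hterm).trans ?_
        refine Finset.sum_le_sum_of_subset_of_nonneg (Finset.filter_subset _ _) fun l _ _ => ?_
        have := Finset.prod_pos fun i (_ : i ∈ Finset.univ) => hgp l i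
        positivity

end

section
variable {ι : Type*} [Fintype ι]

theorem volF_pos {α : ι → ℝ} {M : ℝ} (hM : 0 ≤ M) {x : ι → ℝ} (hx : ∀ i, 0 ≤ x i) :
    0 < volF α M x := by
  unfold volF
  have : 0 < ∏ i, (1 + M * x i) ^ (1 / 2 - α i) :=
    Finset.prod_pos fun i _ => rpow_pos_of_pos (by have := hx i; positivity) _
  positivity

theorem rpow_le_pow_mul_rpow {a b r p : ℝ} (ha : 0 < a) (hb : 0 < b) (h1 : a ≤ r * b)
    (h2 : b ≤ r * a) {N : ℕ} (hp : |p| ≤ N) : a ^ p ≤ r ^ N * b ^ p := by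
  have h := rpow_le_max_pow (x := a / b) (by positivity) hp
  rw [div_rpow ha.le hb.le, div_le_iff₀ (by positivity)] at h
  refine h.trans ?_
  have h3 : max (a / b) (a / b)⁻¹ ≤ r := max_le ((div_le_iff₀ hb).2 h1)
    (by rw [inv_div]; exact (div_le_iff₀ ha).2 h2)
  have h4 : 0 ≤ max (a / b) (a / b)⁻¹ := le_max_of_le_left (by positivity)
  gcongr

theorem volF_le_volF (α : ι → ℝ) : ∃ K : ℕ, ∀ r M M' : ℝ, ∀ x y : ι → ℝ, 0 ≤ M → 0 ≤ M' →
    (∀ i, 0 ≤ x i) → (∀ i, 0 ≤ y i) → 1 + M ≤ r * (1 + M') → 1 + M' ≤ r * (1 + M) →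
    (∀ i, 1 + M * x i ≤ r * (1 + M' * y i)) → (∀ i, 1 + M' * y i ≤ r * (1 + M * x i)) →
    volF α M x ≤ r ^ K * volF α M' y := by
  obtain ⟨N, hN⟩ := exists_nat_abs_le (fun i => 1 / 2 - α i)
  obtain ⟨N', hN'⟩ := exists_nat_ge |(∑ i, α i) - 1 / 2|
  refine ⟨N' + N * Fintype.card ι, fun r M M' x y hM hM' hx hy h1 h2 h3 h4 => ?_⟩
  unfold volF
  have e1 := rpow_le_pow_mul_rpow (by positivity) (by positivity) h1 h2 hN'
  have e2 : ∏ i, (1 + M * x i) ^ (1 / 2 - α i) ≤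
      (r ^ N) ^ Fintype.card ι * ∏ i, (1 + M' * y i) ^ (1 / 2 - α i) := by
    calc _ ≤ ∏ i, (r ^ N * (1 + M' * y i) ^ (1 / 2 - α i)) := by
          refine Finset.prod_le_prod (fun i _ => ?_) fun i _ => ?_
          · have := hx i; positivity
          · have := hx i
            have := hy i
            exact rpow_le_pow_mul_rpow (by positivity) (by positivity) (h3 i) (h4 i) (hN i)
      _ = _ := by rw [Finset.prod_mul_distrib]; simp
  have e3 : 0 ≤ ∏ i, (1 + M * x i) ^ (1 / 2 - α i) :=
    Finset.prod_nonneg fun i _ => by have := hx i; positivity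
  calc _ ≤ (r ^ N' * (1 + M') ^ ((∑ i, α i) - 1 / 2)) *
        ((r ^ N) ^ Fintype.card ι * ∏ i, (1 + M' * y i) ^ (1 / 2 - α i)) :=
        mul_le_mul e1 e2 e3 (le_trans (by positivity) e1)
    _ = _ := by rw [pow_add, pow_mul]; ring

theorem le_one_of_mem_stdSimplex {x : ι → ℝ} (hx : x ∈ stdSimplex ℝ ι) (i : ι) : x i ≤ 1 :=
  hx.2 ▸ Finset.single_le_sum (fun j _ => hx.1 j) (Finset.mem_univ i)

theorem volF_le_volF_scale (α : ι → ℝ) : ∃ K : ℕ, ∀ r M M' : ℝ, ∀ x ∈ stdSimplex ℝ ι,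
    0 ≤ M → 0 ≤ M' → 1 ≤ r → 1 + M ≤ r * (1 + M') → 1 + M' ≤ r * (1 + M) →
    volF α M x ≤ r ^ K * volF α M' x := by
  obtain ⟨K, hK⟩ := volF_le_volF α
  have key : ∀ r M M' a : ℝ, 0 ≤ a → a ≤ 1 → 1 ≤ r → 1 + M ≤ r * (1 + M') →
      1 + M * a ≤ r * (1 + M' * a) := fun r M M' a ha h1 hr h => by
    nlinarith [mul_le_mul_of_nonneg_right h ha]
  exact ⟨K, fun r M M' x hx hM hM' hr h1 h2 => hK r M M' x x hM hM' hx.1 hx.1 h1 h2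
    (fun i => key _ _ _ _ (hx.1 i) (le_one_of_mem_stdSimplex hx i) hr h1)
    (fun i => key _ _ _ _ (hx.1 i) (le_one_of_mem_stdSimplex hx i) hr h2)⟩

def aff (x y : ι → ℝ) : ℝ := ∑ i, √(x i * y i)

theorem aff_nonneg (x y : ι → ℝ) : 0 ≤ aff x y := Finset.sum_nonneg fun _ _ => sqrt_nonneg _

theorem aff_comm (x y : ι → ℝ) : aff x y = aff y x := by simp [aff, mul_comm]

theorem sum_sq_sqrt_sub {x y : ι → ℝ} (hx : x ∈ stdSimplex ℝ ι) (hy : y ∈ stdSimplex ℝ ι) :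
    ∑ i, (√(x i) - √(y i)) ^ 2 = 2 * (1 - aff x y) := by
  have : ∀ i, (√(x i) - √(y i)) ^ 2 = x i + y i - 2 * √(x i * y i) := fun i => by
    rw [sqrt_mul (hx.1 i), sub_sq, sq_sqrt (hx.1 i), sq_sqrt (hy.1 i)]; ring
  simp_rw [this]
  rw [Finset.sum_sub_distrib, Finset.sum_add_distrib, hx.2, hy.2, ← Finset.mul_sum, aff]
  ring

theorem aff_le_one {x y : ι → ℝ} (hx : x ∈ stdSimplex ℝ ι) (hy : y ∈ stdSimplex ℝ ι) :
    aff x y ≤ 1 := by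
  have := sum_sq_sqrt_sub hx hy
  have h2 : 0 ≤ ∑ i, (√(x i) - √(y i)) ^ 2 := Finset.sum_nonneg fun _ _ => sq_nonneg _
  linarith

theorem sq_sqrt_sub_le {x y : ι → ℝ} (hx : x ∈ stdSimplex ℝ ι) (hy : y ∈ stdSimplex ℝ ι) (i : ι) :
    (√(x i) - √(y i)) ^ 2 ≤ 2 * (1 - aff x y) := by
  rw [← sum_sq_sqrt_sub hx hy]
  exact Finset.single_le_sum (f := fun i => (√(x i) - √(y i)) ^ 2)
    (fun _ _ => sq_nonneg _) (Finset.mem_univ i)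

theorem le_two_mul_add {x y : ι → ℝ} (hx : x ∈ stdSimplex ℝ ι) (hy : y ∈ stdSimplex ℝ ι) (i : ι) :
    x i ≤ 2 * y i + 4 * (1 - aff x y) := by
  have h := sq_sqrt_sub_le hx hy i
  have h1 := sq_sqrt (hx.1 i)
  have h2 := sq_sqrt (hy.1 i)
  nlinarith [sq_nonneg (√(x i) - 2 * √(y i))]

theorem volF_le_volF_point (α : ι → ℝ) : ∃ K : ℕ, ∀ M : ℝ, ∀ x ∈ stdSimplex ℝ ι,
    ∀ y ∈ stdSimplex ℝ ι, 0 ≤ M →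
    volF α M x ≤ (2 * (1 + 2 * M * (1 - aff x y))) ^ K * volF α M y := by
  obtain ⟨K, hK⟩ := volF_le_volF α
  refine ⟨K, fun M x hx y hy hM => ?_⟩
  have he := sub_nonneg.2 (aff_le_one hx hy)
  have key : ∀ x ∈ stdSimplex ℝ ι, ∀ y ∈ stdSimplex ℝ ι, ∀ i,
      1 + M * x i ≤ 2 * (1 + 2 * M * (1 - aff x y)) * (1 + M * y i) := fun x hx y hy i => by
    have he := sub_nonneg.2 (aff_le_one hx hy)
    have h1 := mul_le_mul_of_nonneg_left (le_two_mul_add hx hy i) hM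
    have h2 := mul_nonneg hM he
    have h3 := mul_nonneg hM (hy.1 i)
    nlinarith [mul_nonneg h2 h3]
  have h2 := mul_nonneg hM he
  have h0 : 1 + M ≤ 2 * (1 + 2 * M * (1 - aff x y)) * (1 + M) := by nlinarith
  exact hK _ M M x y hM hM hx.1 hy.1 h0 h0 (key x hx y hy)
    (fun i => by rw [aff_comm]; exact key y hy x hx i)

theorem exists_mid {x y : ι → ℝ} (hx : x ∈ stdSimplex ℝ ι) (hy : y ∈ stdSimplex ℝ ι) :
    ∃ z ∈ stdSimplex ℝ ι, (∀ i, x i * y i = aff x y ^ 2 * z i ^ 2) ∧ ∀ M : ℝ, 0 ≤ M →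
      (∀ i, 1 + M * x i ≤ 4 * (1 + 2 * M * (1 - aff x y)) * (1 + M * z i)) ∧
      (∀ i, 1 + M * z i ≤ 4 * (1 + 2 * M * (1 - aff x y)) * (1 + M * x i)) := by
  have hS0 := aff_nonneg x y
  have hS1 := aff_le_one hx hy
  obtain ⟨z, hz, hzs⟩ : ∃ z ∈ stdSimplex ℝ ι, ∀ i, √(x i * y i) = aff x y * z i := by
    rcases hS0.eq_or_lt with h | h
    · refine ⟨x, hx, fun i => ?_⟩
      rw [← h, zero_mul]
      exact (Finset.sum_eq_zero_iff_of_nonneg (fun _ _ => sqrt_nonneg _)).1 h.symm i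
        (Finset.mem_univ i)
    · refine ⟨fun i => √(x i * y i) / aff x y, ⟨fun i => by positivity, ?_⟩, fun i => ?_⟩
      · rw [← Finset.sum_div]; exact div_self h.ne'
      · field_simp
  refine ⟨z, hz, fun i => ?_, fun M hM => ?_⟩
  · rw [← mul_pow, ← hzs, sq_sqrt (mul_nonneg (hx.1 i) (hy.1 i))]
  set S := aff x y with hS
  have he : 0 ≤ M * (1 - S) := mul_nonneg hM (by linarith)
  by_cases hh : S < 1 / 2
  · have key : ∀ x ∈ stdSimplex ℝ ι, ∀ z ∈ stdSimplex ℝ ι, ∀ i,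
        1 + M * x i ≤ 4 * (1 + 2 * M * (1 - S)) * (1 + M * z i) := fun x hx z hz i => by
      have h1 := mul_le_mul_of_nonneg_left (le_one_of_mem_stdSimplex hx i) hM
      have h2 := mul_nonneg hM (hz.1 i)
      nlinarith [mul_nonneg he h2]
    exact ⟨key x hx z hz, key z hz x hx⟩
  · push Not at hh
    have hs : ∀ i, √(x i * y i) = √(x i) * √(y i) := fun i => sqrt_mul (hx.1 i) _
    constructor <;> intro i
    · have h1 := sq_sqrt_sub_le hx hy i
      have h2 := sq_sqrt (hx.1 i)
      have h3 : x i ≤ 2 * z i + 2 * (1 - S) := by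
        have : S * z i ≤ z i := by nlinarith [hz.1 i]
        rw [← hS] at h1
        nlinarith [hzs i, hs i, sq_sqrt (hy.1 i), hy.1 i]
      have h4 := mul_le_mul_of_nonneg_left h3 hM
      have h5 := mul_nonneg hM (hz.1 i)
      nlinarith [mul_nonneg he h5]
    · have h1 := sq_sqrt_sub_le hx hy i
      have h2 := sq_sqrt (hx.1 i)
      have h3 : z i ≤ 4 * x i + 2 * (1 - S) := by
        have : z i ≤ 2 * (S * z i) := by nlinarith [hz.1 i]
        rw [← hS] at h1
        nlinarith [hzs i, hs i, sq_nonneg (√(x i) - √(y i)), sq_nonneg (3 * √(x i) - √(y i)),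
          sq_sqrt (hy.1 i), le_two_mul_add hy hx i, aff_comm y x]
      have h4 := mul_le_mul_of_nonneg_left h3 hM
      have h5 := mul_nonneg hM (hx.1 i)
      nlinarith [mul_nonneg he h5]

variable [DecidableEq ι]

theorem bernKer_mul_sq (α : ι → ℝ) (m : ℕ) (s : ℝ) (p : ι → ℝ) :
    bernKer α m (fun i => s * p i) = s ^ m * bernKer α m p := by
  unfold bernKer
  rw [mul_left_comm]
  refine congrArg _ ?_
  rw [Finset.mul_sum]
  refine Finset.sum_congr rfl fun l hl => ?_
  have hl := sum_eq_of_mem_piAntidiag hl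
  have : s ^ m = ∏ i, s ^ l i := by rw [Finset.prod_pow_eq_pow_sum, hl]
  rw [this, ← Finset.prod_mul_distrib]
  exact Finset.prod_congr rfl fun i _ => by rw [mul_pow]; ring

theorem one_add_pow_le_exp (K : ℕ) {c : ℝ} (hc : 0 < c) :
    ∃ C > 0, ∀ v : ℝ, 0 ≤ v → (1 + v) ^ K ≤ C * exp (c * v) := by
  refine ⟨K.factorial * exp c / c ^ K, by positivity, fun v hv => ?_⟩
  have h := pow_div_factorial_le_exp (c * (1 + v)) (by positivity) K
  rw [div_le_iff₀ (by positivity), mul_pow, mul_add, mul_one, exp_add] at h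
  rw [div_mul_eq_mul_div, le_div_iff₀ (by positivity)]
  linarith

theorem bernKer_nonneg {α : ι → ℝ} (hα : ∀ i, 0 < α i) (m : ℕ) {p : ι → ℝ} (hp : ∀ i, 0 ≤ p i) :
    0 ≤ bernKer α m p := by
  unfold bernKer
  have h1 : 0 ≤ Gamma ((∑ i, α i) + m) :=
    Gamma_nonneg_of_nonneg (add_nonneg (Finset.sum_nonneg fun i _ => (hα i).le) m.cast_nonneg)
  refine mul_nonneg (mul_nonneg h1 (by positivity)) (Finset.sum_nonneg fun l _ =>
    Finset.prod_nonneg fun i _ => ?_)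
  have : 0 < Gamma (α i + l i) := Gamma_pos_of_pos (by have := hα i; positivity)
  have := hp i
  positivity

theorem bernKer_le {α : ι → ℝ} (hα : ∀ i, 0 < α i) (hθ : 0 < ∑ i, α i) :
    ∃ C > 0, ∀ x ∈ stdSimplex ℝ ι, ∀ y ∈ stdSimplex ℝ ι, ∀ m : ℕ,
      bernKer α m (fun i => x i * y i) ≤ C * exp (-(m * (1 - aff x y))) * volF α m x := by
  obtain ⟨C1, hC1, h1⟩ := bernKer_sq_le hα hθ
  obtain ⟨K, hK⟩ := volF_le_volF α
  obtain ⟨C2, hC2, h2⟩ := one_add_pow_le_exp K (c := 1 / 2) (by norm_num)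
  refine ⟨C1 * 4 ^ K * C2, by positivity, fun x hx y hy m => ?_⟩
  obtain ⟨z, hz, hzs, hM⟩ := exists_mid hx hy
  obtain ⟨hM1, hM2⟩ := hM m m.cast_nonneg
  have hS0 := aff_nonneg x y
  have hS1 := aff_le_one hx hy
  set S := aff x y
  have hS2 : 0 ≤ 1 - S := sub_nonneg.2 hS1
  have he : 0 ≤ (m : ℝ) * (1 - S) := mul_nonneg m.cast_nonneg (by linarith)
  have h0 : 1 + (m : ℝ) ≤ 4 * (1 + 2 * m * (1 - S)) * (1 + m) := by
    nlinarith [mul_nonneg he m.cast_nonneg, (m.cast_nonneg : (0 : ℝ) ≤ m)]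
  have h3 := hK _ m m z x m.cast_nonneg m.cast_nonneg hz.1 hx.1 h0 h0 hM2 hM1
  have h4 := h2 (2 * m * (1 - S)) (by linarith)
  have h5 : S ^ 2 ≤ exp (-(2 * (1 - S))) := by
    have := add_one_le_exp (-(1 - S))
    calc S ^ 2 ≤ exp (-(1 - S)) ^ 2 := by gcongr; linarith
      _ = _ := by rw [← exp_nat_mul]; congr 1; push_cast; ring
  have hv := (volF_pos (α := α) (m.cast_nonneg : (0 : ℝ) ≤ m) hx.1).le
  simp_rw [hzs]
  rw [bernKer_mul_sq]
  calc (S ^ 2) ^ m * bernKer α m (fun i => z i ^ 2)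
      ≤ exp (-(2 * (1 - S))) ^ m * (C1 * ((4 * (1 + 2 * m * (1 - S))) ^ K * volF α m x)) := by
        have := h1 z hz.1 hz.2 m
        have h6 : bernKer α m (fun i => z i ^ 2) ≤
          C1 * ((4 * (1 + 2 * m * (1 - S))) ^ K * volF α m x) := this.trans (by gcongr)
        have h7 := bernKer_nonneg hα m (p := fun i => z i ^ 2) fun i => sq_nonneg _
        gcongr
    _ ≤ exp (-(2 * (1 - S))) ^ m * (C1 * (4 ^ K * (C2 * exp (1 / 2 * (2 * m * (1 - S)))) *
        volF α m x)) := by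
        rw [mul_pow]; gcongr
    _ = _ := by
      rw [← exp_nat_mul]
      have : exp (-(m * (1 - S))) = exp (m * -(2 * (1 - S))) * exp (1 / 2 * (2 * m * (1 - S))) := by
        rw [← exp_add]; congr 1; ring
      rw [this]; ring

theorem le_bernKer {α : ι → ℝ} (hα : ∀ i, 0 < α i) (hθ : 0 < ∑ i, α i) :
    ∃ c > 0, ∃ B > 0, ∀ x ∈ stdSimplex ℝ ι, ∀ y ∈ stdSimplex ℝ ι, 1 - aff x y ≤ 1 / 2 → ∀ m : ℕ,
      c * exp (-(B * (m * (1 - aff x y)))) * volF α m x ≤ bernKer α m (fun i => x i * y i) := by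
  obtain ⟨c1, hc1, h1⟩ := le_bernKer_sq hα hθ
  obtain ⟨K, hK⟩ := volF_le_volF α
  refine ⟨c1 / 4 ^ K, by positivity, 4 + 2 * K, by positivity, fun x hx y hy hxy m => ?_⟩
  obtain ⟨z, hz, hzs, hM⟩ := exists_mid hx hy
  obtain ⟨hM1, hM2⟩ := hM m m.cast_nonneg
  have hS0 := aff_nonneg x y
  have hS1 := aff_le_one hx hy
  set S := aff x y
  have hS2 : 0 ≤ 1 - S := sub_nonneg.2 hS1
  have he : 0 ≤ (m : ℝ) * (1 - S) := mul_nonneg m.cast_nonneg (by linarith)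
  have h0 : 1 + (m : ℝ) ≤ 4 * (1 + 2 * m * (1 - S)) * (1 + m) := by
    nlinarith [mul_nonneg he m.cast_nonneg, (m.cast_nonneg : (0 : ℝ) ≤ m)]
  have h3 := hK _ m m x z m.cast_nonneg m.cast_nonneg hx.1 hz.1 h0 h0 hM1 hM2
  have h5 : exp (-(2 * (1 - S))) ≤ S := by
    have h6 := add_one_le_exp (2 * (1 - S))
    rw [exp_neg]
    refine inv_le_of_inv_le₀ (by linarith) (le_trans ?_ h6)
    rw [inv_le_iff_one_le_mul₀ (by linarith)]
    nlinarith
  have hvx := volF_pos (α := α) (m.cast_nonneg : (0 : ℝ) ≤ m) hx.1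
  have hvz := volF_pos (α := α) (m.cast_nonneg : (0 : ℝ) ≤ m) hz.1
  have h7 : (4 * (1 + 2 * m * (1 - S))) ^ K ≤ 4 ^ K * exp (2 * m * (1 - S)) ^ K := by
    rw [← mul_pow]
    gcongr
    linarith [add_one_le_exp (2 * m * (1 - S))]
  have h8 : exp (-((4 + 2 * K) * (m * (1 - S)))) * volF α m x ≤
      4 ^ K * ((exp (-(2 * (1 - S))) ^ 2) ^ m * volF α m z) := by
    calc _ ≤ exp (-((4 + 2 * K) * (m * (1 - S)))) *
          (4 ^ K * exp (2 * m * (1 - S)) ^ K * volF α m z) := by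
          gcongr
          exact h3.trans (by gcongr)
      _ = _ := by
        rw [← exp_nat_mul, ← pow_mul, ← exp_nat_mul]
        have : exp (((2 * m : ℕ) : ℝ) * -(2 * (1 - S))) =
            exp (-((4 + 2 * K) * (m * (1 - S)))) * exp (K * (2 * m * (1 - S))) := by
          rw [← exp_add]; congr 1; push_cast; ring
        rw [this]; ring
  simp_rw [hzs]
  rw [bernKer_mul_sq]
  calc _ = c1 / 4 ^ K * (exp (-((4 + 2 * K) * (m * (1 - S)))) * volF α m x) := by ring
    _ ≤ c1 / 4 ^ K * (4 ^ K * ((exp (-(2 * (1 - S))) ^ 2) ^ m * volF α m z)) := by gcongr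
    _ = (exp (-(2 * (1 - S))) ^ 2) ^ m * (c1 * volF α m z) := by field_simp
    _ ≤ _ := by
      have := h1 z hz.1 hz.2 m
      gcongr

end

section
variable {ι : Type*} [Fintype ι] [DecidableEq ι]

theorem sum_pow_eq_sum_smul {A : Type*} [CommRing A] [Algebra ℝ A] (Y : ι → A) (m : ℕ) :
    (∑ i, Y i) ^ m = ∑ l ∈ Finset.piAntidiag Finset.univ m,
      ((m.factorial : ℝ) * ∏ i, ((l i).factorial : ℝ)⁻¹) • ∏ i, Y i ^ l i := by
  rw [Finset.sum_pow_eq_sum_piAntidiag]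
  refine Finset.sum_congr rfl fun l hl => ?_
  have h := Nat.multinomial_spec Finset.univ l
  rw [sum_eq_of_mem_piAntidiag hl] at h
  have h' : (∏ i, ((l i).factorial : ℝ)) * Nat.multinomial Finset.univ l = m.factorial := by
    exact_mod_cast h
  have h0 : (∏ i, ((l i).factorial : ℝ)) ≠ 0 :=
    Finset.prod_ne_zero_iff.2 fun i _ => by positivity
  have h2 : (m.factorial : ℝ) * ∏ i, ((l i).factorial : ℝ)⁻¹ = Nat.multinomial Finset.univ l := by
    rw [Finset.prod_inv_distrib, ← h']; field_simp
  rw [h2, ← nsmul_eq_mul, Nat.cast_smul_eq_nsmul]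

theorem sum_descFactorial_smul {A : Type*} [CommRing A] [Algebra ℝ A] (Y : ι → A) (m : ℕ)
    (p : ι → ℕ) :
    ∑ l ∈ Finset.piAntidiag Finset.univ m,
      ((m.factorial : ℝ) * ∏ i, ((l i).descFactorial (p i) : ℝ) * ((l i).factorial : ℝ)⁻¹) •
        ∏ i, Y i ^ l i
      = (m.descFactorial (∑ i, p i) : ℝ) • ((∏ i, Y i ^ p i) * (∑ i, Y i) ^ (m - ∑ i, p i)) := by
  have hzero : ∀ l : ι → ℕ, (∃ i, l i < p i) →
      ((m.factorial : ℝ) * ∏ i, ((l i).descFactorial (p i) : ℝ) * ((l i).factorial : ℝ)⁻¹) •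
        ∏ i, Y i ^ l i = 0 := fun l ⟨i, hi⟩ => by
    rw [Finset.prod_eq_zero (Finset.mem_univ i), mul_zero, zero_smul]
    rw [Nat.descFactorial_eq_zero_iff_lt.2 hi]; simp
  rcases lt_or_ge m (∑ i, p i) with h | h
  · rw [Nat.descFactorial_eq_zero_iff_lt.2 h, Nat.cast_zero, zero_smul]
    refine Finset.sum_eq_zero fun l hl => hzero l ?_
    by_contra! hc
    have := Finset.sum_le_sum fun i (_ : i ∈ Finset.univ) => hc i
    rw [sum_eq_of_mem_piAntidiag hl] at this
    omega
  · rw [sum_pow_eq_sum_smul, Finset.mul_sum, Finset.smul_sum]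
    symm
    refine Finset.sum_of_injOn (fun l => l + p) (fun a _ b _ hab => add_right_cancel hab) ?_ ?_ ?_
    · intro l hl
      have hl : l ∈ Finset.piAntidiag Finset.univ (m - ∑ i, p i) := hl
      rw [Finset.mem_coe, Finset.mem_piAntidiag]
      refine ⟨?_, fun _ _ => Finset.mem_univ _⟩
      simp only [Pi.add_apply]
      rw [Finset.sum_add_distrib, sum_eq_of_mem_piAntidiag hl]
      omega
    · intro l hl hl'
      refine hzero l ?_
      by_contra! hc
      refine hl' ⟨l - p, ?_, ?_⟩
      · rw [Finset.mem_coe, Finset.mem_piAntidiag]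
        refine ⟨?_, fun _ _ => Finset.mem_univ _⟩
        simp only [Pi.sub_apply]
        rw [Finset.sum_tsub_distrib _ fun i _ => hc i, sum_eq_of_mem_piAntidiag hl]
      · exact funext fun i => Nat.sub_add_cancel (hc i)
    · intro l hl
      simp only [Pi.add_apply, pow_add, Finset.prod_mul_distrib]
      rw [mul_smul_comm, smul_smul, mul_comm (∏ i, Y i ^ l i)]
      congr 1
      have h1 : (m.descFactorial (∑ i, p i) : ℝ) * (m - ∑ i, p i).factorial = m.factorial := by
        rw [mul_comm]; exact_mod_cast Nat.factorial_mul_descFactorial h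
      have h2 : ∀ i, ((l i).factorial : ℝ)⁻¹ =
          ((l i + p i).descFactorial (p i) : ℝ) * ((l i + p i).factorial : ℝ)⁻¹ := fun i => by
        have h3 := Nat.factorial_mul_descFactorial (Nat.le_add_left (p i) (l i))
        rw [Nat.add_sub_cancel] at h3
        have h3' : ((l i).factorial : ℝ) * ((l i + p i).descFactorial (p i) : ℝ) =
          (l i + p i).factorial := by exact_mod_cast h3
        rw [← h3']
        have h4 : ((l i + p i).descFactorial (p i) : ℝ) ≠ 0 := by
          rw [Nat.cast_ne_zero, Ne, Nat.descFactorial_eq_zero_iff_lt]; omega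
        field_simp
      rw [← mul_assoc, h1, ← Finset.prod_mul_distrib]
      congr 1
      exact Finset.prod_congr rfl fun i _ => h2 i

theorem Gamma_ratio_expansion {a : ℝ} (ha : 0 < a) (b : ℕ) :
    ∃ c : ℕ → ℝ, c b = 1 ∧ ∀ l : ℕ, Gamma (a + l + b) / Gamma (a + l) =
      ∑ j ∈ Finset.range (b + 1), c j * (l.descFactorial j : ℝ) := by
  induction b with
  | zero =>
    refine ⟨fun _ => 1, rfl, fun l => ?_⟩
    have : 0 < Gamma (a + l) := Gamma_pos_of_pos (by positivity)
    simp [this.ne']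
  | succ b ih =>
    obtain ⟨c, hc, h⟩ := ih
    have hd : ∀ l j : ℕ, (l.descFactorial (j + 1) : ℝ) = (l - j) * l.descFactorial j := by
      intro l j
      rw [Nat.descFactorial_succ]
      rcases le_or_gt j l with hjl | hjl
      · push_cast [Nat.cast_sub hjl]; ring
      · rw [Nat.descFactorial_eq_zero_iff_lt.2 hjl]; simp
    refine ⟨fun j => (if j = 0 then 0 else c (j - 1)) +
      (if j = b + 1 then 0 else (a + b + j) * c j), by simp [hc], fun l => ?_⟩
    have h1 : Gamma (a + l + (b + 1 : ℕ)) = (a + l + b) * Gamma (a + l + b) := by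
      rw [Nat.cast_succ, ← add_assoc, Gamma_add_one (by positivity)]
    rw [h1, mul_div_assoc, h, Finset.mul_sum]
    simp_rw [add_mul (ite _ _ _)]
    rw [Finset.sum_add_distrib, Finset.sum_range_succ' (fun j => (if j = 0 then 0 else c (j - 1)) *
      (l.descFactorial j : ℝ)), Finset.sum_range_succ (fun j => (if j = b + 1 then 0 else
      (a + b + j) * c j) * (l.descFactorial j : ℝ)) (b + 1)]
    simp only [Nat.add_eq_zero_iff, one_ne_zero, and_false, if_false, if_true, zero_mul, add_zero,
      Nat.add_sub_cancel]
    rw [← Finset.sum_add_distrib]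
    refine Finset.sum_congr rfl fun j hj => ?_
    rw [Finset.mem_range] at hj
    rw [if_neg (by omega), hd]
    ring

end

def gam (θ : ℝ) (m k : ℕ) : ℝ := m.descFactorial k * (Gamma (θ + m) / Gamma (θ + m + k))

theorem gam_eq_prod {θ : ℝ} (hθ : 0 < θ) (m k : ℕ) :
    gam θ m k = ∏ j ∈ Finset.range k, ((m - j) / (θ + m + j) : ℝ) := by
  unfold gam
  have hg := (Gamma_pos_of_pos (by positivity : 0 < θ + m)).ne'
  have hd : ∀ l j : ℕ, (l.descFactorial (j + 1) : ℝ) = (l - j) * l.descFactorial j := by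
    intro l j
    rw [Nat.descFactorial_succ]
    rcases le_or_gt j l with hjl | hjl
    · push_cast [Nat.cast_sub hjl]; ring
    · rw [Nat.descFactorial_eq_zero_iff_lt.2 hjl]; simp
  induction k with
  | zero => simp [hg]
  | succ k ih =>
    rw [Finset.prod_range_succ, ← ih, hd, Nat.cast_succ, ← add_assoc,
      Gamma_add_one (by positivity)]
    have := (Gamma_pos_of_pos (by positivity : 0 < θ + m + k)).ne'
    field_simp

theorem gam_zero {θ : ℝ} (hθ : 0 < θ) (m : ℕ) : gam θ m 0 = 1 := by
  rw [gam_eq_prod hθ]; simp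

theorem gam_eq_zero {θ : ℝ} {m k : ℕ} (h : m < k) : gam θ m k = 0 := by
  unfold gam; rw [Nat.descFactorial_eq_zero_iff_lt.2 h]; simp

theorem gam_nonneg {θ : ℝ} (hθ : 0 < θ) (m k : ℕ) : 0 ≤ gam θ m k := by
  unfold gam
  have := (Gamma_pos_of_pos (by positivity : 0 < θ + m))
  have := (Gamma_pos_of_pos (by positivity : 0 < θ + m + k))
  positivity

theorem gam_le_one {θ : ℝ} (hθ : 0 < θ) (m k : ℕ) : gam θ m k ≤ 1 := by
  rcases lt_or_ge m k with h | h
  · rw [gam_eq_zero h]; exact zero_le_one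
  · rw [gam_eq_prod hθ]
    refine Finset.prod_le_one (fun j hj => ?_) fun j hj => ?_
    · rw [Finset.mem_range] at hj
      have : (j : ℝ) ≤ m := by exact_mod_cast (by omega : j ≤ m)
      exact div_nonneg (by linarith) (by positivity)
    · rw [div_le_one (by positivity)]
      linarith [(j.cast_nonneg : (0 : ℝ) ≤ j)]

theorem tendsto_gam {θ : ℝ} (hθ : 0 < θ) (k : ℕ) :
    Filter.Tendsto (fun m => gam θ m k) Filter.atTop (nhds 1) := by
  simp_rw [gam_eq_prod hθ]
  rw [← Finset.prod_const_one (s := Finset.range k)]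
  refine tendsto_finsetProd _ fun j _ => ?_
  have h1 : Filter.Tendsto (fun m : ℕ => (m : ℝ) / (m + (θ + j))) Filter.atTop (nhds 1) :=
    tendsto_natCast_div_add_atTop _
  have h2 : Filter.Tendsto (fun m : ℕ => (j : ℝ) / (m + (θ + j))) Filter.atTop (nhds 0) :=
    Filter.Tendsto.div_atTop tendsto_const_nhds
      (Filter.tendsto_atTop_add_const_right _ _ tendsto_natCast_atTop_atTop)
  have h3 := h1.sub h2
  rw [sub_zero] at h3
  refine h3.congr fun m => ?_
  rw [← sub_div]; congr 1; ring

theorem gam_succ {θ : ℝ} (hθ : 0 < θ) (m k : ℕ) :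
    (m + 1) * (m + θ) * (gam θ m k - gam θ (m + 1) k) = -(k * (k + θ - 1)) * gam θ (m + 1) k := by
  have key : (m + 1) * (m + θ) * gam θ m k = (m + 1 - k) * (θ + m + k) * gam θ (m + 1) k := by
    induction k with
    | zero => rw [gam_zero hθ, gam_zero hθ]; push_cast; ring
    | succ k ih =>
      have h1 : ∀ m : ℕ, gam θ m (k + 1) = gam θ m k * ((m - k) / (θ + m + k)) := fun m => by
        rw [gam_eq_prod hθ, gam_eq_prod hθ, Finset.prod_range_succ]
      rw [h1, h1]
      have e1 : θ + m + k ≠ 0 := by positivity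
      have e2 : θ + (m + 1) + k ≠ 0 := by positivity
      push_cast
      calc _ = ((m + 1) * (m + θ) * gam θ m k) * ((m - k) / (θ + m + k)) := by ring
        _ = _ := by rw [ih]; field_simp; ring
  linear_combination key

theorem lintegral_beta_scaled {a b s : ℝ} (ha : 0 < a) (hb : 0 < b) (hs : 0 < s) :
    ∫⁻ u in Set.Ioo 0 s, ENNReal.ofReal (u ^ (a - 1) * (s - u) ^ (b - 1)) =
      ENNReal.ofReal (s ^ (a + b - 1) * (Gamma a * Gamma b / Gamma (a + b))) := by
  set B := ProbabilityTheory.beta a b with hB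
  have hB0 : 0 < B := ProbabilityTheory.beta_pos ha hb
  rw [← lintegral_indicator measurableSet_Ioo]
  set g : ℝ → ENNReal := (Set.Ioo 0 s).indicator
    fun u => ENNReal.ofReal (u ^ (a - 1) * (s - u) ^ (b - 1)) with hg
  have hgm : Measurable g := by
    refine Measurable.indicator ?_ measurableSet_Ioo
    fun_prop
  have h1 : ∀ v, g (s * v) = ENNReal.ofReal (s ^ (a + b - 2) * B) *
      ProbabilityTheory.betaPDF a b v := by
    intro v
    by_cases hv : 0 < v ∧ v < 1
    · have hm : s * v ∈ Set.Ioo 0 s := ⟨mul_pos hs hv.1, by nlinarith [hv.2]⟩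
      rw [hg, Set.indicator_of_mem hm, ProbabilityTheory.betaPDF_of_pos_lt_one hv.1 hv.2,
        ← ENNReal.ofReal_mul (by positivity)]
      congr 1
      rw [show s - s * v = s * (1 - v) by ring, mul_rpow hs.le hv.1.le,
        mul_rpow hs.le (by linarith [hv.2]), show a + b - 2 = (a - 1) + (b - 1) by ring,
        rpow_add hs, ← hB]
      field_simp
    · rw [ProbabilityTheory.betaPDF_eq, if_neg hv, ENNReal.ofReal_zero, mul_zero, hg,
        Set.indicator_of_notMem]
      rintro ⟨h2, h3⟩
      exact hv ⟨pos_of_mul_pos_right h2 hs.le, by by_contra! h; nlinarith⟩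
  have h2 : ∫⁻ v, g (s * v) = ENNReal.ofReal (s ^ (a + b - 2) * B) := by
    simp_rw [h1]
    rw [lintegral_const_mul' _ _ ENNReal.ofReal_ne_top,
      ProbabilityTheory.lintegral_betaPDF_eq_one ha hb, mul_one]
  have h3 : ∫⁻ v, g (s * v) = ENNReal.ofReal s⁻¹ * ∫⁻ u, g u := by
    rw [← lintegral_map (f := g) hgm (measurable_const_mul s), Real.map_volume_mul_left hs.ne',
      lintegral_smul_measure, abs_of_pos (by positivity)]
    rfl
  have h4 : ∫⁻ u, g u = ENNReal.ofReal s * ∫⁻ v, g (s * v) := by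
    rw [h3, ← mul_assoc, ← ENNReal.ofReal_mul hs.le, mul_inv_cancel₀ hs.ne', ENNReal.ofReal_one,
      one_mul]
  rw [h4, h2, ← ENNReal.ofReal_mul hs.le]
  congr 1
  rw [show a + b - 1 = 1 + (a + b - 2) by ring, rpow_add hs, rpow_one, hB]
  unfold ProbabilityTheory.beta
  ring

theorem measurableSet_sum_lt (n : ℕ) (s : ℝ) :
    MeasurableSet {x : Fin n → ℝ | (∀ i, 0 < x i) ∧ ∑ i, x i < s} := by
  have h1 : {x : Fin n → ℝ | (∀ i, 0 < x i) ∧ ∑ i, x i < s} =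
      (⋂ i, {x : Fin n → ℝ | 0 < x i}) ∩ {x | ∑ i, x i < s} := by
    ext x; simp
  have h2 : Measurable fun x : Fin n → ℝ => ∑ i, x i := by fun_prop
  rw [h1]
  exact (MeasurableSet.iInter fun i => measurableSet_lt measurable_const
    (measurable_pi_apply i)).inter (measurableSet_lt h2 measurable_const)

theorem lintegral_dirichlet (n : ℕ) : ∀ {a : Fin n → ℝ} {b s : ℝ}, (∀ i, 0 < a i) → 0 < b →
    0 < s → ∫⁻ x in {x : Fin n → ℝ | (∀ i, 0 < x i) ∧ ∑ i, x i < s},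
      ENNReal.ofReal ((∏ i, x i ^ (a i - 1)) * (s - ∑ i, x i) ^ (b - 1)) =
      ENNReal.ofReal (s ^ ((∑ i, a i) + b - 1) *
        ((∏ i, Gamma (a i)) * Gamma b / Gamma ((∑ i, a i) + b))) := by
  have hmeas := measurableSet_sum_lt
  induction n with
  | zero =>
    intro a b s ha hb hs
    have : (Gamma b) ≠ 0 := (Gamma_pos_of_pos hb).ne'
    simp [hs, this, volume_pi]
  | succ n ih =>
    intro a b s ha hb hs
    set β := (∑ i : Fin n, a i.succ) + b with hβ
    have hβ0 : 0 < β := add_pos_of_nonneg_of_pos (Finset.sum_nonneg fun i _ => (ha _).le) hb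
    set c := (∏ i : Fin n, Gamma (a i.succ)) * Gamma b / Gamma β with hc
    have hc0 : 0 ≤ c := by
      have := Gamma_pos_of_pos hb
      have := Gamma_pos_of_pos hβ0
      have : 0 ≤ ∏ i : Fin n, Gamma (a i.succ) :=
        Finset.prod_nonneg fun i _ => (Gamma_pos_of_pos (ha _)).le
      positivity
    rw [← lintegral_indicator (hmeas _ _)]
    set f : (Fin (n + 1) → ℝ) → ENNReal := Set.indicator
      {x : Fin (n + 1) → ℝ | (∀ i, 0 < x i) ∧ ∑ i, x i < s} fun x =>
        ENNReal.ofReal ((∏ i, x i ^ (a i - 1)) * (s - ∑ i, x i) ^ (b - 1)) with hf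
    have hfm : Measurable f := Measurable.indicator (by fun_prop) (hmeas _ _)
    have hp := (volume_preserving_piFinSuccAbove (fun _ : Fin (n + 1) => ℝ) 0).symm
    rw [← hp.lintegral_comp hfm, Measure.volume_eq_prod, lintegral_prod
      (fun z => f ((MeasurableEquiv.piFinSuccAbove (fun _ : Fin (n + 1) => ℝ) 0).symm z))
      (hfm.comp (MeasurableEquiv.measurable _)).aemeasurable]
    have hkey : ∀ u : ℝ, ∫⁻ v : Fin n → ℝ,
        f ((MeasurableEquiv.piFinSuccAbove (fun _ => ℝ) 0).symm (u, v)) =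
        (Set.Ioo 0 s).indicator (fun u => ENNReal.ofReal c *
          ENNReal.ofReal (u ^ (a 0 - 1) * (s - u) ^ (β - 1))) u := by
      intro u
      have hcons : ∀ v : Fin n → ℝ, (MeasurableEquiv.piFinSuccAbove (fun _ => ℝ) 0).symm (u, v)
          = (Fin.cons u v : Fin (n + 1) → ℝ) := fun v => by
        ext i
        simp [MeasurableEquiv.piFinSuccAbove, Fin.insertNthEquiv]
      simp_rw [hcons]
      by_cases hu : u ∈ Set.Ioo 0 s
      · rw [Set.indicator_of_mem hu]
        have h1 : ∀ v : Fin n → ℝ, f (Fin.cons u v) = ENNReal.ofReal (u ^ (a 0 - 1)) *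
            Set.indicator {x : Fin n → ℝ | (∀ i, 0 < x i) ∧ ∑ i, x i < s - u} (fun x =>
              ENNReal.ofReal ((∏ i, x i ^ (a i.succ - 1)) * (s - u - ∑ i, x i) ^ (b - 1))) v := by
          intro v
          have hiff : (Fin.cons u v : Fin (n + 1) → ℝ) ∈
              {x : Fin (n + 1) → ℝ | (∀ i, 0 < x i) ∧ ∑ i, x i < s} ↔
              v ∈ {x : Fin n → ℝ | (∀ i, 0 < x i) ∧ ∑ i, x i < s - u} := by
            simp only [Set.mem_ofPred_eq, Fin.forall_fin_succ, Fin.cons_zero, Fin.cons_succ,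
              Fin.sum_univ_succ, hu.1, true_and]
            rw [lt_sub_iff_add_lt']
          by_cases hv : v ∈ {x : Fin n → ℝ | (∀ i, 0 < x i) ∧ ∑ i, x i < s - u}
          · rw [hf, Set.indicator_of_mem hv, Set.indicator_of_mem (hiff.2 hv),
              ← ENNReal.ofReal_mul (rpow_nonneg hu.1.le _)]
            simp only [Fin.prod_univ_succ, Fin.sum_univ_succ, Fin.cons_zero, Fin.cons_succ]
            rw [← sub_sub, mul_assoc]
          · rw [hf, Set.indicator_of_notMem hv, Set.indicator_of_notMem (fun h => hv (hiff.1 h)),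
              mul_zero]
        simp_rw [h1]
        rw [lintegral_const_mul' _ _ ENNReal.ofReal_ne_top, lintegral_indicator (hmeas _ _),
          ih (fun i => ha i.succ) hb (sub_pos.2 hu.2), ← ENNReal.ofReal_mul (rpow_nonneg hu.1.le _),
          ← ENNReal.ofReal_mul hc0]
        congr 1
        rw [hc, hβ]
        ring
      · rw [Set.indicator_of_notMem hu]
        refine (lintegral_congr fun v => ?_).trans lintegral_zero
        rw [hf, Set.indicator_of_notMem]
        rintro ⟨h1, h2⟩
        have h3 := h1 0
        rw [Fin.sum_univ_succ] at h2
        simp only [Fin.cons_zero, Fin.cons_succ] at h2 h3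
        refine hu ⟨h3, ?_⟩
        have h4 : 0 ≤ ∑ i, v i := Finset.sum_nonneg fun i _ => by
          have := h1 i.succ
          rw [Fin.cons_succ] at this
          exact this.le
        linarith
    rw [lintegral_congr hkey, lintegral_indicator measurableSet_Ioo,
      lintegral_const_mul' _ _ ENNReal.ofReal_ne_top, lintegral_beta_scaled (ha 0) hβ0 hs,
      ← ENNReal.ofReal_mul hc0]
    congr 1
    rw [Fin.sum_univ_succ, Fin.prod_univ_succ, add_assoc (a 0), ← hβ, hc]
    have := (Gamma_pos_of_pos hβ0).ne'
    field_simp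

section Measure
variable {n : ℕ} {κ : Fin (n + 1) → ℝ}

def bary (x : Fin n → ℝ) : Fin (n + 1) → ℝ := Fin.snoc x (1 - ∑ i, x i)

def baryX (n : ℕ) : Fin (n + 1) → MvPolynomial (Fin n) ℝ := Fin.snoc X (1 - ∑ i, X i)

def shift (κ : Fin (n + 1) → ℝ) (i : Fin (n + 1)) : ℝ := κ i + 1 / 2

theorem eval_baryX (x : Fin n → ℝ) (i : Fin (n + 1)) : eval x (baryX n i) = bary x i := by
  refine Fin.lastCases ?_ (fun i => ?_) i <;> simp [bary, baryX]

theorem sum_baryX : ∑ i, baryX n i = 1 := by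
  simp [Fin.sum_univ_castSucc, baryX]

theorem bary_mem_stdSimplex {x : Fin n → ℝ} (hx : ∀ i, 0 ≤ x i) (hx1 : ∑ i, x i ≤ 1) :
    bary x ∈ stdSimplex ℝ (Fin (n + 1)) := by
  refine ⟨fun i => ?_, by simp [Fin.sum_univ_castSucc, bary]⟩
  refine Fin.lastCases ?_ (fun i => ?_) i <;> simp [bary, hx, hx1]

theorem bary_mem_of_mem_simplexSet {x : Fin n → ℝ} (hx : x ∈ simplexSet n) :
    bary x ∈ stdSimplex ℝ (Fin (n + 1)) :=
  bary_mem_stdSimplex (fun i => (hx.1 i).le) hx.2.le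

theorem simplexDist_eq {x y : Fin n → ℝ} (hx : ∑ i, x i ≤ 1) :
    simplexDist n x y = arccos (aff (bary x) (bary y)) := by
  unfold simplexDist aff
  simp [Fin.sum_univ_castSucc, bary, Real.sqrt_mul (sub_nonneg.2 hx)]

theorem measurableSet_simplexSet (n : ℕ) : MeasurableSet (simplexSet n) := measurableSet_sum_lt n 1

theorem ae_mem_simplexSet : ∀ᵐ x ∂simplexMeasure n κ, x ∈ simplexSet n :=
  (withDensity_absolutelyContinuous _ _).ae_le (ae_restrict_mem (measurableSet_simplexSet n))

theorem measurable_simplexW (κ : Fin (n + 1) → ℝ) : Measurable (simplexW n κ) := by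
  unfold simplexW; fun_prop

theorem simplexW_nonneg {x : Fin n → ℝ} (hx : x ∈ simplexSet n) : 0 ≤ simplexW n κ x :=
  mul_nonneg (Finset.prod_nonneg fun i _ => rpow_nonneg (hx.1 i).le _)
    (rpow_nonneg (by linarith [hx.2]) _)

theorem lintegral_simplexW (hκ : ∀ i, 0 < shift κ i) :
    ∫⁻ x in simplexSet n, ENNReal.ofReal (simplexW n κ x) =
      ENNReal.ofReal ((∏ i, Gamma (shift κ i)) / Gamma (∑ i, shift κ i)) := by
  have h := lintegral_dirichlet n (a := fun i => shift κ i.castSucc) (b := shift κ (Fin.last n))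
    (fun i => hκ _) (hκ _) one_pos
  rw [one_rpow, one_mul, ← Fin.sum_univ_castSucc,
    ← Fin.prod_univ_castSucc (fun i => Gamma (shift κ i))] at h
  rw [← h]
  refine setLIntegral_congr_fun (measurableSet_simplexSet n) fun x _ => ?_
  have h2 : ∀ i, shift κ i - 1 = κ i - 1 / 2 := fun i => by unfold shift; ring
  simp only [simplexW, h2]

theorem simplexW_mul_prod {x : Fin n → ℝ} (hx : x ∈ simplexSet n) (l : Fin (n + 1) → ℕ) :
    simplexW n κ x * ∏ i, bary x i ^ l i = simplexW n (fun i => κ i + l i) x := by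
  unfold simplexW
  have h1 : 0 < 1 - ∑ i, x i := by linarith [hx.2]
  have h2 : ∀ u : ℝ, 0 < u → ∀ (a : ℝ) (l : ℕ), u ^ (a - 1 / 2) * u ^ l = u ^ (a + l - 1 / 2) :=
    fun u hu a l => by rw [← rpow_natCast, ← rpow_add hu]; congr 1; ring
  rw [Fin.prod_univ_castSucc, mul_mul_mul_comm, ← Finset.prod_mul_distrib]
  simp only [bary, Fin.snoc_castSucc, Fin.snoc_last]
  rw [h2 _ h1]
  refine congrArg (· * _) (Finset.prod_congr rfl fun i _ => h2 _ (hx.1 i) _ _)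

theorem isFiniteMeasure_simplexMeasure (hκ : ∀ i, 0 < shift κ i) :
    IsFiniteMeasure (simplexMeasure n κ) := by
  refine isFiniteMeasure_withDensity ?_
  rw [lintegral_simplexW hκ]
  exact ENNReal.ofReal_ne_top

theorem integrable_of_continuous (hκ : ∀ i, 0 < shift κ i) {f : (Fin n → ℝ) → ℝ}
    (hf : Continuous f) : Integrable f (simplexMeasure n κ) := by
  have := isFiniteMeasure_simplexMeasure hκ
  obtain ⟨C, hC⟩ := (isCompact_Icc (a := (0 : Fin n → ℝ)) (b := 1)).exists_bound_of_continuousOn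
    hf.continuousOn
  refine Integrable.of_bound hf.measurable.aestronglyMeasurable C ?_
  filter_upwards [ae_mem_simplexSet] with x hx
  refine hC x ⟨fun i => (hx.1 i).le, fun i => ?_⟩
  exact (Finset.single_le_sum (fun j _ => (hx.1 j).le) (Finset.mem_univ i)).trans hx.2.le

theorem continuous_bary (i : Fin (n + 1)) : Continuous fun x : Fin n → ℝ => bary x i := by
  simp_rw [← eval_baryX]
  exact MvPolynomial.continuous_eval _

theorem integral_moment (hκ : ∀ i, 0 < shift κ i) (l : Fin (n + 1) → ℕ) :
    ∫ x, ∏ i, bary x i ^ l i ∂simplexMeasure n κ =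
      (∏ i, Gamma (shift κ i + l i)) / Gamma ((∑ i, shift κ i) + (∑ i, l i : ℕ)) := by
  have hc : Continuous fun x : Fin n → ℝ => ∏ i, bary x i ^ l i :=
    continuous_finsetProd _ fun i _ => (continuous_bary i).pow _
  rw [integral_eq_lintegral_of_nonneg_ae ?_ hc.measurable.aestronglyMeasurable]
  · have hs : ∀ i, shift (fun i => κ i + (l i : ℝ)) i = shift κ i + l i := fun i => by
      unfold shift; ring
    have h1 : ∫⁻ x, ENNReal.ofReal (∏ i, bary x i ^ l i) ∂simplexMeasure n κ =
        ∫⁻ x in simplexSet n, ENNReal.ofReal (simplexW n (fun i => κ i + l i) x) := by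
      unfold simplexMeasure
      rw [lintegral_withDensity_eq_lintegral_mul _ (measurable_simplexW κ).ennreal_ofReal
        hc.measurable.ennreal_ofReal]
      refine setLIntegral_congr_fun (measurableSet_simplexSet n) fun x hx => ?_
      simp only [Pi.mul_apply]
      rw [← ENNReal.ofReal_mul (simplexW_nonneg hx), simplexW_mul_prod hx]
    have h3 : ∀ i, 0 < shift κ i + l i := fun i => by have := hκ i; positivity
    rw [h1, lintegral_simplexW fun i => by rw [hs]; exact h3 i]
    simp_rw [hs]
    rw [Finset.sum_add_distrib, ENNReal.toReal_ofReal, Nat.cast_sum]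
    refine div_nonneg (Finset.prod_nonneg fun i _ => (Gamma_pos_of_pos (h3 i)).le)
      (Gamma_pos_of_pos ?_).le
    rw [← Finset.sum_add_distrib]
    exact Finset.sum_pos (fun i _ => h3 i) Finset.univ_nonempty
  · filter_upwards [ae_mem_simplexSet] with x hx
    exact Finset.prod_nonneg fun i _ => pow_nonneg ((bary_mem_of_mem_simplexSet hx).1 i) _

end Measure

section Spectral
variable {n : ℕ} {κ : Fin (n + 1) → ℝ}

theorem integrable_eval (hκ : ∀ i, 0 < shift κ i) (f : MvPolynomial (Fin n) ℝ) :
    Integrable (fun x => eval x f) (simplexMeasure n κ) :=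
  integrable_of_continuous hκ (MvPolynomial.continuous_eval f)

def polyInt (hκ : ∀ i, 0 < shift κ i) : MvPolynomial (Fin n) ℝ →ₗ[ℝ] ℝ where
  toFun f := ∫ x, eval x f ∂simplexMeasure n κ
  map_add' f g := by
    simp_rw [map_add]
    exact integral_add (integrable_eval hκ f) (integrable_eval hκ g)
  map_smul' c f := by
    simp_rw [smul_eval, RingHom.id_apply, smul_eq_mul]
    exact integral_const_mul _ _

theorem polyInt_apply (hκ : ∀ i, 0 < shift κ i) (f : MvPolynomial (Fin n) ℝ) :
    polyInt hκ f = ∫ x, eval x f ∂simplexMeasure n κ := rfl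

def baryMon (l : Fin (n + 1) → ℕ) : MvPolynomial (Fin n) ℝ := ∏ i, baryX n i ^ l i

theorem eval_baryMon (x : Fin n → ℝ) (l : Fin (n + 1) → ℕ) :
    eval x (baryMon l) = ∏ i, bary x i ^ l i := by
  simp [baryMon, eval_baryX]

theorem baryMon_add (l b : Fin (n + 1) → ℕ) :
    (baryMon l : MvPolynomial (Fin n) ℝ) * baryMon b = baryMon (l + b) := by
  simp [baryMon, ← Finset.prod_mul_distrib, pow_add]

theorem totalDegree_baryMon_le (l : Fin (n + 1) → ℕ) :
    (baryMon l : MvPolynomial (Fin n) ℝ).totalDegree ≤ ∑ i, l i := by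
  refine (totalDegree_finsetProd _ _).trans (Finset.sum_le_sum fun i _ => ?_)
  refine (totalDegree_pow _ _).trans ?_
  have h : (baryX n i).totalDegree ≤ 1 := by
    refine Fin.lastCases ?_ (fun i => ?_) i
    · simp only [baryX, Fin.snoc_last]
      refine (totalDegree_sub _ _).trans (max_le (by simp) ?_)
      exact totalDegree_finsetSum_le fun i _ => (totalDegree_X i).le
    · simp [baryX]
  exact (Nat.mul_le_mul_left _ h).trans_eq (mul_one _)

theorem polyInt_baryMon (hκ : ∀ i, 0 < shift κ i) (l : Fin (n + 1) → ℕ) :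
    polyInt hκ (baryMon l) =
      (∏ i, Gamma (shift κ i + l i)) / Gamma ((∑ i, shift κ i) + (∑ i, l i : ℕ)) := by
  rw [polyInt_apply, ← integral_moment hκ]
  simp_rw [eval_baryMon]

/-- The weight of `baryMon l` in the kernel `bernKer`. -/
def bernWt (κ : Fin (n + 1) → ℝ) (m : ℕ) (l : Fin (n + 1) → ℕ) : ℝ :=
  Gamma ((∑ i, shift κ i) + m) * m.factorial *
    ∏ i, 1 / (((l i).factorial : ℝ) * Gamma (shift κ i + l i))

/-- The Bernstein-Durrmeyer operator. -/
def bernOp (hκ : ∀ i, 0 < shift κ i) (m : ℕ) :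
    MvPolynomial (Fin n) ℝ →ₗ[ℝ] MvPolynomial (Fin n) ℝ :=
  ∑ l ∈ Finset.piAntidiag Finset.univ m,
    bernWt κ m l • ((polyInt hκ).comp (LinearMap.mulLeft ℝ (baryMon l))).smulRight (baryMon l)

theorem bernOp_apply (hκ : ∀ i, 0 < shift κ i) (m : ℕ) (f : MvPolynomial (Fin n) ℝ) :
    bernOp hκ m f = ∑ l ∈ Finset.piAntidiag Finset.univ m,
      (bernWt κ m l * polyInt hκ (baryMon l * f)) • baryMon l := by
  simp [bernOp, LinearMap.sum_apply, smul_smul]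

theorem polyInt_bernOp_mul (hκ : ∀ i, 0 < shift κ i) (m : ℕ) (f g : MvPolynomial (Fin n) ℝ) :
    polyInt hκ (bernOp hκ m f * g) = polyInt hκ (f * bernOp hκ m g) := by
  rw [bernOp_apply, bernOp_apply, Finset.sum_mul, Finset.mul_sum, map_sum, map_sum]
  refine Finset.sum_congr rfl fun l _ => ?_
  rw [smul_mul_assoc, mul_smul_comm, map_smul, map_smul, mul_comm f, smul_eq_mul, smul_eq_mul]
  ring

theorem sum_shift_pos (hκ : ∀ i, 0 < shift κ i) : 0 < ∑ i, shift κ i :=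
  Finset.sum_pos (fun i _ => hκ i) Finset.univ_nonempty

theorem bernOp_baryMon (hκ : ∀ i, 0 < shift κ i) (b : Fin (n + 1) → ℕ) :
    ∃ c : Fin (n + 1) → ℕ → ℝ, (∀ i, c i (b i) = 1) ∧ ∀ m, bernOp hκ m (baryMon b) =
      (Gamma ((∑ i, shift κ i) + m) / Gamma ((∑ i, shift κ i) + m + (∑ i, b i : ℕ))) •
      ∑ p ∈ Fintype.piFinset fun i => Finset.range (b i + 1),
        ((∏ i, c i (p i)) * (m.descFactorial (∑ i, p i) : ℝ)) • baryMon p := by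
  choose c hc1 hc using fun i => Gamma_ratio_expansion (hκ i) (b i)
  refine ⟨c, hc1, fun m => ?_⟩
  have h2 := fun p => sum_descFactorial_smul (baryX n) m p
  rw [sum_baryX] at h2
  simp_rw [one_pow, mul_one] at h2
  have hθ := sum_shift_pos hκ
  rw [bernOp_apply, Finset.smul_sum]
  set G := Gamma ((∑ i, shift κ i) + m) with hG
  set H := Gamma ((∑ i, shift κ i) + m + (∑ i, b i : ℕ)) with hH
  have h3 : ∀ l ∈ Finset.piAntidiag (Finset.univ : Finset (Fin (n + 1))) m,
      bernWt κ m l * polyInt hκ (baryMon l * baryMon b) =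
      ∑ p ∈ Fintype.piFinset fun i => Finset.range (b i + 1), (G / H) * (∏ i, c i (p i)) *
        ((m.factorial : ℝ) * ∏ i, ((l i).descFactorial (p i) : ℝ) * ((l i).factorial : ℝ)⁻¹) := by
    intro l hl
    rw [baryMon_add, polyInt_baryMon]
    have e1 : ((∑ i, (l + b) i : ℕ) : ℝ) = m + (∑ i, b i : ℕ) := by
      simp only [Pi.add_apply]
      rw [Finset.sum_add_distrib, sum_eq_of_mem_piAntidiag hl]; push_cast; rfl
    rw [e1, ← add_assoc, ← hH]
    unfold bernWt
    rw [← hG]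
    have e2 : (∏ i, 1 / (((l i).factorial : ℝ) * Gamma (shift κ i + l i))) *
        (∏ i, Gamma (shift κ i + (l + b) i)) =
        ∑ p ∈ Fintype.piFinset fun i => Finset.range (b i + 1),
          ∏ i, c i (p i) * (((l i).descFactorial (p i) : ℝ) * ((l i).factorial : ℝ)⁻¹) := by
      rw [← Finset.prod_univ_sum (fun i => Finset.range (b i + 1)) fun i j =>
        c i j * (((l i).descFactorial j : ℝ) * ((l i).factorial : ℝ)⁻¹),
        ← Finset.prod_mul_distrib]
      refine Finset.prod_congr rfl fun i _ => ?_
      simp_rw [← mul_assoc]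
      rw [← Finset.sum_mul, ← hc]
      simp only [Pi.add_apply, Nat.cast_add]
      rw [← add_assoc]
      ring
    calc _ = G / H * m.factorial * ((∏ i, 1 / (((l i).factorial : ℝ) * Gamma (shift κ i + l i))) *
        (∏ i, Gamma (shift κ i + (l + b) i))) := by ring
      _ = _ := by
        rw [e2, Finset.mul_sum]
        refine Finset.sum_congr rfl fun p _ => ?_
        rw [Finset.prod_mul_distrib]
        ring
  rw [Finset.sum_congr rfl fun l hl => by rw [h3 l hl]]
  simp_rw [Finset.sum_smul]
  rw [Finset.sum_comm]
  refine Finset.sum_congr rfl fun p _ => ?_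
  simp_rw [mul_smul _ _ (baryMon _), ← Finset.smul_sum]
  rw [show (baryMon p : MvPolynomial (Fin n) ℝ) = ∏ i, baryX n i ^ p i from rfl, ← h2]
  simp only [baryMon, mul_smul, Finset.smul_sum]

end Spectral

section Expansion
variable {n : ℕ} {κ : Fin (n + 1) → ℝ} {N : ℕ → ℕ}
  {P : (k : ℕ) → Fin (N k) → MvPolynomial (Fin n) ℝ}

def lowSpan (P : (k : ℕ) → Fin (N k) → MvPolynomial (Fin n) ℝ) (k : ℕ) :
    Submodule ℝ (MvPolynomial (Fin n) ℝ) :=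
  Submodule.span ℝ {R | ∃ k' < k, ∃ j, R = P k' j}

theorem lowSpan_mono {k k' : ℕ} (h : k ≤ k') : lowSpan P k ≤ lowSpan P k' :=
  Submodule.span_mono fun _ ⟨a, ha, hj⟩ => ⟨a, ha.trans_le h, hj⟩

theorem mem_lowSpan {k k' : ℕ} (h : k' < k) (j : Fin (N k')) : P k' j ∈ lowSpan P k :=
  Submodule.subset_span ⟨k', h, j, rfl⟩

theorem mem_lowSpan_of_totalDegree
    (hspan : ∀ m : ℕ, ∀ Q : MvPolynomial (Fin n) ℝ, Q.totalDegree ≤ m →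
      Q ∈ Submodule.span ℝ {R | ∃ k ≤ m, ∃ j, R = P k j}) {k : ℕ}
    {Q : MvPolynomial (Fin n) ℝ} (h : Q.totalDegree < k) : Q ∈ lowSpan P k := by
  refine Submodule.span_mono ?_ (hspan _ Q le_rfl)
  rintro _ ⟨a, ha, hj⟩
  exact ⟨a, ha.trans_lt h, hj⟩

theorem bernOp_baryMon_sub_mem
    (hspan : ∀ m : ℕ, ∀ Q : MvPolynomial (Fin n) ℝ, Q.totalDegree ≤ m →
      Q ∈ Submodule.span ℝ {R | ∃ k ≤ m, ∃ j, R = P k j})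
    (hκ : ∀ i, 0 < shift κ i) (m : ℕ) (b : Fin (n + 1) → ℕ) :
    bernOp hκ m (baryMon b) - gam (∑ i, shift κ i) m (∑ i, b i) • baryMon b ∈
      lowSpan P (∑ i, b i) := by
  obtain ⟨c, hc, h⟩ := bernOp_baryMon hκ b
  have hb : b ∈ Fintype.piFinset fun i => Finset.range (b i + 1) := by simp
  rw [h, ← Finset.add_sum_erase _ _ hb, smul_add]
  simp only [hc, Finset.prod_const_one, one_mul, smul_smul]
  rw [gam, mul_comm (m.descFactorial _ : ℝ), add_sub_cancel_left]
  refine Submodule.smul_mem _ _ (Submodule.sum_mem _ fun p hp => Submodule.smul_mem _ _ ?_)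
  refine mem_lowSpan_of_totalDegree hspan ((totalDegree_baryMon_le p).trans_lt ?_)
  rw [Finset.mem_erase, Fintype.mem_piFinset] at hp
  have hle : ∀ i, p i ≤ b i := fun i => Nat.lt_succ_iff.1 (Finset.mem_range.1 (hp.2 i))
  obtain ⟨i, hi⟩ := Function.ne_iff.1 hp.1
  exact Finset.sum_lt_sum (fun i _ => hle i) ⟨i, Finset.mem_univ i, (hle i).lt_of_ne hi⟩

theorem monomial_eq_baryMon (d : Fin n →₀ ℕ) :
    ∃ b : Fin (n + 1) → ℕ, (∑ i, b i = d.degree) ∧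
      (monomial d 1 : MvPolynomial (Fin n) ℝ) = baryMon b := by
  refine ⟨Fin.snoc d 0, ?_, ?_⟩
  · simp [Fin.sum_univ_castSucc, Finsupp.degree_eq_sum]
  · simp [baryMon, Fin.prod_univ_castSucc, baryX, monomial_eq, Finsupp.prod_fintype]

theorem bernOp_sub_mem
    (hspan : ∀ m : ℕ, ∀ Q : MvPolynomial (Fin n) ℝ, Q.totalDegree ≤ m →
      Q ∈ Submodule.span ℝ {R | ∃ k ≤ m, ∃ j, R = P k j})
    (hκ : ∀ i, 0 < shift κ i) (m : ℕ) {k : ℕ} {f : MvPolynomial (Fin n) ℝ}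
    (hf : f.totalDegree ≤ k) :
    bernOp hκ m f - gam (∑ i, shift κ i) m k • f ∈ lowSpan P k := by
  have h1 : ∀ d ∈ f.support, bernOp hκ m (monomial d (coeff d f)) -
      gam (∑ i, shift κ i) m k • monomial d (coeff d f) ∈ lowSpan P k := by
    intro d hd
    obtain ⟨b, hb, hbd⟩ := monomial_eq_baryMon (n := n) d
    have hdk : ∑ i, b i ≤ k := by
      rw [hb]
      refine le_trans ?_ hf
      rw [Finsupp.degree_eq_sum]
      have := le_totalDegree hd
      rwa [Finsupp.sum_fintype _ _ (fun _ => rfl)] at this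
    have h2 : monomial d (coeff d f) = coeff d f • (monomial d 1 : MvPolynomial (Fin n) ℝ) := by
      rw [smul_monomial, smul_eq_mul, mul_one]
    rw [h2, map_smul, smul_comm, ← smul_sub, hbd]
    refine Submodule.smul_mem _ _ ?_
    have h3 := bernOp_baryMon_sub_mem hspan hκ m b
    rcases hdk.eq_or_lt with h | h
    · rwa [h] at h3
    · have h4 : (baryMon b : MvPolynomial (Fin n) ℝ) ∈ lowSpan P k :=
        mem_lowSpan_of_totalDegree hspan ((totalDegree_baryMon_le b).trans_lt h)
      have h5 := (lowSpan P k).add_mem (lowSpan_mono h.le h3)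
        ((lowSpan P k).smul_mem (gam (∑ i, shift κ i) m (∑ i, b i)) h4)
      rw [sub_add_cancel] at h5
      exact (lowSpan P k).sub_mem h5 ((lowSpan P k).smul_mem _ h4)
  have h2 := Submodule.sum_mem _ h1
  rw [Finset.sum_sub_distrib, ← map_sum, ← Finset.smul_sum] at h2
  rwa [← f.as_sum] at h2

theorem bernOp_one
    (hspan : ∀ m : ℕ, ∀ Q : MvPolynomial (Fin n) ℝ, Q.totalDegree ≤ m →
      Q ∈ Submodule.span ℝ {R | ∃ k ≤ m, ∃ j, R = P k j})
    (hκ : ∀ i, 0 < shift κ i) (m : ℕ) : bernOp hκ m 1 = 1 := by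
  have h := bernOp_sub_mem hspan hκ m (k := 0) (f := 1) (by simp)
  have h0 : lowSpan P 0 = ⊥ := by
    rw [lowSpan, Submodule.span_eq_bot]
    rintro x ⟨k', hk', -⟩
    omega
  rw [h0, Submodule.mem_bot, gam_zero (sum_shift_pos hκ), one_smul, sub_eq_zero] at h
  exact h

theorem eq_sum_of_mem_lowSpan (hκ : ∀ i, 0 < shift κ i)
    (horth : ∀ (k : ℕ) (j : Fin (N k)) (k' : ℕ) (j' : Fin (N k')),
      polyInt hκ (P k j * P k' j') = if (⟨k, j⟩ : Σ k, Fin (N k)) = ⟨k', j'⟩ then 1 else 0)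
    {k : ℕ} {g : MvPolynomial (Fin n) ℝ} (hg : g ∈ lowSpan P k) :
    g = ∑ k' ∈ Finset.range k, ∑ j, polyInt hκ (g * P k' j) • P k' j := by
  induction hg using Submodule.span_induction with
  | mem x hx =>
    obtain ⟨k', hk', j, rfl⟩ := hx
    rw [Finset.sum_eq_single k', Finset.sum_eq_single j]
    · rw [horth, if_pos rfl, one_smul]
    · intro j' _ hj
      rw [horth, if_neg, zero_smul]
      intro h
      simp only [Sigma.mk.injEq, heq_eq_eq, true_and] at h
      exact hj h.symm
    · simp
    · intro k'' _ hk
      refine Finset.sum_eq_zero fun j' _ => ?_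
      rw [horth, if_neg, zero_smul]
      intro h
      simp only [Sigma.mk.injEq] at h
      exact hk h.1.symm
    · intro h
      exact absurd (Finset.mem_range.2 hk') h
  | zero => simp
  | add x y _ _ hx hy =>
    simp_rw [add_mul, map_add, add_smul, Finset.sum_add_distrib]
    rw [← hx, ← hy]
  | smul c x _ hx =>
    simp_rw [smul_mul_assoc, map_smul, smul_assoc, ← Finset.smul_sum]
    rw [← hx]

theorem polyInt_mul_eq_zero (hκ : ∀ i, 0 < shift κ i)
    (horth : ∀ (k : ℕ) (j : Fin (N k)) (k' : ℕ) (j' : Fin (N k')),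
      polyInt hκ (P k j * P k' j') = if (⟨k, j⟩ : Σ k, Fin (N k)) = ⟨k', j'⟩ then 1 else 0)
    {k : ℕ} (j : Fin (N k)) {g : MvPolynomial (Fin n) ℝ} (hg : g ∈ lowSpan P k) :
    polyInt hκ (P k j * g) = 0 := by
  rw [eq_sum_of_mem_lowSpan hκ horth hg]
  simp_rw [Finset.mul_sum, map_sum, mul_smul_comm, map_smul]
  refine Finset.sum_eq_zero fun k' hk' => Finset.sum_eq_zero fun j' _ => ?_
  rw [horth, if_neg, smul_zero]
  intro h
  simp only [Sigma.mk.injEq] at h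
  rw [Finset.mem_range] at hk'
  omega

theorem bernOp_eigen
    (hdeg : ∀ k j, (P k j).totalDegree ≤ k)
    (hspan : ∀ m : ℕ, ∀ Q : MvPolynomial (Fin n) ℝ, Q.totalDegree ≤ m →
      Q ∈ Submodule.span ℝ {R | ∃ k ≤ m, ∃ j, R = P k j})
    (hκ : ∀ i, 0 < shift κ i)
    (horth : ∀ (k : ℕ) (j : Fin (N k)) (k' : ℕ) (j' : Fin (N k')),
      polyInt hκ (P k j * P k' j') = if (⟨k, j⟩ : Σ k, Fin (N k)) = ⟨k', j'⟩ then 1 else 0)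
    (m : ℕ) {k : ℕ} (j : Fin (N k)) :
    bernOp hκ m (P k j) = gam (∑ i, shift κ i) m k • P k j := by
  have h := bernOp_sub_mem hspan hκ m (hdeg k j)
  rw [← sub_eq_zero, eq_sum_of_mem_lowSpan hκ horth h]
  refine Finset.sum_eq_zero fun k' hk' => Finset.sum_eq_zero fun j' _ => ?_
  rw [Finset.mem_range] at hk'
  have h1 : bernOp hκ m (P k' j') ∈ lowSpan P k := by
    have h2 := lowSpan_mono hk'.le (bernOp_sub_mem hspan hκ m (hdeg k' j'))
    have h3 := (lowSpan P k).add_mem h2 ((lowSpan P k).smul_mem (gam (∑ i, shift κ i) m k')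
      (mem_lowSpan hk' j'))
    rwa [sub_add_cancel] at h3
  rw [sub_mul, map_sub, polyInt_bernOp_mul, polyInt_mul_eq_zero hκ horth j h1, smul_mul_assoc,
    map_smul, polyInt_mul_eq_zero hκ horth j (mem_lowSpan hk' j')]
  simp

/-- The reproducing kernel of the span of `P k j`. -/
def projKer (P : (k : ℕ) → Fin (N k) → MvPolynomial (Fin n) ℝ) (k : ℕ) (x y : Fin n → ℝ) : ℝ :=
  ∑ j, eval x (P k j) * eval y (P k j)

def bernPoly (κ : Fin (n + 1) → ℝ) (m : ℕ) (x : Fin n → ℝ) : MvPolynomial (Fin n) ℝ :=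
  ∑ l ∈ Finset.piAntidiag Finset.univ m, (bernWt κ m l * eval x (baryMon l)) • baryMon l

theorem eval_bernPoly (m : ℕ) (x y : Fin n → ℝ) :
    eval y (bernPoly κ m x) = bernKer (shift κ) m fun i => bary x i * bary y i := by
  unfold bernPoly bernKer bernWt
  simp_rw [map_sum, smul_eval, eval_baryMon, Finset.mul_sum]
  refine Finset.sum_congr rfl fun l _ => ?_
  rw [mul_assoc, ← Finset.prod_mul_distrib, mul_assoc, ← Finset.prod_mul_distrib]
  refine congrArg _ (Finset.prod_congr rfl fun i _ => ?_)
  rw [mul_pow]; ring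

theorem polyInt_bernPoly_mul (hκ : ∀ i, 0 < shift κ i) (m : ℕ) (x : Fin n → ℝ)
    (f : MvPolynomial (Fin n) ℝ) :
    polyInt hκ (bernPoly κ m x * f) = eval x (bernOp hκ m f) := by
  rw [bernOp_apply, bernPoly, Finset.sum_mul, map_sum, map_sum]
  refine Finset.sum_congr rfl fun l _ => ?_
  rw [smul_mul_assoc, map_smul, smul_eval, smul_eq_mul]
  ring

theorem bernKer_expansion
    (hdeg : ∀ k j, (P k j).totalDegree ≤ k)
    (hspan : ∀ m : ℕ, ∀ Q : MvPolynomial (Fin n) ℝ, Q.totalDegree ≤ m →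
      Q ∈ Submodule.span ℝ {R | ∃ k ≤ m, ∃ j, R = P k j})
    (hκ : ∀ i, 0 < shift κ i)
    (horth : ∀ (k : ℕ) (j : Fin (N k)) (k' : ℕ) (j' : Fin (N k')),
      polyInt hκ (P k j * P k' j') = if (⟨k, j⟩ : Σ k, Fin (N k)) = ⟨k', j'⟩ then 1 else 0)
    (m : ℕ) (x y : Fin n → ℝ) :
    bernKer (shift κ) m (fun i => bary x i * bary y i) =
      ∑ k ∈ Finset.range (m + 1), gam (∑ i, shift κ i) m k * projKer P k x y := by
  have h1 : bernPoly κ m x ∈ lowSpan P (m + 1) := by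
    refine Submodule.sum_mem _ fun l hl => Submodule.smul_mem _ _
      (mem_lowSpan_of_totalDegree hspan ((totalDegree_baryMon_le l).trans_lt ?_))
    rw [sum_eq_of_mem_piAntidiag hl]; omega
  rw [← eval_bernPoly, eq_sum_of_mem_lowSpan hκ horth h1, map_sum]
  refine Finset.sum_congr rfl fun k _ => ?_
  rw [map_sum, projKer, Finset.mul_sum]
  refine Finset.sum_congr rfl fun j _ => ?_
  rw [smul_eval, polyInt_bernPoly_mul, bernOp_eigen hdeg hspan hκ horth, smul_eval]
  ring

theorem integral_bernKer
    (hspan : ∀ m : ℕ, ∀ Q : MvPolynomial (Fin n) ℝ, Q.totalDegree ≤ m →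
      Q ∈ Submodule.span ℝ {R | ∃ k ≤ m, ∃ j, R = P k j})
    (hκ : ∀ i, 0 < shift κ i) (m : ℕ) (x : Fin n → ℝ) :
    ∫ y, bernKer (shift κ) m (fun i => bary x i * bary y i) ∂simplexMeasure n κ = 1 := by
  have h := polyInt_bernPoly_mul hκ m x 1
  rw [mul_one, bernOp_one hspan, polyInt_apply] at h
  simpa [eval_bernPoly] using h

end Expansion

section DeathBern
variable {ι : Type*} [Fintype ι] [DecidableEq ι]

theorem deathSol_bernKer_le {α : ι → ℝ} (hα : ∀ i, 0 < α i) (hθ : 0 < ∑ i, α i) :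
    ∃ C > 0, ∃ c > 0, ∀ x ∈ stdSimplex ℝ ι, ∀ y ∈ stdSimplex ℝ ι, ∀ U : ℕ → ℝ → ℝ,
      DeathSol (deathRate (∑ i, α i)) U → (∀ m, U m 0 = bernKer α m fun i => x i * y i) →
      ∀ t, 0 < t → ∀ m : ℕ, 1 / t ≤ (m : ℝ) + 1 →
        U m t ≤ C * exp (-(c * ((1 - aff x y) / t))) * volF α (1 / t) x := by
  obtain ⟨C1, hC1, h1⟩ := bernKer_le hα hθ
  obtain ⟨K, hK⟩ := volF_le_volF_scale α
  obtain ⟨C2, hC2, c, hc, h2⟩ := deathSol_upper hθ K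
  refine ⟨C2 * (C1 * exp (1 / 2)), by positivity, c / 2, by positivity,
    fun x hx y hy U hU hU0 t ht m hm => ?_⟩
  have he := sub_nonneg.2 (aff_le_one hx hy)
  have he1 : 1 - aff x y ≤ 1 := by linarith [aff_nonneg x y]
  set e := 1 - aff x y with he_def
  have hF : 0 < volF α (1 / t) x := volF_pos (by positivity) hx.1
  have h3 := h2 U hU (C1 * exp (1 / 2) * volF α (1 / t) x) (e / 2) t (by positivity)
    (by positivity) (by linarith) ht (fun k => ?_) m hm
  · refine h3.trans_eq ?_
    rw [show -c * (e / 2) / t = -(c / 2 * (e / t)) by ring]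
    ring
  · rw [hU0]
    refine (h1 x hx y hy k).trans ?_
    set a : ℝ := ((k : ℝ) + 1) / (1 + 1 / t) with ha
    have ha0 : 0 < a := by positivity
    have hinv : (1 + 1 / t) / ((k : ℝ) + 1) = a⁻¹ := by rw [ha, inv_div]
    have hr1 : 1 ≤ max a a⁻¹ := by
      rcases le_total 1 a with h | h
      · exact h.trans (le_max_left _ _)
      · exact ((one_le_inv₀ ha0).2 h).trans (le_max_right _ _)
    have h4 := hK (max a a⁻¹) k (1 / t) x hx k.cast_nonneg (by positivity) hr1 ?_ ?_
    · have h5 : (max a a⁻¹) ^ K ≤ a ^ (K + 1) + a⁻¹ ^ (K + 1) := by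
        refine (pow_le_pow_right₀ hr1 K.le_succ).trans ?_
        rcases le_total a a⁻¹ with h | h
        · rw [max_eq_right h]
          exact le_add_of_nonneg_left (by positivity)
        · rw [max_eq_left h]
          exact le_add_of_nonneg_right (by positivity)
      have h6 : exp (-(k * e)) ≤ exp (1 / 2) * exp (-(e / 2) * (k + 1)) := by
        rw [← exp_add]
        refine exp_le_exp.2 ?_
        have : (0 : ℝ) ≤ k * e := by positivity
        nlinarith
      rw [hinv]
      calc C1 * exp (-(k * e)) * volF α k x
          ≤ C1 * (exp (1 / 2) * exp (-(e / 2) * (k + 1))) *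
            ((a ^ (K + 1) + a⁻¹ ^ (K + 1)) * volF α (1 / t) x) := by
            gcongr
            · exact (volF_pos k.cast_nonneg hx.1).le
            · exact h4.trans (by gcongr)
        _ = _ := by ring
    · have : a * (1 + 1 / t) = k + 1 := by rw [ha]; field_simp
      nlinarith [le_max_left a a⁻¹, (by positivity : 0 < 1 + 1 / t)]
    · have : a⁻¹ * (k + 1) = 1 + 1 / t := by rw [ha]; field_simp
      nlinarith [le_max_right a a⁻¹, (by positivity : (0 : ℝ) < k + 1)]

omit [DecidableEq ι] in
theorem volF_zero (α x : ι → ℝ) : volF α 0 x = 1 := by simp [volF]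

omit [DecidableEq ι] in
theorem volF_le_pow (α : ι → ℝ) : ∃ K : ℕ, ∀ x ∈ stdSimplex ℝ ι, ∀ M : ℝ, 0 ≤ M →
    volF α M x ≤ (1 + M) ^ K ∧ 1 ≤ (1 + M) ^ K * volF α M x := by
  obtain ⟨K, hK⟩ := volF_le_volF_scale α
  refine ⟨K, fun x hx M hM => ⟨?_, ?_⟩⟩
  · have := hK (1 + M) M 0 x hx hM le_rfl (by linarith) (by linarith) (by nlinarith)
    rwa [volF_zero, mul_one] at this
  · have := hK (1 + M) 0 M x hx le_rfl hM (by linarith) (by nlinarith) (by linarith)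
    rwa [volF_zero] at this

theorem le_deathSol_bernKer_near {α : ι → ℝ} (hα : ∀ i, 0 < α i) (hθ : 0 < ∑ i, α i) :
    ∃ t₁ > 0, ∃ c > 0, ∃ C > 0, ∀ x ∈ stdSimplex ℝ ι, ∀ y ∈ stdSimplex ℝ ι, ∀ U : ℕ → ℝ → ℝ,
      DeathSol (deathRate (∑ i, α i)) U → (∀ m, U m 0 = bernKer α m fun i => x i * y i) →
      1 - aff x y ≤ 1 / 2 → ∀ t, 0 < t → t ≤ t₁ → ∀ m : ℕ, 1 / t ≤ (m : ℝ) + 1 →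
        c * exp (-(C * ((1 - aff x y) / t))) * volF α (1 / t) x ≤ U m t := by
  obtain ⟨c1, hc1, B1, hB1, h1⟩ := le_bernKer hα hθ
  obtain ⟨K, hK⟩ := volF_le_volF_scale α
  obtain ⟨a, ha, b, hb, t₁, ht₁, -, h2⟩ := deathSol_lower_near hθ
  set r := 1 + 1 / a + b with hr
  have hr0 : 0 < r := by positivity
  refine ⟨t₁, ht₁, c1 / r ^ K / 2, by positivity, B1 * b, by positivity,
    fun x hx y hy U hU hU0 hxy t ht htt m hm => ?_⟩
  have he := sub_nonneg.2 (aff_le_one hx hy)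
  set e := 1 - aff x y with he_def
  have hF : 0 < volF α (1 / t) x := volF_pos (by positivity) hx.1
  have h3 := h2 U hU (c1 / r ^ K * exp (-(B1 * b * (e / t))) * volF α (1 / t) x) t (by positivity)
    ht htt (fun k => ?_) (fun k hk1 hk2 => ?_) m hm
  · refine le_trans (le_of_eq ?_) h3
    ring
  · rw [hU0]
    exact bernKer_nonneg hα _ fun i => mul_nonneg (hx.1 i) (hy.1 i)
  · rw [hU0]
    refine le_trans ?_ (h1 x hx y hy hxy k)
    have h4 : volF α (1 / t) x ≤ r ^ K * volF α k x := by
      refine hK r (1 / t) k x hx (by positivity) k.cast_nonneg ?_ ?_ ?_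
      · rw [hr]; have : 0 < 1 / a := by positivity
        linarith
      · have e1 : 1 / t ≤ 1 / a * k := by
          calc 1 / t = 1 / a * (a / t) := by field_simp
            _ ≤ _ := by gcongr
        have e2 : 0 < 1 / a := by positivity
        have e3 : (0 : ℝ) ≤ k := k.cast_nonneg
        rw [hr]; nlinarith [mul_nonneg hb.le e3]
      · have e1 : b / t = b * (1 / t) := by ring
        have e2 : 0 < 1 / a := by positivity
        have e3 : 0 < 1 / t := by positivity
        rw [hr]; nlinarith [mul_pos e2 e3]
    have h5 : exp (-(B1 * b * (e / t))) ≤ exp (-(B1 * (k * e))) := by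
      refine exp_le_exp.2 (neg_le_neg ?_)
      calc B1 * (k * e) ≤ B1 * (b / t * e) := by gcongr
        _ = _ := by ring
    calc _ ≤ c1 / r ^ K * exp (-(B1 * (k * e))) * (r ^ K * volF α k x) := by gcongr
      _ = _ := by
        have hR : r ^ K ≠ 0 := by positivity
        generalize r ^ K = R at hR ⊢
        rw [← he_def]
        field_simp

theorem le_deathSol_bernKer_far {α : ι → ℝ} (hα : ∀ i, 0 < α i) (hθ : 0 < ∑ i, α i) {t₁ : ℝ}
    (ht₁ : 0 < t₁) :
    ∃ c > 0, ∃ C > 0, ∀ x ∈ stdSimplex ℝ ι, ∀ y ∈ stdSimplex ℝ ι, ∀ U : ℕ → ℝ → ℝ,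
      DeathSol (deathRate (∑ i, α i)) U → (∀ m, U m 0 = bernKer α m fun i => x i * y i) →
      ∀ t, 0 < t → (t₁ ≤ t ∨ 1 / 2 ≤ 1 - aff x y) → ∀ m : ℕ,
        c * exp (-(C * ((1 - aff x y) / t))) * volF α (1 / t) x ≤ U m t := by
  obtain ⟨K, hK⟩ := volF_le_pow α
  obtain ⟨C', hC', h1⟩ := one_add_pow_le_exp K one_pos
  obtain ⟨C, hC, h2⟩ := deathSol_lower_zero hθ
  have hq : ∀ x y : ι → ℝ, bernKer α 0 (fun i => x i * y i) =
      Gamma (∑ i, α i) * ∏ i, (Gamma (α i))⁻¹ := fun x y => by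
    simp [bernKer]
  set q := Gamma (∑ i, α i) * ∏ i, (Gamma (α i))⁻¹ with hq_def
  have hq0 : 0 < q := mul_pos (Gamma_pos_of_pos hθ)
    (Finset.prod_pos fun i _ => inv_pos.2 (Gamma_pos_of_pos (hα i)))
  refine ⟨q / 2 / C' * exp (-((C + 1) / t₁)), by positivity, 2 * (C + 1), by positivity,
    fun x hx y hy U hU hU0 t ht htt m => ?_⟩
  have he := sub_nonneg.2 (aff_le_one hx hy)
  set e := 1 - aff x y with he_def
  refine le_trans ?_ (h2 U hU q t hq0.le ht (fun k => ?_) ?_ m)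
  · have h3 := (hK x hx (1 / t) (by positivity)).1.trans (h1 (1 / t) (by positivity))
    have h4 : exp (-((C + 1) / t₁)) * exp (-(2 * (C + 1) * (e / t))) * exp (1 / t) ≤
        exp (-C / t) := by
      rw [← exp_add, ← exp_add]
      refine exp_le_exp.2 ?_
      have e1 : 0 ≤ (C + 1) / t₁ := by positivity
      have e2 : 0 ≤ 2 * (C + 1) * (e / t) := by positivity
      have e3 : (C + 1) / t ≤ (C + 1) / t₁ + 2 * (C + 1) * (e / t) := by
        rcases htt with h | h
        · have : (C + 1) / t ≤ (C + 1) / t₁ := by gcongr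
          linarith
        · have : (C + 1) / t ≤ 2 * (C + 1) * (e / t) := by
            calc (C + 1) / t = 2 * (C + 1) * (1 / 2 / t) := by ring
              _ ≤ _ := by gcongr
          linarith
      have e4 : (C + 1) / t = C / t + 1 / t := by ring
      rw [neg_div]
      linarith
    calc _ ≤ q / 2 / C' * exp (-((C + 1) / t₁)) * exp (-(2 * (C + 1) * (e / t))) *
        (C' * exp (1 * (1 / t))) := by gcongr
      _ = q / 2 * (exp (-((C + 1) / t₁)) * exp (-(2 * (C + 1) * (e / t))) * exp (1 / t)) := by
        rw [one_mul]; field_simp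
      _ ≤ _ := by gcongr
  · rw [hU0]
    exact bernKer_nonneg hα _ fun i => mul_nonneg (hx.1 i) (hy.1 i)
  · rw [hU0, hq]

theorem le_deathSol_bernKer {α : ι → ℝ} (hα : ∀ i, 0 < α i) (hθ : 0 < ∑ i, α i) :
    ∃ c > 0, ∃ C > 0, ∀ x ∈ stdSimplex ℝ ι, ∀ y ∈ stdSimplex ℝ ι, ∀ U : ℕ → ℝ → ℝ,
      DeathSol (deathRate (∑ i, α i)) U → (∀ m, U m 0 = bernKer α m fun i => x i * y i) →
      ∀ t, 0 < t → ∀ m : ℕ, 1 / t ≤ (m : ℝ) + 1 →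
        c * exp (-(C * ((1 - aff x y) / t))) * volF α (1 / t) x ≤ U m t := by
  obtain ⟨t₁, ht₁, c1, hc1, C1, hC1, h1⟩ := le_deathSol_bernKer_near hα hθ
  obtain ⟨c2, hc2, C2, hC2, h2⟩ := le_deathSol_bernKer_far hα hθ ht₁
  refine ⟨min c1 c2, lt_min hc1 hc2, max C1 C2, lt_max_of_lt_left hC1,
    fun x hx y hy U hU hU0 t ht m hm => ?_⟩
  have he := sub_nonneg.2 (aff_le_one hx hy)
  have hF : 0 < volF α (1 / t) x := volF_pos (by positivity) hx.1
  by_cases h : t ≤ t₁ ∧ 1 - aff x y ≤ 1 / 2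
  · refine le_trans ?_ (h1 x hx y hy U hU hU0 h.2 t ht h.1 m hm)
    gcongr
    · exact min_le_left _ _
    · exact le_max_left _ _
  · refine le_trans ?_ (h2 x hx y hy U hU hU0 t ht ?_ m)
    · gcongr
      · exact min_le_right _ _
      · exact le_max_right _ _
    · by_contra! hc
      exact h ⟨hc.1.le, hc.2.le⟩

end DeathBern

section DeathSum

def deathSum (θ : ℝ) (Z : ℕ → ℝ) (m : ℕ) (t : ℝ) : ℝ :=
  ∑ k ∈ Finset.range (m + 1), exp (-deathRate θ k * t) * (gam θ m k * Z k)

theorem deathSuper_deathSum {θ : ℝ} (hθ : 0 < θ) (Z : ℕ → ℝ) :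
    DeathSuper (deathRate θ) (deathSum θ Z) := by
  refine ⟨fun m t => ∑ k ∈ Finset.range (m + 1),
    exp (-deathRate θ k * t) * (-deathRate θ k) * (gam θ m k * Z k), ?_, ?_, ?_⟩
  · intro m t _
    refine HasDerivAt.fun_sum fun k _ => ?_
    refine HasDerivAt.mul_const (HasDerivAt.exp ?_) _
    exact ((hasDerivAt_id' t).const_mul (-deathRate θ k)).congr_deriv (mul_one _)
  · intro t _
    simp [deathRate]
  · intro m t _
    refine le_of_eq ?_
    have h1 : deathSum θ Z m t = ∑ k ∈ Finset.range (m + 1 + 1),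
        exp (-deathRate θ k * t) * (gam θ m k * Z k) := by
      rw [Finset.sum_range_succ _ (m + 1), gam_eq_zero (Nat.lt_succ_self m)]
      simp [deathSum]
    rw [h1, deathSum, ← Finset.sum_sub_distrib, Finset.mul_sum]
    refine Finset.sum_congr rfl fun k _ => ?_
    have h2 := gam_succ hθ m k
    rw [← deathRate_succ, ← show deathRate θ k = k * (k + θ - 1) from rfl] at h2
    linear_combination exp (-deathRate θ k * t) * Z k * h2

theorem deathSol_deathSum {θ : ℝ} (hθ : 0 < θ) (Z : ℕ → ℝ) :
    DeathSol (deathRate θ) (deathSum θ Z) := by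
  refine ⟨deathSuper_deathSum hθ Z, ?_⟩
  have h : (fun m t => -deathSum θ Z m t) = deathSum θ fun k => -Z k := by
    funext m t
    simp [deathSum]
  rw [h]
  exact deathSuper_deathSum hθ _

theorem deathSum_zero_right (θ : ℝ) (Z : ℕ → ℝ) (m : ℕ) :
    deathSum θ Z m 0 = ∑ k ∈ Finset.range (m + 1), gam θ m k * Z k := by
  simp [deathSum]

theorem tendsto_deathSum {θ : ℝ} (hθ : 0 < θ) {Z : ℕ → ℝ} {t : ℝ}
    (hs : Summable fun k => exp (-deathRate θ k * t) * |Z k|) :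
    Filter.Tendsto (fun m => deathSum θ Z m t) Filter.atTop
      (nhds (∑' k, exp (-deathRate θ k * t) * Z k)) := by
  have h1 : ∀ m, deathSum θ Z m t = ∑' k, exp (-deathRate θ k * t) * (gam θ m k * Z k) := by
    intro m
    rw [deathSum, tsum_eq_sum]
    intro k hk
    rw [Finset.mem_range] at hk
    rw [gam_eq_zero (by omega)]; simp
  simp_rw [h1]
  refine tendsto_tsum_of_dominated_convergence hs (fun k => ?_) (Filter.Eventually.of_forall
    fun m k => ?_)
  · have h2 := ((tendsto_gam hθ k).mul_const (Z k)).const_mul (exp (-deathRate θ k * t))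
    rwa [one_mul] at h2
  · rw [norm_mul, norm_mul, norm_eq_abs, norm_eq_abs, norm_eq_abs, abs_of_nonneg (exp_pos _).le,
      abs_of_nonneg (gam_nonneg hθ m k)]
    gcongr
    exact mul_le_of_le_one_left (abs_nonneg _) (gam_le_one hθ m k)

theorem summable_of_deathSum_le {θ : ℝ} (hθ : 0 < θ) {Z : ℕ → ℝ} (hZ : ∀ k, 0 ≤ Z k) {t C : ℝ}
    (h : ∀ᶠ m in Filter.atTop, deathSum θ Z m t ≤ C) :
    Summable fun k => exp (-deathRate θ k * t) * Z k := by
  refine summable_of_sum_range_le (c := C) (fun k => mul_nonneg (exp_pos _).le (hZ k)) fun K => ?_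
  have h1 : Filter.Tendsto (fun m => ∑ k ∈ Finset.range K,
      exp (-deathRate θ k * t) * (gam θ m k * Z k)) Filter.atTop
      (nhds (∑ k ∈ Finset.range K, exp (-deathRate θ k * t) * (1 * Z k))) :=
    tendsto_finsetSum _ fun k _ => ((tendsto_gam hθ k).mul_const (Z k)).const_mul _
  simp_rw [one_mul] at h1
  refine le_of_tendsto h1 ?_
  filter_upwards [h, Filter.eventually_ge_atTop K] with m hm hmK
  refine le_trans ?_ hm
  refine Finset.sum_le_sum_of_subset_of_nonneg (Finset.range_mono (by omega)) fun k _ _ => ?_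
  exact mul_nonneg (exp_pos _).le (mul_nonneg (gam_nonneg hθ m k) (hZ k))

end DeathSum

section Heat
variable {n : ℕ} {κ : Fin (n + 1) → ℝ} {N : ℕ → ℕ}
  {P : (k : ℕ) → Fin (N k) → MvPolynomial (Fin n) ℝ}

theorem two_mul_abs_projKer_le (k : ℕ) (x y : Fin n → ℝ) :
    2 * |projKer P k x y| ≤ projKer P k x x + projKer P k y y := by
  unfold projKer
  rw [← Finset.sum_add_distrib]
  refine (mul_le_mul_of_nonneg_left (Finset.abs_sum_le_sum_abs _ _) zero_le_two).trans ?_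
  rw [Finset.mul_sum]
  refine Finset.sum_le_sum fun j _ => ?_
  rw [abs_mul]
  nlinarith [sq_nonneg (|eval x (P k j)| - |eval y (P k j)|), abs_mul_abs_self (eval x (P k j)),
    abs_mul_abs_self (eval y (P k j))]

theorem projKer_self_nonneg (k : ℕ) (x : Fin n → ℝ) : 0 ≤ projKer P k x x :=
  Finset.sum_nonneg fun _ _ => mul_self_nonneg _

/-- Two-sided bounds in terms of the affinity of `x` and `y` and the volume function. -/
theorem heat_bounds
    (hdeg : ∀ k j, (P k j).totalDegree ≤ k)
    (hspan : ∀ m : ℕ, ∀ Q : MvPolynomial (Fin n) ℝ, Q.totalDegree ≤ m →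
      Q ∈ Submodule.span ℝ {R | ∃ k ≤ m, ∃ j, R = P k j})
    (hκ : ∀ i, 0 < shift κ i)
    (horth : ∀ (k : ℕ) (j : Fin (N k)) (k' : ℕ) (j' : Fin (N k')),
      polyInt hκ (P k j * P k' j') = if (⟨k, j⟩ : Σ k, Fin (N k)) = ⟨k', j'⟩ then 1 else 0) :
    ∃ c₁ > 0, ∃ C₁ > 0, ∃ C₂ > 0, ∃ c₂ > 0, ∀ x y : Fin n → ℝ,
      bary x ∈ stdSimplex ℝ (Fin (n + 1)) → bary y ∈ stdSimplex ℝ (Fin (n + 1)) → ∀ t, 0 < t →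
      c₁ * exp (-(C₁ * ((1 - aff (bary x) (bary y)) / t))) * volF (shift κ) (1 / t) (bary x) ≤
        ∑' k, exp (-deathRate (∑ i, shift κ i) k * t) * projKer P k x y ∧
      ∑' k, exp (-deathRate (∑ i, shift κ i) k * t) * projKer P k x y ≤
        C₂ * exp (-(c₂ * ((1 - aff (bary x) (bary y)) / t))) *
          volF (shift κ) (1 / t) (bary x) := by
  have hθ := sum_shift_pos hκ
  obtain ⟨C₂, hC₂, c₂, hc₂, hup⟩ := deathSol_bernKer_le hκ hθ
  obtain ⟨c₁, hc₁, C₁, hC₁, hlow⟩ := le_deathSol_bernKer hκ hθ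
  refine ⟨c₁, hc₁, C₁, hC₁, C₂, hC₂, c₂, hc₂, fun x y hx hy t ht => ?_⟩
  set θ := ∑ i, shift κ i with hθ_def
  have hU : ∀ x y : Fin n → ℝ, DeathSol (deathRate θ) (deathSum θ fun k => projKer P k x y) :=
    fun x y => deathSol_deathSum hθ _
  have hU0 : ∀ (x y : Fin n → ℝ) m, deathSum θ (fun k => projKer P k x y) m 0 =
      bernKer (shift κ) m fun i => bary x i * bary y i := fun x y m => by
    rw [deathSum_zero_right, bernKer_expansion hdeg hspan hκ horth]
  have hev : ∀ᶠ m : ℕ in Filter.atTop, 1 / t ≤ (m : ℝ) + 1 := by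
    filter_upwards [Filter.eventually_ge_atTop ⌈1 / t⌉₊] with m hm
    have := Nat.ceil_le.1 hm
    linarith
  have hsd : ∀ x : Fin n → ℝ, bary x ∈ stdSimplex ℝ (Fin (n + 1)) →
      Summable fun k => exp (-deathRate θ k * t) * projKer P k x x := fun x hx => by
    refine summable_of_deathSum_le hθ (fun k => projKer_self_nonneg k x)
      (C := C₂ * exp (-(c₂ * ((1 - aff (bary x) (bary x)) / t))) * volF (shift κ) (1 / t) (bary x))
      ?_
    filter_upwards [hev] with m hm
    exact hup _ hx _ hx _ (hU x x) (hU0 x x) t ht m hm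
  have hs : Summable fun k => exp (-deathRate θ k * t) * |projKer P k x y| := by
    refine Summable.of_nonneg_of_le (fun k => mul_nonneg (exp_pos _).le (abs_nonneg _))
      (fun k => ?_) ((hsd x hx).add (hsd y hy))
    rw [← mul_add]
    have h1 := two_mul_abs_projKer_le (P := P) k x y
    have h2 := abs_nonneg (projKer P k x y)
    gcongr
    linarith
  have hlim := tendsto_deathSum hθ hs
  constructor
  · refine ge_of_tendsto hlim ?_
    filter_upwards [hev] with m hm
    exact hlow _ hx _ hy _ (hU x y) (hU0 x y) t ht m hm
  · refine le_of_tendsto hlim ?_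
    filter_upwards [hev] with m hm
    exact hup _ hx _ hy _ (hU x y) (hU0 x y) t ht m hm

end Heat

section Volume
variable {n : ℕ} {κ : Fin (n + 1) → ℝ}

def baryDef (x y : Fin n → ℝ) : ℝ := 1 - aff (bary x) (bary y)

theorem baryDef_nonneg {x y : Fin n → ℝ} (hx : bary x ∈ stdSimplex ℝ (Fin (n + 1)))
    (hy : bary y ∈ stdSimplex ℝ (Fin (n + 1))) : 0 ≤ baryDef x y :=
  sub_nonneg.2 (aff_le_one hx hy)

theorem sum_le_one_of_bary_mem {x : Fin n → ℝ} (hx : bary x ∈ stdSimplex ℝ (Fin (n + 1))) :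
    ∑ i, x i ≤ 1 := by
  have := hx.1 (Fin.last n)
  simpa [bary] using this

theorem cos_simplexDist {x y : Fin n → ℝ} (hx : bary x ∈ stdSimplex ℝ (Fin (n + 1)))
    (hy : bary y ∈ stdSimplex ℝ (Fin (n + 1))) : cos (simplexDist n x y) = 1 - baryDef x y := by
  rw [simplexDist_eq (sum_le_one_of_bary_mem hx), cos_arccos, baryDef, sub_sub_cancel]
  · linarith [aff_nonneg (bary x) (bary y)]
  · exact aff_le_one hx hy

theorem simplexDist_nonneg (x y : Fin n → ℝ) : 0 ≤ simplexDist n x y := arccos_nonneg _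

theorem baryDef_le {x y : Fin n → ℝ} (hx : bary x ∈ stdSimplex ℝ (Fin (n + 1)))
    (hy : bary y ∈ stdSimplex ℝ (Fin (n + 1))) : baryDef x y ≤ simplexDist n x y ^ 2 / 2 := by
  have := one_sub_sq_div_two_le_cos (x := simplexDist n x y)
  rw [cos_simplexDist hx hy] at this
  linarith

theorem le_baryDef {x y : Fin n → ℝ} (hx : bary x ∈ stdSimplex ℝ (Fin (n + 1)))
    (hy : bary y ∈ stdSimplex ℝ (Fin (n + 1))) : simplexDist n x y ^ 2 / 5 ≤ baryDef x y := by
  have h := cos_le_one_sub_mul_cos_sq (x := simplexDist n x y)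
    (by rw [abs_of_nonneg (simplexDist_nonneg x y)]; exact arccos_le_pi _)
  rw [cos_simplexDist hx hy] at h
  have h1 : 1 / 5 ≤ 2 / π ^ 2 := by
    rw [div_le_div_iff₀ (by norm_num) (by positivity)]
    nlinarith [pi_lt_d2, pi_pos]
  nlinarith [sq_nonneg (simplexDist n x y)]

theorem continuous_simplexDist (x : Fin n → ℝ) : Continuous (simplexDist n x) := by
  unfold simplexDist
  exact continuous_arccos.comp (by fun_prop)

theorem measurableSet_dist_lt (x : Fin n → ℝ) (r : ℝ) :
    MeasurableSet {y | simplexDist n x y < r} :=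
  measurableSet_lt (continuous_simplexDist x).measurable measurable_const

theorem simplexVol_eq_integral (hκ : ∀ i, 0 < shift κ i) (x : Fin n → ℝ) (r : ℝ) :
    simplexVol n κ x r =
      ∫ y, Set.indicator {y | simplexDist n x y < r} (fun _ => (1 : ℝ)) y
        ∂simplexMeasure n κ := by
  have := isFiniteMeasure_simplexMeasure hκ
  rw [integral_indicator (measurableSet_dist_lt x r)]
  simp [simplexVol, Measure.real]

theorem integrable_ball (hκ : ∀ i, 0 < shift κ i) (x : Fin n → ℝ) (r : ℝ) :
    Integrable (Set.indicator {y | simplexDist n x y < r} (fun _ => (1 : ℝ)))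
      (simplexMeasure n κ) := by
  have := isFiniteMeasure_simplexMeasure hκ
  exact (integrable_const _).indicator (measurableSet_dist_lt x r)

theorem integrable_bernKer (hκ : ∀ i, 0 < shift κ i) (m : ℕ) (x : Fin n → ℝ) :
    Integrable (fun y => bernKer (shift κ) m fun i => bary x i * bary y i)
      (simplexMeasure n κ) := by
  simp_rw [← eval_bernPoly]
  exact integrable_eval hκ _

theorem simplexVol_mul_volF_le_of_le_one (hκ : ∀ i, 0 < shift κ i)
    (hQ : ∀ (m : ℕ) (x : Fin n → ℝ),
      ∫ y, bernKer (shift κ) m (fun i => bary x i * bary y i) ∂simplexMeasure n κ = 1) :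
    ∃ C > 0, ∀ x : Fin n → ℝ, bary x ∈ stdSimplex ℝ (Fin (n + 1)) → ∀ t, 0 < t → t ≤ 1 →
      simplexVol n κ x (√t) * volF (shift κ) (1 / t) (bary x) ≤ C := by
  obtain ⟨c, hc, B, hB, h1⟩ := le_bernKer hκ (sum_shift_pos hκ)
  obtain ⟨K, hK⟩ := volF_le_volF_scale (shift κ)
  refine ⟨2 ^ K / (c * exp (-(B / 2))), by positivity, fun x hx t ht ht1 => ?_⟩
  set m := ⌊1 / t⌋₊ with hm
  have hm1 : (m : ℝ) ≤ 1 / t := Nat.floor_le (by positivity)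
  have hm2 : 1 / t < m + 1 := Nat.lt_floor_add_one _
  have hF : volF (shift κ) (1 / t) (bary x) ≤ 2 ^ K * volF (shift κ) m (bary x) :=
    hK 2 (1 / t) m _ hx (by positivity) m.cast_nonneg (by norm_num)
      (by linarith [(m.cast_nonneg : (0 : ℝ) ≤ m)])
      (by linarith [(by positivity : 0 < 1 / t)])
  have hFm : 0 < volF (shift κ) m (bary x) := volF_pos m.cast_nonneg hx.1
  have h2 : c * exp (-(B / 2)) * volF (shift κ) m (bary x) * simplexVol n κ x (√t) ≤ 1 := by
    rw [simplexVol_eq_integral hκ, ← integral_const_mul]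
    refine le_of_le_of_eq ?_ (hQ m x)
    refine integral_mono_ae ((integrable_ball hκ x _).const_mul _) (integrable_bernKer hκ m x) ?_
    filter_upwards [ae_mem_simplexSet] with y hy
    have hy' := bary_mem_of_mem_simplexSet hy
    by_cases hyr : simplexDist n x y < √t
    · rw [Set.indicator_of_mem (show y ∈ {y | simplexDist n x y < √t} from hyr), mul_one]
      have h3 : simplexDist n x y ^ 2 ≤ t := by
        have := pow_le_pow_left₀ (simplexDist_nonneg x y) hyr.le 2
        rwa [sq_sqrt ht.le] at this
      have h4 : baryDef x y ≤ t / 2 := (baryDef_le hx hy').trans (by linarith)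
      have h5 := baryDef_nonneg hx hy'
      refine le_trans ?_ (h1 _ hx _ hy' (h4.trans (by linarith)) m)
      gcongr c * exp (-?_) * _
      have h6 : (m : ℝ) * baryDef x y ≤ 1 / t * (t / 2) := by gcongr
      have h7 : 1 / t * (t / 2) = 1 / 2 := by field_simp
      rw [← baryDef]
      nlinarith
    · rw [Set.indicator_of_notMem (show y ∉ {y | simplexDist n x y < √t} from hyr), mul_zero]
      exact bernKer_nonneg hκ _ fun i => mul_nonneg (hx.1 i) (hy'.1 i)
  have hV : 0 ≤ simplexVol n κ x (√t) := ENNReal.toReal_nonneg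
  rw [le_div_iff₀ (by positivity)]
  calc _ ≤ simplexVol n κ x (√t) * (2 ^ K * volF (shift κ) m (bary x)) *
        (c * exp (-(B / 2))) := by gcongr
    _ = 2 ^ K * (c * exp (-(B / 2)) * volF (shift κ) m (bary x) * simplexVol n κ x (√t)) := by
      ring
    _ ≤ 2 ^ K * 1 := by gcongr
    _ = _ := mul_one _

theorem simplexVol_mul_volF_le (hκ : ∀ i, 0 < shift κ i)
    (hQ : ∀ (m : ℕ) (x : Fin n → ℝ),
      ∫ y, bernKer (shift κ) m (fun i => bary x i * bary y i) ∂simplexMeasure n κ = 1) :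
    ∃ C > 0, ∀ x : Fin n → ℝ, bary x ∈ stdSimplex ℝ (Fin (n + 1)) → ∀ t, 0 < t →
      simplexVol n κ x (√t) * volF (shift κ) (1 / t) (bary x) ≤ C := by
  have := isFiniteMeasure_simplexMeasure hκ
  obtain ⟨C, hC, h1⟩ := simplexVol_mul_volF_le_of_le_one hκ hQ
  obtain ⟨K, hK⟩ := volF_le_pow (ι := Fin (n + 1)) (shift κ)
  refine ⟨max C ((simplexMeasure n κ).real Set.univ * 2 ^ K), lt_max_of_lt_left hC,
    fun x hx t ht => ?_⟩
  rcases le_total t 1 with h | h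
  · exact (h1 x hx t ht h).trans (le_max_left _ _)
  · refine le_trans ?_ (le_max_right _ _)
    have h2 : simplexVol n κ x (√t) ≤ (simplexMeasure n κ).real Set.univ :=
      measureReal_mono (Set.subset_univ _)
    have h3 : 1 / t ≤ 1 := by rw [div_le_one ht]; exact h
    have h4 : volF (shift κ) (1 / t) (bary x) ≤ 2 ^ K :=
      ((hK _ hx (1 / t) (by positivity)).1).trans
        (pow_le_pow_left₀ (by positivity) (by linarith) _)
    exact mul_le_mul h2 h4 (volF_pos (by positivity) hx.1).le measureReal_nonneg

end Volume

section Far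
variable {ι : Type*} [Fintype ι] [DecidableEq ι] {α : ι → ℝ}

theorem bernKer_le_exp_mul_bernKer_div_add_one (hα : ∀ i, 0 < α i) (hθ : 0 < ∑ i, α i) :
    ∃ D : ℕ, ∃ E > 0, ∀ x ∈ stdSimplex ℝ ι, ∀ y ∈ stdSimplex ℝ ι, ∀ m : ℕ,
      bernKer α m (fun i => x i * y i) ≤ E * exp (-(m * (1 - aff x y) / 2)) *
        (bernKer α (m / D) (fun i => x i * y i) + 1) := by
  obtain ⟨C, hC, h1⟩ := bernKer_le hα hθ
  obtain ⟨c, hc, B, hB, h2⟩ := le_bernKer hα hθ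
  obtain ⟨K, hK⟩ := volF_le_volF_scale α
  obtain ⟨L, hL⟩ := volF_le_pow α
  obtain ⟨C', hC', h3⟩ := one_add_pow_le_exp L (c := 1 / 4) (by norm_num)
  obtain ⟨D, hD⟩ := exists_nat_ge (max 1 (2 * B))
  have hD1 : (1 : ℝ) ≤ D := (le_max_left _ _).trans hD
  have hD2 : 2 * B ≤ D := (le_max_right _ _).trans hD
  have hD0 : 0 < D := by exact_mod_cast (zero_lt_one.trans_le hD1)
  refine ⟨D, max (C * D ^ K / c) (C * C'), lt_max_of_lt_right (by positivity),
    fun x hx y hy m => ?_⟩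
  have he : 0 ≤ 1 - aff x y := sub_nonneg.2 (aff_le_one hx hy)
  have hp := bernKer_nonneg (p := fun i => x i * y i) hα (m / D)
    fun i => mul_nonneg (hx.1 i) (hy.1 i)
  have h4 := h1 x hx y hy m
  have h5 := h2 x hx y hy
  generalize 1 - aff x y = e at *
  generalize bernKer α m (fun i => x i * y i) = Q at *
  rcases le_total e (1 / 2) with h | h
  · have h6 := h5 h (m / D)
    generalize bernKer α (m / D) (fun i => x i * y i) = Q' at *
    have h7 : ((m / D : ℕ) : ℝ) ≤ m / D := Nat.cast_div_le
    have h8 : (m : ℝ) + 1 ≤ D * ((m / D : ℕ) + 1) := by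
      exact_mod_cast Nat.lt_mul_div_succ m hD0
    have h9 := hK D m (m / D : ℕ) x hx m.cast_nonneg (Nat.cast_nonneg _) hD1
      (by linarith) (by
        have : ((m / D : ℕ) : ℝ) ≤ m := h7.trans (div_le_self m.cast_nonneg hD1)
        nlinarith [(m.cast_nonneg : (0 : ℝ) ≤ m)])
    have hF : 0 ≤ volF α (m / D : ℕ) x := (volF_pos (Nat.cast_nonneg _) hx.1).le
    have h10 : B * ((m / D : ℕ) * e) ≤ m * e / 2 := by
      rw [le_div_iff₀ (by positivity)] at h7
      nlinarith [mul_le_mul_of_nonneg_right hD2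
        (mul_nonneg (Nat.cast_nonneg (α := ℝ) (m / D)) he), mul_le_mul_of_nonneg_right h7 he]
    have h11 : c * exp (-(m * e / 2)) * volF α (m / D : ℕ) x ≤ Q' :=
      le_trans (by gcongr) h6
    calc Q ≤ C * exp (-(m * e)) * (D ^ K * volF α (m / D : ℕ) x) := h4.trans (by gcongr)
      _ = C * D ^ K / c * exp (-(m * e / 2)) *
          (c * exp (-(m * e / 2)) * volF α (m / D : ℕ) x) := by
        rw [show -(m * e) = -(m * e / 2) + -(m * e / 2) by ring, exp_add]
        field_simp
      _ ≤ _ := by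
        gcongr
        · exact le_max_left _ _
        · linarith
  · have h6 := (hL x hx m m.cast_nonneg).1
    have h7 := h3 m m.cast_nonneg
    have h8 : exp (1 / 4 * m) ≤ exp (m * e / 2) := by
      gcongr
      nlinarith [mul_le_mul_of_nonneg_left h (m.cast_nonneg : (0 : ℝ) ≤ m)]
    calc Q ≤ C * exp (-(m * e)) * (C' * exp (m * e / 2)) :=
          h4.trans (by gcongr; exact (h6.trans h7).trans (by gcongr))
      _ = C * C' * exp (-(m * e / 2)) * 1 := by
        rw [show -(m * e / 2) = -(m * e) + m * e / 2 by ring, exp_add]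
        ring
      _ ≤ _ := by
        gcongr
        · exact le_max_right _ _
        · linarith

end Far

section Volume
variable {n : ℕ} {κ : Fin (n + 1) → ℝ}

theorem bernKer_le_indicator_add (hκ : ∀ i, 0 < shift κ i) :
    ∃ D : ℕ, ∃ C > 0, ∃ K : ℕ, ∃ E > 0, ∀ A, 1 ≤ A → ∀ t, 0 < t →
      ∀ x y : Fin n → ℝ, bary x ∈ stdSimplex ℝ (Fin (n + 1)) →
      bary y ∈ stdSimplex ℝ (Fin (n + 1)) →
      bernKer (shift κ) ⌈A / t⌉₊ (fun i => bary x i * bary y i) ≤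
        C * (A + 2) ^ K * volF (shift κ) (1 / t) (bary x) *
          Set.indicator {y | simplexDist n x y < √t} (fun _ => (1 : ℝ)) y +
        E * exp (-(A / 10)) *
          (bernKer (shift κ) (⌈A / t⌉₊ / D) (fun i => bary x i * bary y i) + 1) := by
  obtain ⟨D, E, hE, h1⟩ := bernKer_le_exp_mul_bernKer_div_add_one hκ (sum_shift_pos hκ)
  obtain ⟨C, hC, h2⟩ := bernKer_le hκ (sum_shift_pos hκ)
  obtain ⟨K, hK⟩ := volF_le_volF_scale (shift κ)
  refine ⟨D, C, hC, K, E, hE, fun A hA1 t ht x y hx hy => ?_⟩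
  have hA : 0 < A := by linarith
  have hp := bernKer_nonneg (p := fun i => bary x i * bary y i) hκ (⌈A / t⌉₊ / D)
    fun i => mul_nonneg (hx.1 i) (hy.1 i)
  have h3 := h1 _ hx _ hy ⌈A / t⌉₊
  have h4 := h2 _ hx _ hy ⌈A / t⌉₊
  have he : 0 ≤ 1 - aff (bary x) (bary y) := baryDef_nonneg hx hy
  have hm1 : A / t ≤ ⌈A / t⌉₊ := Nat.le_ceil _
  have hm2 : (⌈A / t⌉₊ : ℝ) < A / t + 1 := Nat.ceil_lt_add_one (by positivity)
  have ht' : 0 < 1 / t := by positivity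
  have hAt : A / t = A * (1 / t) := by ring
  generalize bernKer (shift κ) ⌈A / t⌉₊ (fun i => bary x i * bary y i) = Q at *
  generalize bernKer (shift κ) (⌈A / t⌉₊ / D) (fun i => bary x i * bary y i) = Q' at *
  by_cases hyr : simplexDist n x y < √t
  · rw [Set.indicator_of_mem (show y ∈ {y | simplexDist n x y < √t} from hyr), mul_one]
    have h5 : 1 ≤ (⌈A / t⌉₊ : ℝ) := by
      exact_mod_cast Nat.one_le_ceil_iff.2 (by positivity : 0 < A / t)
    have h6 := hK (A + 2) ⌈A / t⌉₊ (1 / t) (bary x) hx (Nat.cast_nonneg _) ht'.le (by linarith)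
      (by nlinarith) (by nlinarith [mul_le_mul_of_nonneg_right hA1 ht'.le])
    have h7 : exp (-(⌈A / t⌉₊ * (1 - aff (bary x) (bary y)))) ≤ 1 := by
      rw [exp_le_one_iff]
      nlinarith [mul_nonneg (zero_le_one.trans h5) he]
    have h8 : 0 ≤ E * exp (-(A / 10)) * (Q' + 1) := by positivity
    have h9 : Q ≤ C * 1 * ((A + 2) ^ K * volF (shift κ) (1 / t) (bary x)) :=
      h4.trans (by gcongr; exact (volF_pos (Nat.cast_nonneg _) hx.1).le)
    linarith
  · rw [Set.indicator_of_notMem (show y ∉ {y | simplexDist n x y < √t} from hyr), mul_zero,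
      zero_add]
    suffices h : A / 10 ≤ ⌈A / t⌉₊ * (1 - aff (bary x) (bary y)) / 2 from
      h3.trans (by gcongr)
    have h5 : t ≤ simplexDist n x y ^ 2 := by
      have := pow_le_pow_left₀ (sqrt_nonneg t) (not_lt.1 hyr) 2
      rwa [sq_sqrt ht.le] at this
    have h6 : t / 5 ≤ 1 - aff (bary x) (bary y) := by
      have := le_baryDef hx hy
      rw [baryDef] at this
      linarith
    have h7 : A / t * (t / 5) ≤ ⌈A / t⌉₊ * (1 - aff (bary x) (bary y)) := by gcongr
    have h8 : A / t * (t / 5) = A / 5 := by field_simp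
    linarith

theorem le_simplexVol_mul_volF (hκ : ∀ i, 0 < shift κ i)
    (hQ : ∀ (m : ℕ) (x : Fin n → ℝ),
      ∫ y, bernKer (shift κ) m (fun i => bary x i * bary y i) ∂simplexMeasure n κ = 1) :
    ∃ c > 0, ∀ x : Fin n → ℝ, bary x ∈ stdSimplex ℝ (Fin (n + 1)) → ∀ t, 0 < t →
      c ≤ simplexVol n κ x (√t) * volF (shift κ) (1 / t) (bary x) := by
  have := isFiniteMeasure_simplexMeasure hκ
  obtain ⟨D, C, hC, K, E, hE, h1⟩ := bernKer_le_indicator_add hκ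
  set Z := (simplexMeasure n κ).real Set.univ with hZ
  have hZ0 : 0 ≤ Z := measureReal_nonneg
  obtain ⟨A, hA, hA2⟩ : ∃ A ≥ 1, E * exp (-(A / 10)) * (1 + Z) ≤ 1 / 2 := by
    refine ⟨10 * (2 * E * (1 + Z)) + 1, le_add_of_nonneg_left (by positivity), ?_⟩
    have h2 := add_one_le_exp ((10 * (2 * E * (1 + Z)) + 1) / 10)
    rw [exp_neg, mul_right_comm,
      ← div_eq_mul_inv, div_le_iff₀ (exp_pos _)]
    linarith
  refine ⟨1 / (2 * (C * (A + 2) ^ K)), by positivity, fun x hx t ht => ?_⟩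
  have h3 : (1 : ℝ) ≤ C * (A + 2) ^ K * volF (shift κ) (1 / t) (bary x) * simplexVol n κ x (√t) +
      E * exp (-(A / 10)) * (1 + Z) := by
    have hi := integrable_bernKer hκ (⌈A / t⌉₊ / D) x
    have hi' : Integrable (fun y =>
        bernKer (shift κ) (⌈A / t⌉₊ / D) (fun i => bary x i * bary y i) + 1)
        (simplexMeasure n κ) := hi.add (integrable_const _)
    have h4 : ∫ y, (bernKer (shift κ) (⌈A / t⌉₊ / D) (fun i => bary x i * bary y i) + 1)
        ∂simplexMeasure n κ = 1 + Z := by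
      rw [integral_add hi (integrable_const _), hQ, integral_const, smul_eq_mul, mul_one]
    rw [simplexVol_eq_integral hκ, ← integral_const_mul, ← h4, ← integral_const_mul,
      ← integral_add ((integrable_ball hκ x _).const_mul _)
        (hi'.const_mul _)]
    refine le_of_eq_of_le (hQ ⌈A / t⌉₊ x).symm ?_
    refine integral_mono_ae (integrable_bernKer hκ _ x)
      (((integrable_ball hκ x _).const_mul _).add
        (hi'.const_mul _)) ?_
    filter_upwards [ae_mem_simplexSet] with y hy
    exact h1 A hA t ht x y hx (bary_mem_of_mem_simplexSet hy)
  rw [div_le_iff₀ (by positivity)]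
  linarith

end Volume

section Comparison

theorem le_mul_sqrt_mul {a b w : ℝ} (ha : 0 ≤ a) (hb : 0 ≤ b) (hw : 1 ≤ w) (h : a ≤ w * b) :
    a ≤ w * √(a * b) := by
  rw [← sqrt_sq (zero_le_one.trans hw), ← sqrt_mul (sq_nonneg w)]
  refine le_sqrt_of_sq_le ?_
  calc a ^ 2 ≤ w * b * a := by rw [sq]; gcongr
    _ ≤ w ^ 2 * b * a := by
      gcongr
      nlinarith
    _ = _ := by ring

theorem sqrt_mul_le_mul {a b w : ℝ} (ha : 0 ≤ a) (hw : 1 ≤ w) (h : b ≤ w * a) :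
    √(a * b) ≤ w * a := by
  refine sqrt_le_iff.2 ⟨by positivity, ?_⟩
  calc a * b ≤ a * (w * a) := by gcongr
    _ ≤ a * (w ^ 2 * a) := by
      gcongr
      nlinarith
    _ = _ := by ring

theorem sqrt_mul_bounds {a b v w c C : ℝ} (hc : 0 < c) (ha : 0 < a) (hb : 0 < b)
    (hv : c ≤ v * a) (hw : c ≤ w * b) (hv' : v * a ≤ C) (hw' : w * b ≤ C) :
    c / √(v * w) ≤ √(a * b) ∧ √(a * b) ≤ C / √(v * w) := by
  have hv0 : 0 < v := pos_of_mul_pos_left (hc.trans_le hv) ha.le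
  have hw0 : 0 < w := pos_of_mul_pos_left (hc.trans_le hw) hb.le
  have h : √(a * b) * √(v * w) = √((v * a) * (w * b)) := by
    rw [← sqrt_mul (by positivity)]
    ring_nf
  have hs : 0 < √(v * w) := by positivity
  rw [div_le_iff₀ hs, le_div_iff₀ hs, h]
  constructor
  · refine le_sqrt_of_sq_le ?_
    rw [sq]
    gcongr
  · have hC := (hc.trans_le hv).le.trans hv'
    refine sqrt_le_iff.2 ⟨hC, ?_⟩
    rw [sq]
    gcongr

end Comparison

section Final
variable {n : ℕ} {κ : Fin (n + 1) → ℝ}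

theorem volF_comparable_sqrt (hκ : ∀ i, 0 < shift κ i)
    (hQ : ∀ (m : ℕ) (x : Fin n → ℝ),
      ∫ y, bernKer (shift κ) m (fun i => bary x i * bary y i) ∂simplexMeasure n κ = 1)
    {b : ℝ} (hb : 0 < b) :
    ∃ c > 0, ∃ C > 0, ∀ x y : Fin n → ℝ, bary x ∈ stdSimplex ℝ (Fin (n + 1)) →
      bary y ∈ stdSimplex ℝ (Fin (n + 1)) → ∀ t, 0 < t →
      c * exp (-(b * (baryDef x y / t))) / √(simplexVol n κ x (√t) * simplexVol n κ y (√t)) ≤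
        volF (shift κ) (1 / t) (bary x) ∧
      volF (shift κ) (1 / t) (bary x) ≤
        C * exp (b * (baryDef x y / t)) / √(simplexVol n κ x (√t) * simplexVol n κ y (√t)) := by
  obtain ⟨c, hc, h1⟩ := le_simplexVol_mul_volF hκ hQ
  obtain ⟨C, hC, h2⟩ := simplexVol_mul_volF_le hκ hQ
  obtain ⟨K, hK⟩ := volF_le_volF_point (shift κ)
  obtain ⟨C', hC', h3⟩ := one_add_pow_le_exp K (half_pos hb)
  refine ⟨c / (2 ^ K * C'), by positivity, C * (2 ^ K * C'), by positivity,
    fun x y hx hy t ht => ?_⟩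
  have ht' : 0 ≤ 1 / t := by positivity
  have hxy := hK (1 / t) _ hx _ hy ht'
  have hyx := hK (1 / t) _ hy _ hx ht'
  rw [aff_comm] at hyx
  have he : 0 ≤ baryDef x y := baryDef_nonneg hx hy
  have hW : (2 * (1 + 2 * (1 / t) * baryDef x y)) ^ K ≤
      2 ^ K * C' * exp (b * (baryDef x y / t)) := by
    rw [mul_pow, mul_assoc (2 ^ K)]
    refine mul_le_mul_of_nonneg_left ((h3 _ (by positivity)).trans_eq ?_) (by positivity)
    ring_nf
  have hW1 : 1 ≤ (2 * (1 + 2 * (1 / t) * baryDef x y)) ^ K :=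
    one_le_pow₀ (by linarith [(by positivity : 0 ≤ 2 * (1 / t) * baryDef x y)])
  rw [← baryDef] at hxy hyx
  have hFx : 0 < volF (shift κ) (1 / t) (bary x) := volF_pos ht' hx.1
  have hFy : 0 < volF (shift κ) (1 / t) (bary y) := volF_pos ht' hy.1
  obtain ⟨h4, h5⟩ := sqrt_mul_bounds hc hFx hFy (h1 x hx t ht) (h1 y hy t ht) (h2 x hx t ht)
    (h2 y hy t ht)
  have h6 := sqrt_mul_le_mul hFx.le hW1 hyx
  have h7 := le_mul_sqrt_mul hFx.le hFy.le hW1 hxy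
  generalize √(simplexVol n κ x (√t) * simplexVol n κ y (√t)) = S at *
  generalize (2 * (1 + 2 * (1 / t) * baryDef x y)) ^ K = W at *
  generalize b * (baryDef x y / t) = u at *
  have hu := exp_pos u
  constructor
  · calc c / (2 ^ K * C') * exp (-u) / S = (c / S) / (2 ^ K * C' * exp u) := by
          rw [exp_neg]; field_simp
      _ ≤ 2 ^ K * C' * exp u * volF (shift κ) (1 / t) (bary x) / (2 ^ K * C' * exp u) := by
          gcongr
          exact (h4.trans h6).trans (by gcongr)
      _ = _ := by field_simp
  · calc _ ≤ 2 ^ K * C' * exp u * (C / S) := h7.trans (by gcongr)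
      _ = _ := by ring

theorem sum_shift (κ : Fin (n + 1) → ℝ) : ∑ i, shift κ i = (∑ i, κ i) + ((n : ℝ) + 1) / 2 := by
  simp [shift, Finset.sum_add_distrib]
  ring

theorem simplexEig_eq_deathRate (κ : Fin (n + 1) → ℝ) (k : ℕ) :
    simplexEig n κ k = deathRate (∑ i, shift κ i) k := by
  rw [simplexEig, deathRate, sum_shift]
  ring

theorem simplexHeat_eq_tsum (P : (k : ℕ) → Fin (simplexNk n k) → MvPolynomial (Fin n) ℝ)
    (t : ℝ) (x y : Fin n → ℝ) : simplexHeat n κ P t x y =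
      ∑' k, exp (-deathRate (∑ i, shift κ i) k * t) * projKer P k x y := by
  simp only [simplexHeat, simplexEig_eq_deathRate, projKer]

end Final

/-- Two-sided Gaussian bounds for the heat kernel on the simplex. -/
theorem stmt1 (n : ℕ) (hn : 1 ≤ n) (κ : Fin (n + 1) → ℝ) (hκ : ∀ i, -(1 / 2 : ℝ) < κ i)
    (P : (k : ℕ) → Fin (simplexNk n k) → MvPolynomial (Fin n) ℝ)
    (hdeg : ∀ k j, (P k j).totalDegree ≤ k)
    (horth : ∀ (k : ℕ) (j : Fin (simplexNk n k)) (k' : ℕ) (j' : Fin (simplexNk n k')),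
      ∫ x, eval x (P k j) * eval x (P k' j') ∂(simplexMeasure n κ)
        = if (⟨k, j⟩ : Σ k, Fin (simplexNk n k)) = ⟨k', j'⟩ then 1 else 0)
    (hspan : ∀ m : ℕ, ∀ Q : MvPolynomial (Fin n) ℝ, Q.totalDegree ≤ m →
      Q ∈ Submodule.span ℝ {R | ∃ k ≤ m, ∃ j, R = P k j})
    (heig : ∀ (k : ℕ) (j : Fin (simplexNk n k)), ∀ x ∈ simplexSet n,
      eval x (simplexOp n κ (P k j)) = -(simplexEig n κ k) * eval x (P k j)) :
    ∃ c₁ > (0 : ℝ), ∃ c₂ > (0 : ℝ), ∃ c₃ > (0 : ℝ), ∃ c₄ > (0 : ℝ),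
      ∀ x : Fin n → ℝ, (∀ i, 0 ≤ x i) → (∑ i, x i) ≤ 1 →
      ∀ y : Fin n → ℝ, (∀ i, 0 ≤ y i) → (∑ i, y i) ≤ 1 →
      ∀ t : ℝ, 0 < t →
        c₁ * Real.exp (-(simplexDist n x y) ^ 2 / (c₂ * t)) /
            Real.sqrt (simplexVol n κ x (Real.sqrt t) * simplexVol n κ y (Real.sqrt t))
          ≤ simplexHeat n κ P t x y ∧
        simplexHeat n κ P t x y ≤
          c₃ * Real.exp (-(simplexDist n x y) ^ 2 / (c₄ * t)) /
            Real.sqrt (simplexVol n κ x (Real.sqrt t) * simplexVol n κ y (Real.sqrt t)) := by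
  have hs : ∀ i, 0 < shift κ i := fun i => by
    have := hκ i
    unfold shift
    linarith
  have horth' : ∀ (k : ℕ) (j : Fin (simplexNk n k)) (k' : ℕ) (j' : Fin (simplexNk n k')),
      polyInt hs (P k j * P k' j') =
        if (⟨k, j⟩ : Σ k, Fin (simplexNk n k)) = ⟨k', j'⟩ then 1 else 0 := fun k j k' j' => by
    rw [polyInt_apply, ← horth]
    simp_rw [map_mul]
  have hQ := integral_bernKer hspan hs
  obtain ⟨c₁, hc₁, b₁, hb₁, c₂, hc₂, b₂, hb₂, hheat⟩ := heat_bounds hdeg hspan hs horth'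
  obtain ⟨d₁, hd₁, _, _, hlow⟩ := volF_comparable_sqrt hs hQ one_pos
  obtain ⟨_, _, d₂, hd₂, hupp⟩ := volF_comparable_sqrt hs hQ (half_pos hb₂)
  refine ⟨c₁ * d₁, by positivity, 2 / (b₁ + 1), by positivity, c₂ * d₂, by positivity, 10 / b₂,
    by positivity, fun x hx hx1 y hy hy1 t ht => ?_⟩
  have hbx := bary_mem_stdSimplex hx hx1
  have hby := bary_mem_stdSimplex hy hy1
  obtain ⟨h1, h2⟩ := hheat x y hbx hby t ht
  rw [← baryDef, ← simplexHeat_eq_tsum] at h1 h2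
  have h3 := (hlow x y hbx hby t ht).1
  have h4 := (hupp x y hbx hby t ht).2
  have h5 : baryDef x y / t ≤ simplexDist n x y ^ 2 / 2 / t := by
    gcongr
    exact baryDef_le hbx hby
  have h6 : simplexDist n x y ^ 2 / 5 / t ≤ baryDef x y / t := by
    gcongr
    exact le_baryDef hbx hby
  constructor
  · refine le_trans ?_ h1
    refine le_trans ?_ (mul_le_mul_of_nonneg_left h3 (by positivity))
    rw [← mul_div_assoc, mul_mul_mul_comm, ← exp_add]
    gcongr
    rw [neg_div, show simplexDist n x y ^ 2 / (2 / (b₁ + 1) * t) =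
      (b₁ + 1) * (simplexDist n x y ^ 2 / 2 / t) by field_simp]
    nlinarith
  · refine h2.trans ?_
    refine (mul_le_mul_of_nonneg_left h4 (by positivity)).trans ?_
    rw [← mul_div_assoc, mul_mul_mul_comm, ← exp_add]
    gcongr
    rw [neg_div, show simplexDist n x y ^ 2 / (10 / b₂ * t) =
      b₂ / 2 * (simplexDist n x y ^ 2 / 5 / t) by field_simp; ring]
    nlinarith

end
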